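/- arXiv:2106.03354 — 4 statements merged into one kernel-verified Lean document; each statement's English description precedes it below -/
import Mathlib

section
/- Let d ≥ 1 and let ρ be a probability density on ℝ^d with finite variance. Fix x in the interior of the support of ρ (so ρ(x) > 0), assume ρ is continuous at x, and let X_0,…,X_n be i.i.d. with density ρ. For the Hilbert kernel weight w_0(x) = ‖x−X_0‖^{−d} / Σ_{j=0}^n ‖x−X_j‖^{−d}, and any real β > 1, the β-th moment satisfies E[w_0(x)^β] ~ 1/((β−1)·n·ln n) as n → ∞, i.e. the ratio of the two sides tends to 1. -/
open MeasureTheory Filter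
noncomputable section

/-- Euclidean space `ℝ^d`. -/
abbrev Euc (d : ℕ) : Type := EuclideanSpace ℝ (Fin d)

/-- The Hilbert kernel weight `w_i(x) = ‖x−x_i‖^{−d} / Σ_j ‖x−x_j‖^{−d}`
for sample points `xs : Fin (n+1) → ℝ^d`. -/
def hilbertWeight (d n : ℕ) (x : Euc d) (xs : Fin (n + 1) → Euc d) (i : Fin (n + 1)) : ℝ :=
  ‖x - xs i‖ ^ (-(d : ℝ)) / ∑ j : Fin (n + 1), ‖x - xs j‖ ^ (-(d : ℝ))

def phiH {Ω : Type*} [MeasurableSpace Ω] (ν : Measure Ω) (T : Ω → ℝ) (t : ℝ) : ℝ :=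
  ∫ ω, Real.exp (-(t * T ω)) ∂ν

def AH {Ω : Type*} [MeasurableSpace Ω] (ν : Measure Ω) (T : Ω → ℝ) (β t : ℝ) : ℝ :=
  t ^ (β - 1) * ∫ ω, T ω ^ β * Real.exp (-(t * T ω)) ∂ν

lemma laplace_step {Ω : Type*} [MeasurableSpace Ω] (ν : Measure Ω) [IsProbabilityMeasure ν]
    (T : Ω → ℝ) (hT : Measurable T) (hT0 : ∀ ω, 0 ≤ T ω) (hTpos : ∀ᵐ ω ∂ν, 0 < T ω)
    (β : ℝ) (hβ : 1 < β) (n : ℕ) :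
    IntegrableOn (fun t => AH ν T β t * phiH ν T t ^ n) (Set.Ioi 0) ∧
    ∫ xs : Fin (n + 1) → Ω, (T (xs 0) / ∑ j, T (xs j)) ^ β ∂(Measure.pi fun _ => ν)
      = (∫ t in Set.Ioi 0, AH ν T β t * phiH ν T t ^ n) / Real.Gamma β := by
  have hΓ : 0 < Real.Gamma β := Real.Gamma_pos_of_pos (by linarith)
  set P : Measure (Fin (n + 1) → Ω) := Measure.pi fun _ => ν with hP
  let F : (Fin (n + 1) → Ω) → ℝ → ℝ := fun xs t =>
    t ^ (β - 1) * (T (xs 0) ^ β * Real.exp (-(t * ∑ j, T (xs j))))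
  have hFm : Measurable (Function.uncurry F) := by
    unfold F Function.uncurry
    fun_prop
  have hpos : ∀ᵐ xs ∂P, 0 < T (xs 0) := by
    have := (measurePreserving_eval (fun _ : Fin (n + 1) => ν) 0).quasiMeasurePreserving.ae hTpos
    simpa using this
  have hw : ∀ᵐ xs ∂P, ∫ t in Set.Ioi 0, F xs t
      = Real.Gamma β * (T (xs 0) / ∑ j, T (xs j)) ^ β := by
    filter_upwards [hpos] with xs hx
    have hS : 0 < ∑ j, T (xs j) :=
      lt_of_lt_of_le hx (Finset.single_le_sum (f := fun j => T (xs j))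
        (fun j _ => hT0 _) (Finset.mem_univ 0))
    have h1 := Real.integral_rpow_mul_exp_neg_mul_Ioi (a := β) (by linarith) hS
    have : ∀ t, F xs t = T (xs 0) ^ β * (t ^ (β - 1) * Real.exp (-((∑ j, T (xs j)) * t))) := by
      intro t; simp only [F]; rw [mul_comm t]; ring
    simp_rw [this]
    rw [integral_const_mul, h1, Real.div_rpow hx.le hS.le, Real.div_rpow zero_le_one hS.le]
    simp; ring
  have hFnn : ∀ xs, ∀ t ∈ Set.Ioi (0:ℝ), 0 ≤ F xs t := by
    intro xs t ht
    have := hT0 (xs 0)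
    have ht' : (0:ℝ) < t := ht
    simp only [F]; positivity
  have hnorm : ∀ xs, ∫ t in Set.Ioi 0, ‖F xs t‖ = ∫ t in Set.Ioi 0, F xs t := by
    intro xs
    apply setIntegral_congr_fun measurableSet_Ioi
    intro t ht
    exact Real.norm_of_nonneg (hFnn xs t ht)
  have hle : ∀ xs : Fin (n + 1) → Ω, 0 ≤ T (xs 0) / ∑ j, T (xs j) ∧
      T (xs 0) / ∑ j, T (xs j) ≤ 1 := fun xs =>
    ⟨div_nonneg (hT0 _) (Finset.sum_nonneg fun j _ => hT0 _),
      div_le_one_of_le₀ (Finset.single_le_sum (f := fun j => T (xs j))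
        (fun j _ => hT0 _) (Finset.mem_univ 0)) (Finset.sum_nonneg fun j _ => hT0 _)⟩
  have hint : Integrable (Function.uncurry F) (P.prod (volume.restrict (Set.Ioi 0))) := by
    rw [integrable_prod_iff hFm.aestronglyMeasurable]
    constructor
    · filter_upwards [hpos, hw] with xs hx h2
      by_contra hcon
      have h3 : ∫ t in Set.Ioi 0, F xs t = 0 := integral_undef hcon
      rw [h3] at h2
      have hS : 0 < ∑ j, T (xs j) :=
        lt_of_lt_of_le hx (Finset.single_le_sum (f := fun j => T (xs j))
          (fun j _ => hT0 _) (Finset.mem_univ 0))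
      have : 0 < Real.Gamma β * (T (xs 0) / ∑ j, T (xs j)) ^ β := by positivity
      linarith
    · simp only [Function.uncurry]
      simp_rw [hnorm]
      have : Integrable (fun xs : Fin (n + 1) → Ω =>
          Real.Gamma β * (T (xs 0) / ∑ j, T (xs j)) ^ β) P := by
        apply Integrable.const_mul
        apply Integrable.of_bound (C := 1)
        · apply Measurable.aestronglyMeasurable
          fun_prop
        · refine ae_of_all _ fun xs => ?_
          obtain ⟨h1, h2⟩ := hle xs
          rw [Real.norm_of_nonneg (Real.rpow_nonneg h1 _)]
          exact Real.rpow_le_one h1 h2 (by linarith)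
      exact this.congr (hw.mono fun _ h => h.symm)
  have hinner : ∀ t, ∫ xs, F xs t ∂P = AH ν T β t * phiH ν T t ^ n := by
    intro t
    have e : ∀ xs : Fin (n + 1) → Ω, F xs t = t ^ (β - 1) *
        ∏ i, (Fin.cons (fun ω => T ω ^ β * Real.exp (-(t * T ω)))
          (fun _ ω => Real.exp (-(t * T ω))) : Fin (n + 1) → Ω → ℝ) i (xs i) := by
      intro xs
      rw [Fin.prod_univ_succ]
      simp only [F, Fin.cons_zero, Fin.cons_succ]
      rw [← Real.exp_sum, mul_assoc (T (xs 0) ^ β), ← Real.exp_add, Fin.sum_univ_succ,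
        mul_add, Finset.mul_sum, neg_add, Finset.sum_neg_distrib]
    simp_rw [e]
    rw [integral_const_mul, integral_fintype_prod_eq_prod, Fin.prod_univ_succ]
    simp [AH, phiH, mul_assoc]
  constructor
  · have := hint.integral_prod_right
    refine this.congr (ae_of_all _ fun t => ?_)
    exact hinner t
  · have := integral_integral_swap hint
    simp_rw [hinner] at this
    rw [← this, integral_congr_ae hw, integral_const_mul]
    field_simp

lemma phiH_le_one {Ω : Type*} [MeasurableSpace Ω] (ν : Measure Ω) [IsProbabilityMeasure ν]
    (T : Ω → ℝ) (hT : Measurable T) (hT0 : ∀ ω, 0 ≤ T ω) {t : ℝ} (ht : 0 ≤ t) :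
    Integrable (fun ω => Real.exp (-(t * T ω))) ν := by
  apply Integrable.of_bound (C := 1)
  · apply Measurable.aestronglyMeasurable
    fun_prop
  · refine ae_of_all _ fun ω => ?_
    rw [Real.norm_of_nonneg (Real.exp_pos _).le, Real.exp_le_one_iff]
    have := mul_nonneg ht (hT0 ω)
    linarith

lemma phiH_nonneg {Ω : Type*} [MeasurableSpace Ω] (ν : Measure Ω) (T : Ω → ℝ) (t : ℝ) :
    0 ≤ phiH ν T t := integral_nonneg fun _ => (Real.exp_pos _).le

lemma phiH_anti {Ω : Type*} [MeasurableSpace Ω] (ν : Measure Ω) [IsProbabilityMeasure ν]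
    (T : Ω → ℝ) (hT : Measurable T) (hT0 : ∀ ω, 0 ≤ T ω) {s t : ℝ} (hs : 0 ≤ s) (hst : s ≤ t) :
    phiH ν T t ≤ phiH ν T s := by
  apply integral_mono (phiH_le_one ν T hT hT0 (hs.trans hst)) (phiH_le_one ν T hT hT0 hs)
  intro ω
  simp only
  gcongr
  exact hT0 ω

lemma phiH_lt_one {Ω : Type*} [MeasurableSpace Ω] (ν : Measure Ω) [IsProbabilityMeasure ν]
    (T : Ω → ℝ) (hT : Measurable T) (hT0 : ∀ ω, 0 ≤ T ω) (hTpos : ∀ᵐ ω ∂ν, 0 < T ω)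
    {t : ℝ} (ht : 0 < t) : phiH ν T t < 1 := by
  have h1 : phiH ν T t ≤ 1 := by
    have := phiH_anti ν T hT hT0 le_rfl ht.le
    simpa [phiH] using this
  refine lt_of_le_of_ne h1 fun h => ?_
  have hi := phiH_le_one ν T hT hT0 ht.le
  have h0 : ∫ ω, (1 - Real.exp (-(t * T ω))) ∂ν = 0 := by
    rw [integral_sub (integrable_const _) hi]
    unfold phiH at h
    simp [h]
  rw [integral_eq_zero_iff_of_nonneg] at h0
  · have : ∀ᵐ ω ∂ν, False := by
      filter_upwards [h0, hTpos] with ω h2 h3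
      simp only [Pi.zero_apply] at h2
      have : Real.exp (-(t * T ω)) < 1 := by
        rw [Real.exp_lt_one_iff]
        have := mul_pos ht h3
        linarith
      linarith
    simp at this
    exact IsProbabilityMeasure.ne_zero ν this
  · intro ω
    simp only [Pi.zero_apply, sub_nonneg, Real.exp_le_one_iff]
    have := mul_nonneg ht.le (hT0 ω)
    linarith
  · exact (integrable_const _).sub hi

lemma phiH_meas {Ω : Type*} [MeasurableSpace Ω] (ν : Measure Ω) [IsProbabilityMeasure ν]
    (T : Ω → ℝ) (hT : Measurable T) : Measurable (phiH ν T) := by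
  apply StronglyMeasurable.measurable
  apply StronglyMeasurable.integral_prod_right (f := fun t ω => Real.exp (-(t * T ω)))
  apply Measurable.stronglyMeasurable
  unfold Function.uncurry
  fun_prop

lemma AH_meas {Ω : Type*} [MeasurableSpace Ω] (ν : Measure Ω) [IsProbabilityMeasure ν]
    (T : Ω → ℝ) (hT : Measurable T) (β : ℝ) : Measurable (AH ν T β) := by
  unfold AH
  refine Measurable.mul (by fun_prop) ?_
  apply StronglyMeasurable.measurable
  apply StronglyMeasurable.integral_prod_right
    (f := fun t ω => T ω ^ β * Real.exp (-(t * T ω)))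
  apply Measurable.stronglyMeasurable
  unfold Function.uncurry
  fun_prop

lemma AH_nonneg {Ω : Type*} [MeasurableSpace Ω] (ν : Measure Ω)
    (T : Ω → ℝ) (hT0 : ∀ ω, 0 ≤ T ω) (β : ℝ) {t : ℝ} (ht : 0 ≤ t) : 0 ≤ AH ν T β t := by
  unfold AH
  refine mul_nonneg (Real.rpow_nonneg ht _) (integral_nonneg fun ω => ?_)
  exact mul_nonneg (Real.rpow_nonneg (hT0 ω) _) (Real.exp_pos _).le

lemma layer_real {Ω : Type*} [MeasurableSpace Ω] (ν : Measure Ω) [IsProbabilityMeasure ν]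
    (T : Ω → ℝ) (hT : Measurable T) (hT0 : ∀ ω, 0 ≤ T ω)
    (g : ℝ → ℝ) (hg : Continuous g) (hg0 : ∀ t, 0 < t → 0 ≤ g t) :
    ∫ ω, (∫ u in (0:ℝ)..T ω, g u) ∂ν = ∫ u in Set.Ioi 0, ν.real {ω | u < T ω} * g u := by
  have hGm : Measurable (fun u : ℝ => ν.real {ω | u < T ω}) := by
    apply Antitone.measurable
    intro a b hab
    exact measureReal_mono (fun ω (h : b < T ω) => lt_of_le_of_lt hab h)
  have h := lintegral_comp_eq_lintegral_meas_lt_mul ν (ae_of_all _ hT0) hT.aemeasurable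
    (g := g) (fun t _ => hg.intervalIntegrable _ _)
    ((ae_restrict_iff' measurableSet_Ioi).2 (ae_of_all _ fun t ht => hg0 t ht))
  have hc : Continuous (fun x => ∫ u in (0:ℝ)..x, g u) :=
    intervalIntegral.continuous_primitive (fun a b => hg.intervalIntegrable a b) 0
  rw [integral_eq_lintegral_of_nonneg_ae, integral_eq_lintegral_of_nonneg_ae, h]
  · congr 1
    apply lintegral_congr
    intro u
    rw [ENNReal.ofReal_mul measureReal_nonneg, ofReal_measureReal]
  · refine (ae_restrict_iff' measurableSet_Ioi).2 (ae_of_all _ fun t ht => ?_)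
    exact mul_nonneg measureReal_nonneg (hg0 t ht)
  · exact (hGm.mul hg.measurable).aestronglyMeasurable
  · refine ae_of_all _ fun ω => ?_
    exact intervalIntegral.integral_nonneg_of_ae_restrict (hT0 ω) (by
      rw [← restrict_Ioc_eq_restrict_Icc]
      exact (ae_restrict_iff' measurableSet_Ioc).2 (ae_of_all _ fun t ht => hg0 t ht.1))
  · exact (hc.measurable.comp hT).aestronglyMeasurable

lemma tail_bound {Ω : Type*} [MeasurableSpace Ω] (ν : Measure Ω) [IsProbabilityMeasure ν]
    (T : Ω → ℝ) (c : ℝ)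
    (htail : Tendsto (fun s : ℝ => s * ν.real {ω | s < T ω}) atTop (nhds c)) :
    ∃ M : ℝ, 0 < M ∧ ∀ s, 0 < s → s * ν.real {ω | s < T ω} ≤ M := by
  have h := htail.eventually (gt_mem_nhds (lt_add_one c))
  obtain ⟨s0, hs0⟩ := eventually_atTop.1 h
  refine ⟨max (max s0 (c + 1)) 1, by positivity, fun s hs => ?_⟩
  rcases le_total s0 s with h1 | h1
  · exact (hs0 s h1).le.trans ((le_max_right _ _).trans (le_max_left _ _))
  · refine le_trans ?_ ((le_max_left _ _).trans (le_max_left _ _))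
    calc s * ν.real {ω | s < T ω} ≤ s * 1 := by gcongr; exact measureReal_le_one
      _ ≤ s0 := by linarith

lemma scaled_limit {Ω : Type*} [MeasurableSpace Ω] (ν : Measure Ω) [IsProbabilityMeasure ν]
    (T : Ω → ℝ) (hT : Measurable T) (hT0 : ∀ ω, 0 ≤ T ω) (c : ℝ)
    (htail : Tendsto (fun s : ℝ => s * ν.real {ω | s < T ω}) atTop (nhds c))
    (g : ℝ → ℝ) (hg : Continuous g) (hg0 : ∀ t, 0 < t → 0 ≤ g t)
    (hgi : IntegrableOn (fun v => g v / v) (Set.Ioi 0)) :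
    Tendsto (fun t : ℝ => t⁻¹ * ∫ ω, (∫ u in (0:ℝ)..(t * T ω), g u) ∂ν) (nhdsWithin 0 (Set.Ioi 0))
      (nhds (c * ∫ v in Set.Ioi 0, g v / v)) := by
  obtain ⟨M, hM, hMb⟩ := tail_bound ν T c htail
  have hGm : Measurable (fun u : ℝ => ν.real {ω | u < T ω}) := by
    apply Antitone.measurable
    intro a b hab
    exact measureReal_mono (fun ω (h : b < T ω) => lt_of_le_of_lt hab h)
  have key : ∀ t ∈ Set.Ioi (0:ℝ), ∫ v in Set.Ioi 0, ((v / t) * ν.real {ω | v / t < T ω}) * (g v / v)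
      = t⁻¹ * ∫ ω, (∫ u in (0:ℝ)..(t * T ω), g u) ∂ν := by
    intro t ht
    have ht' : (0:ℝ) < t := ht
    rw [layer_real ν (fun ω => t * T ω) (by fun_prop) (fun ω => mul_nonneg ht'.le (hT0 ω)) g hg hg0,
      ← integral_const_mul]
    apply setIntegral_congr_fun measurableSet_Ioi
    intro v hv
    have hv' : (0:ℝ) < v := hv
    have : {ω | v / t < T ω} = {ω | v < t * T ω} := by
      ext ω; simp only [Set.mem_ofPred_eq]; rw [div_lt_iff₀' ht']
    simp only [this]
    field_simp
  rw [← integral_const_mul]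
  refine Tendsto.congr' (eventually_nhdsWithin_of_forall key) ?_
  apply tendsto_integral_filter_of_dominated_convergence (fun v => M * (g v / v))
  · filter_upwards with t
    apply Measurable.aestronglyMeasurable
    have : Measurable (fun v : ℝ => ν.real {ω | v / t < T ω}) := hGm.comp (measurable_id.div_const t)
    have := hg.measurable
    fun_prop
  · refine eventually_nhdsWithin_of_forall fun t ht => ?_
    have ht' : (0:ℝ) < t := ht
    refine (ae_restrict_iff' measurableSet_Ioi).2 (ae_of_all _ fun v hv => ?_)
    have hv' : (0:ℝ) < v := hv
    have h1 : 0 ≤ g v / v := div_nonneg (hg0 v hv') hv'.le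
    rw [Real.norm_of_nonneg (by positivity)]
    gcongr
    exact hMb _ (by positivity)
  · exact hgi.const_mul M
  · refine (ae_restrict_iff' measurableSet_Ioi).2 (ae_of_all _ fun v hv => ?_)
    refine Tendsto.mul_const _ ?_
    have hv' : (0:ℝ) < v := hv
    have : Tendsto (fun t : ℝ => v / t) (nhdsWithin 0 (Set.Ioi 0)) atTop := by
      simp_rw [div_eq_mul_inv]
      exact tendsto_inv_nhdsGT_zero.const_mul_atTop hv'
    exact htail.comp this

lemma prim_integrable {Ω : Type*} [MeasurableSpace Ω] (ν : Measure Ω) [IsProbabilityMeasure ν]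
    (T : Ω → ℝ) (hT : Measurable T) (hT0 : ∀ ω, 0 ≤ T ω)
    (g : ℝ → ℝ) (hg : Continuous g) (hg0 : ∀ t, 0 < t → 0 ≤ g t)
    (hgi : IntegrableOn g (Set.Ioi 0)) :
    Integrable (fun ω => ∫ u in (0:ℝ)..T ω, g u) ν := by
  have hc : Continuous (fun x => ∫ u in (0:ℝ)..x, g u) :=
    intervalIntegral.continuous_primitive (fun a b => hg.intervalIntegrable a b) 0
  apply Integrable.of_bound (C := ∫ u in Set.Ioi 0, g u)
  · exact (hc.measurable.comp hT).aestronglyMeasurable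
  · refine ae_of_all _ fun ω => ?_
    rw [intervalIntegral.integral_of_le (hT0 ω), Real.norm_of_nonneg]
    · apply setIntegral_mono_set hgi
      · exact (ae_restrict_iff' measurableSet_Ioi).2 (ae_of_all _ fun t ht => hg0 t ht)
      · exact LE.le.eventuallyLE Set.Ioc_subset_Ioi_self
    · exact setIntegral_nonneg measurableSet_Ioc fun t ht => hg0 t ht.1

lemma AH_limit {Ω : Type*} [MeasurableSpace Ω] (ν : Measure Ω) [IsProbabilityMeasure ν]
    (T : Ω → ℝ) (hT : Measurable T) (hT0 : ∀ ω, 0 ≤ T ω) (c : ℝ)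
    (htail : Tendsto (fun s : ℝ => s * ν.real {ω | s < T ω}) atTop (nhds c))
    (β : ℝ) (hβ : 1 < β) :
    Tendsto (AH ν T β) (nhdsWithin 0 (Set.Ioi 0)) (nhds (c * Real.Gamma (β - 1))) := by
  let g1 : ℝ → ℝ := fun v => β * (Real.exp (-v) * v ^ (β - 1))
  let g2 : ℝ → ℝ := fun v => Real.exp (-v) * v ^ β
  have c1 : Continuous g1 := by
    have := Real.continuous_rpow_const (q := β - 1) (by linarith)
    unfold g1; fun_prop
  have c2 : Continuous g2 := by
    have := Real.continuous_rpow_const (q := β) (by linarith)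
    unfold g2; fun_prop
  have n1 : ∀ t, 0 < t → 0 ≤ g1 t := fun t ht => by
    have : 0 < β := by linarith
    simp only [g1]; positivity
  have n2 : ∀ t, 0 < t → 0 ≤ g2 t := fun t ht => by
    simp only [g2]; positivity
  have i1 : IntegrableOn g1 (Set.Ioi 0) := (Real.GammaIntegral_convergent (s := β) (by linarith)).const_mul β
  have i2 : IntegrableOn g2 (Set.Ioi 0) := by
    simpa using (Real.GammaIntegral_convergent (s := β + 1) (by linarith))
  have e1 : ∀ v ∈ Set.Ioi (0:ℝ), β * (Real.exp (-v) * v ^ (β - 1 - 1)) = g1 v / v := by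
    intro v hv
    rw [Real.rpow_sub_one (ne_of_gt hv)]
    simp only [g1]; ring
  have e2 : ∀ v ∈ Set.Ioi (0:ℝ), (Real.exp (-v) * v ^ (β - 1)) = g2 v / v := by
    intro v hv
    rw [Real.rpow_sub_one (ne_of_gt hv)]
    simp only [g2]; ring
  have j1 : IntegrableOn (fun v => g1 v / v) (Set.Ioi 0) :=
    IntegrableOn.congr_fun ((Real.GammaIntegral_convergent (s := β - 1) (by linarith)).const_mul β)
      e1 measurableSet_Ioi
  have j2 : IntegrableOn (fun v => g2 v / v) (Set.Ioi 0) :=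
    IntegrableOn.congr_fun (Real.GammaIntegral_convergent (s := β) (by linarith))
      e2 measurableSet_Ioi
  have v1 : ∫ v in Set.Ioi 0, g1 v / v = β * Real.Gamma (β - 1) := by
    rw [← setIntegral_congr_fun measurableSet_Ioi e1, integral_const_mul,
      ← Real.Gamma_eq_integral (by linarith)]
  have v2 : ∫ v in Set.Ioi 0, g2 v / v = (β - 1) * Real.Gamma (β - 1) := by
    rw [← setIntegral_congr_fun measurableSet_Ioi e2,
      ← Real.Gamma_eq_integral (by linarith)]
    have := Real.Gamma_add_one (s := β - 1) (by linarith)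
    simpa using this
  have l1 := scaled_limit ν T hT hT0 c htail g1 c1 n1 j1
  have l2 := scaled_limit ν T hT hT0 c htail g2 c2 n2 j2
  have l := l1.sub l2
  rw [v1, v2] at l
  have : c * (β * Real.Gamma (β - 1)) - c * ((β - 1) * Real.Gamma (β - 1))
      = c * Real.Gamma (β - 1) := by ring
  rw [this] at l
  refine l.congr' (eventually_nhdsWithin_of_forall fun t ht => ?_)
  have ht' : (0:ℝ) < t := ht
  have p1 := prim_integrable ν (fun ω => t * T ω) (by fun_prop)
    (fun ω => mul_nonneg ht'.le (hT0 ω)) g1 c1 n1 i1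
  have p2 := prim_integrable ν (fun ω => t * T ω) (by fun_prop)
    (fun ω => mul_nonneg ht'.le (hT0 ω)) g2 c2 n2 i2
  rw [← mul_sub, ← integral_sub p1 p2]
  unfold AH
  rw [← integral_const_mul, ← integral_const_mul]
  apply integral_congr_ae
  refine ae_of_all _ fun ω => ?_
  simp only
  rw [← intervalIntegral.integral_sub (c1.intervalIntegrable _ _) (c2.intervalIntegrable _ _)]
  have hd : ∀ x ∈ Set.uIcc 0 (t * T ω), HasDerivAt (fun x : ℝ => x ^ β * Real.exp (-x))
      (g1 x - g2 x) x := by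
    intro x _
    have := (Real.hasDerivAt_rpow_const (x := x) (p := β) (Or.inr hβ.le)).mul
      ((Real.hasDerivAt_exp (-x)).comp x (hasDerivAt_neg x))
    refine HasDerivAt.congr_deriv this ?_
    simp only [g1, g2, Function.comp_apply]; ring
  rw [intervalIntegral.integral_eq_sub_of_hasDerivAt hd ((c1.sub c2).intervalIntegrable _ _),
    Real.mul_rpow ht'.le (hT0 ω), Real.rpow_sub_one ht'.ne', Real.zero_rpow (by linarith)]
  ring

lemma psi_limit {Ω : Type*} [MeasurableSpace Ω] (ν : Measure Ω) [IsProbabilityMeasure ν]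
    (T : Ω → ℝ) (hT : Measurable T) (hT0 : ∀ ω, 0 ≤ T ω) (c : ℝ)
    (htail : Tendsto (fun s : ℝ => s * ν.real {ω | s < T ω}) atTop (nhds c)) :
    Tendsto (fun t => (1 - phiH ν T t) / (t * Real.log (1 / t))) (nhdsWithin 0 (Set.Ioi 0))
      (nhds c) := by
  obtain ⟨M, hM, hMb⟩ := tail_bound ν T c htail
  let H : ℝ → ℝ := fun s => s * ν.real {ω | s < T ω}
  have hGm : Measurable (fun u : ℝ => ν.real {ω | u < T ω}) := by
    apply Antitone.measurable
    intro a b hab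
    exact measureReal_mono (fun ω (h : b < T ω) => lt_of_le_of_lt hab h)
  have hHm : Measurable H := measurable_id.mul hGm
  have hH0 : ∀ s, 0 < s → 0 ≤ H s := fun s hs => mul_nonneg hs.le measureReal_nonneg
  have hHs : ∀ s, 0 < s → H s ≤ s := fun s hs => by
    have : ν.real {ω | s < T ω} ≤ 1 := measureReal_le_one
    simp only [H]; nlinarith
  -- the limit in the variable `l = log (1/t)`
  have main : Tendsto (fun l : ℝ => ∫ v : ℝ, H (Real.exp (l * v)) * Real.exp (-Real.exp (l * (v - 1))))
      atTop (nhds (∫ v : ℝ, (Set.Ioo (0:ℝ) 1).indicator (fun _ => c) v)) := by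
    apply tendsto_integral_filter_of_dominated_convergence
      (fun v => (M + 1) * Real.exp 1 * Real.exp (-|v|))
    · filter_upwards with l
      apply Measurable.aestronglyMeasurable
      fun_prop
    · filter_upwards [eventually_ge_atTop 1] with l hl
      refine ae_of_all _ fun v => ?_
      have hh0 := hH0 _ (Real.exp_pos (l * v))
      have hh1 := hHs _ (Real.exp_pos (l * v))
      have hh2 : H (Real.exp (l * v)) ≤ M := hMb _ (Real.exp_pos (l * v))
      rw [Real.norm_of_nonneg (by positivity)]
      rcases lt_or_ge v 0 with hv | hv
      · have a1 : Real.exp (l * v) ≤ Real.exp v := Real.exp_le_exp.2 (by nlinarith)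
        have a2 : Real.exp (-Real.exp (l * (v - 1))) ≤ 1 := by
          rw [Real.exp_le_one_iff]; have := Real.exp_pos (l * (v - 1)); linarith
        rw [abs_of_neg hv, neg_neg]
        have a3 : (1:ℝ) ≤ (M + 1) * Real.exp 1 := by
          have := Real.add_one_le_exp (1:ℝ)
          nlinarith
        calc _ ≤ Real.exp v * 1 := by gcongr; linarith
          _ = 1 * Real.exp v := by ring
          _ ≤ _ := by gcongr
      · rw [abs_of_nonneg hv]
        have a4 : Real.exp (-Real.exp (l * (v - 1))) ≤ Real.exp 1 * Real.exp (-v) := by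
          rw [← Real.exp_add]
          apply Real.exp_le_exp.2
          rcases le_total v 1 with h | h
          · have := Real.exp_pos (l * (v - 1)); linarith
          · have := Real.add_one_le_exp (l * (v - 1)); nlinarith
        calc _ ≤ M * (Real.exp 1 * Real.exp (-v)) := by gcongr
          _ ≤ (M + 1) * (Real.exp 1 * Real.exp (-v)) := by gcongr; linarith
          _ = _ := by ring
    · apply Integrable.const_mul
      have h1 := integrable_of_isBigO_exp_neg (f := fun v : ℝ => Real.exp (-|v|)) (a := 0) (b := 1) one_pos
        (by fun_prop) (by
          apply Asymptotics.IsBigO.of_bound 1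
          filter_upwards [eventually_ge_atTop 0] with v hv
          simp [abs_of_nonneg hv])
      rw [← integrableOn_univ, ← Set.Iio_union_Ici (a := (0:ℝ)), integrableOn_union]
      constructor
      · rw [← integrableOn_Iic_iff_integrableOn_Iio]
        have := h1
        rw [← integrableOn_Ici_iff_integrableOn_Ioi] at this
        have h2 := this.comp_neg
        simpa using h2
      · rw [integrableOn_Ici_iff_integrableOn_Ioi]; exact h1
    · have hae : ∀ᵐ v : ℝ, v ≠ 0 ∧ v ≠ 1 := by
        have a := (Set.countable_singleton (0:ℝ)).ae_notMem (volume : Measure ℝ)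
        have b := (Set.countable_singleton (1:ℝ)).ae_notMem (volume : Measure ℝ)
        filter_upwards [a, b] with v h1 h2
        exact ⟨h1, h2⟩
      filter_upwards [hae] with v hv
      rcases lt_or_gt_of_ne hv.1 with h | h
      · have : v ∉ Set.Ioo (0:ℝ) 1 := fun h' => by linarith [h'.1]
        rw [Set.indicator_of_notMem this]
        have hl : Tendsto (fun l : ℝ => Real.exp (l * v)) atTop (nhds 0) :=
          Real.tendsto_exp_atBot.comp (tendsto_id.atTop_mul_const_of_neg h)
        refine squeeze_zero (fun l => mul_nonneg (hH0 _ (Real.exp_pos _)) (Real.exp_pos _).le)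
          (fun l => ?_) hl
        have a2 : Real.exp (-Real.exp (l * (v - 1))) ≤ 1 := by
          rw [Real.exp_le_one_iff]; have := Real.exp_pos (l * (v - 1)); linarith
        calc _ ≤ Real.exp (l * v) * 1 := by gcongr; exact hHs _ (Real.exp_pos _)
          _ = _ := mul_one _
      · rcases lt_or_gt_of_ne hv.2 with h' | h'
        · rw [Set.indicator_of_mem (show v ∈ Set.Ioo (0:ℝ) 1 from ⟨h, h'⟩)]
          have hl : Tendsto (fun l : ℝ => Real.exp (l * v)) atTop atTop :=
            Real.tendsto_exp_atTop.comp (tendsto_id.atTop_mul_const h)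
          have hl2 : Tendsto (fun l : ℝ => Real.exp (-Real.exp (l * (v - 1)))) atTop (nhds 1) := by
            have : Tendsto (fun l : ℝ => Real.exp (l * (v - 1))) atTop (nhds 0) :=
              Real.tendsto_exp_atBot.comp (tendsto_id.atTop_mul_const_of_neg (by linarith))
            have := (Real.continuous_exp.tendsto _).comp this.neg
            simpa [Function.comp_def] using this
          have := (htail.comp hl).mul hl2
          simpa using this
        · have : v ∉ Set.Ioo (0:ℝ) 1 := fun h'' => by linarith [h''.2]
          rw [Set.indicator_of_notMem this]
          have hl2 : Tendsto (fun l : ℝ => M * Real.exp (-Real.exp (l * (v - 1)))) atTop (nhds (M * 0)) := by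
            have : Tendsto (fun l : ℝ => Real.exp (l * (v - 1))) atTop atTop :=
              Real.tendsto_exp_atTop.comp (tendsto_id.atTop_mul_const (by linarith))
            exact ((Real.tendsto_exp_neg_atTop_nhds_zero).comp this).const_mul M
          rw [mul_zero] at hl2
          refine squeeze_zero (fun l => mul_nonneg (hH0 _ (Real.exp_pos _)) (Real.exp_pos _).le)
            (fun l => ?_) hl2
          gcongr
          exact hMb _ (Real.exp_pos _)
  have hval : (∫ v : ℝ, (Set.Ioo (0:ℝ) 1).indicator (fun _ => c) v) = c := by
    rw [integral_indicator measurableSet_Ioo]; simp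
  rw [hval] at main
  have hlog : Tendsto (fun t : ℝ => Real.log (1 / t)) (nhdsWithin 0 (Set.Ioi 0)) atTop := by
    simp_rw [one_div]
    exact Real.tendsto_log_atTop.comp tendsto_inv_nhdsGT_zero
  refine (main.comp hlog).congr' ?_
  have hlt : ∀ᶠ t in nhdsWithin (0:ℝ) (Set.Ioi 0), t < 1 :=
    nhdsWithin_le_nhds (gt_mem_nhds one_pos)
  filter_upwards [self_mem_nhdsWithin, hlt] with t ht ht1
  have ht' : (0:ℝ) < t := ht
  set l := Real.log (1 / t) with hl
  have hl0 : 0 < l := Real.log_pos (by rw [lt_div_iff₀ ht']; linarith)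
  have htl : t = Real.exp (-l) := by
    rw [hl, one_div, Real.log_inv, neg_neg, Real.exp_log ht']
  -- layer cake
  have s1 : 1 - phiH ν T t = ∫ u in Set.Ioi 0, ν.real {ω | u < T ω} * (t * Real.exp (-(t * u))) := by
    rw [← layer_real ν T hT hT0 (fun u => t * Real.exp (-(t * u))) (by fun_prop)
      (fun u _ => by positivity)]
    have : ∀ ω, ∫ u in (0:ℝ)..T ω, t * Real.exp (-(t * u)) = 1 - Real.exp (-(t * T ω)) := by
      intro ω
      have hd : ∀ x ∈ Set.uIcc 0 (T ω), HasDerivAt (fun x : ℝ => - Real.exp (-(t * x)))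
          (t * Real.exp (-(t * x))) x := by
        intro x _
        have := (((hasDerivAt_id x).const_mul t).neg.exp).neg
        refine HasDerivAt.congr_deriv this ?_
        simp [mul_comm]
      rw [intervalIntegral.integral_eq_sub_of_hasDerivAt hd
        (Continuous.intervalIntegrable (by fun_prop) _ _)]
      simp; ring
    simp_rw [this]
    rw [integral_sub (integrable_const _) (phiH_le_one ν T hT hT0 ht'.le)]
    simp [phiH]
  -- change of variables
  have himg : (fun v : ℝ => Real.exp (l * v)) '' Set.univ = Set.Ioi 0 := by
    ext y
    simp only [Set.image_univ, Set.mem_range, Set.mem_Ioi]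
    constructor
    · rintro ⟨v, rfl⟩; exact Real.exp_pos _
    · intro hy
      refine ⟨Real.log y / l, ?_⟩
      rw [mul_div_cancel₀ _ hl0.ne', Real.exp_log hy]
  have cv := integral_image_eq_integral_abs_deriv_smul (s := Set.univ)
    (f := fun v : ℝ => Real.exp (l * v)) (f' := fun v => l * Real.exp (l * v)) MeasurableSet.univ
    (fun v _ => by
      have := ((hasDerivAt_id v).const_mul l).exp
      refine HasDerivAt.hasDerivWithinAt ?_
      refine HasDerivAt.congr_deriv this ?_
      simp; ring)
    (fun a _ b _ hab => by
      have := Real.exp_injective hab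
      exact mul_left_cancel₀ hl0.ne' this)
    (fun u => ν.real {ω | u < T ω} * (t * Real.exp (-(t * u))))
  rw [himg] at cv
  rw [s1, cv, eq_div_iff (by positivity), mul_comm, Function.comp, ← integral_const_mul,
    setIntegral_univ]
  apply integral_congr_ae
  refine ae_of_all _ fun v => ?_
  simp only [smul_eq_mul, H]
  rw [abs_of_pos (by positivity)]
  have : t * Real.exp (l * v) = Real.exp (l * (v - 1)) := by
    rw [htl, ← Real.exp_add]; congr 1; ring
  rw [this]
  ring

lemma dom_ineq {n : ℕ} {s : ℝ} (hL : 1 ≤ Real.log n) (hs : 0 < s)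
    (hsN : Real.exp 1 * s ≤ n * Real.log n) :
    (1 / 4) * (Real.sqrt s - 1) ≤ s / Real.log n * Real.log (n * Real.log n / s) := by
  have hn : (0:ℝ) < n := by
    rcases Nat.eq_zero_or_pos n with h | h
    · subst h; simp at hL; linarith
    · exact_mod_cast h
  set L := Real.log n with hLdef
  have hL0 : 0 < L := by linarith
  have hN : 0 < n * L := by positivity
  have hLN : L ≤ Real.log (n * L) := by
    rw [hLdef]; apply Real.log_le_log hn; nlinarith
  have hld : Real.log (n * L / s) = Real.log (n * L) - Real.log s :=
    Real.log_div hN.ne' hs.ne'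
  have h1 : 1 ≤ Real.log (n * L / s) := by
    rw [Real.le_log_iff_exp_le (by positivity), le_div_iff₀ hs]; exact hsN
  have hq := Real.sq_sqrt hs.le
  have hq0 := Real.sqrt_pos.2 hs
  rcases le_total (2 * Real.log s) (Real.log (n * L)) with h | h
  · have h2 : L / 2 ≤ Real.log (n * L / s) := by rw [hld]; linarith
    calc (1 / 4) * (Real.sqrt s - 1) ≤ s / 2 := by nlinarith [sq_nonneg (Real.sqrt s - 1)]
      _ = s / L * (L / 2) := by field_simp
      _ ≤ _ := by gcongr
  · have h3 : Real.log s ≤ 2 * Real.sqrt s := by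
      have := Real.log_le_sub_one_of_pos hq0
      rw [Real.log_sqrt hs.le] at this
      linarith
    have h4 : L ≤ 4 * Real.sqrt s := by linarith
    calc (1 / 4) * (Real.sqrt s - 1) ≤ (1/4) * Real.sqrt s := by linarith
      _ ≤ s / L * 1 := by
        rw [mul_one, le_div_iff₀ hL0]; nlinarith
      _ ≤ _ := by gcongr

lemma abstract_main {Ω : Type*} [MeasurableSpace Ω] (ν : Measure Ω) [IsProbabilityMeasure ν]
    (T : Ω → ℝ) (hT : Measurable T) (hT0 : ∀ ω, 0 ≤ T ω) (hTpos : ∀ᵐ ω ∂ν, 0 < T ω)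
    (c : ℝ) (hc : 0 < c)
    (htail : Tendsto (fun s : ℝ => s * ν.real {ω | s < T ω}) atTop (nhds c))
    (β : ℝ) (hβ : 1 < β) :
    Tendsto (fun n : ℕ => (n * Real.log n) *
      ∫ t in Set.Ioi 0, AH ν T β t * phiH ν T t ^ n) atTop (nhds (Real.Gamma (β - 1))) := by
  have hA := AH_limit ν T hT hT0 c htail β hβ
  have hψ := psi_limit ν T hT hT0 c htail
  have hAi : IntegrableOn (AH ν T β) (Set.Ioi 0) := by
    simpa using (laplace_step ν T hT hT0 hTpos β hβ 0).1
  set K := c * Real.Gamma (β - 1) + 1 with hK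
  obtain ⟨ε, hε, hε1, hAK, hψc⟩ : ∃ ε : ℝ, 0 < ε ∧ Real.exp 1 * ε ≤ 1 ∧
      (∀ t, 0 < t → t < ε → AH ν T β t ≤ K) ∧
      (∀ t, 0 < t → t < ε → c / 2 * (t * Real.log (1 / t)) ≤ 1 - phiH ν T t) := by
    have e1 := hA.eventually (gt_mem_nhds (lt_add_one _))
    have e2 := hψ.eventually (lt_mem_nhds (half_lt_self hc))
    obtain ⟨δ, hδ, hδ2⟩ := (mem_nhdsGT_iff_exists_Ioo_subset).1 (e1.and e2)
    have hδ' : (0:ℝ) < δ := hδ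
    refine ⟨min δ (Real.exp (-1)), by positivity, ?_, ?_, ?_⟩
    · calc _ ≤ Real.exp 1 * Real.exp (-1) := by gcongr; exact min_le_right _ _
        _ = 1 := by rw [← Real.exp_add]; simp
    · intro t h1 h2
      exact (hδ2 ⟨h1, h2.trans_le (min_le_left _ _)⟩).1.le
    · intro t h1 h2
      have h3 := (hδ2 ⟨h1, h2.trans_le (min_le_left _ _)⟩).2
      have h4 : t < 1 := by
        have := h2.trans_le (min_le_right _ _)
        have h5 : Real.exp (-1) < 1 := by rw [Real.exp_lt_one_iff]; norm_num
        linarith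
      have h5 : 0 < t * Real.log (1 / t) :=
        mul_pos h1 (Real.log_pos (by rw [lt_div_iff₀ h1]; linarith))
      rw [lt_div_iff₀ h5] at h3
      exact h3.le
  have hK0 : 0 ≤ K := by
    have := Real.Gamma_pos_of_pos (show 0 < β - 1 by linarith)
    positivity
  let f : ℕ → ℝ → ℝ := fun n => (Set.Iio ε).indicator (fun t => AH ν T β t * phiH ν T t ^ n)
  let f2 : ℕ → ℝ → ℝ := fun n => (Set.Ici ε).indicator (fun t => AH ν T β t * phiH ν T t ^ n)
  have hAm := AH_meas ν T hT β
  have hφm := phiH_meas ν T hT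
  have hfm : ∀ n, Measurable (f n) := fun n =>
    (hAm.mul (hφm.pow_const n)).indicator measurableSet_Iio
  have hlogt : Tendsto (fun n : ℕ => Real.log n) atTop atTop :=
    Real.tendsto_log_atTop.comp tendsto_natCast_atTop_atTop
  have hNt : Tendsto (fun n : ℕ => n * Real.log n) atTop atTop :=
    tendsto_natCast_atTop_atTop.atTop_mul_atTop₀ hlogt
  -- near part
  have near : Tendsto (fun n : ℕ => ∫ s in Set.Ioi 0, f n ((n * Real.log n)⁻¹ * s)) atTop
      (nhds (∫ s in Set.Ioi 0, (c * Real.Gamma (β - 1)) * Real.exp (-(c * s)))) := by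
    apply tendsto_integral_filter_of_dominated_convergence
      (fun s => K * Real.exp (-(c / 8) * (Real.sqrt s - 1)))
    · filter_upwards with n
      exact ((hfm n).comp (measurable_const.mul measurable_id)).aestronglyMeasurable
    · filter_upwards [hlogt.eventually_ge_atTop 1, eventually_gt_atTop 0] with n hL hn
      refine (ae_restrict_iff' measurableSet_Ioi).2 (ae_of_all _ fun s hs => ?_)
      have hs' : (0:ℝ) < s := hs
      have hn' : (0:ℝ) < n := by exact_mod_cast hn
      have hL0 : 0 < Real.log n := by linarith
      set t := (n * Real.log n)⁻¹ * s with ht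
      have ht0 : 0 < t := by positivity
      by_cases htε : t < ε
      · have : f n t = AH ν T β t * phiH ν T t ^ n :=
          Set.indicator_of_mem (show t ∈ Set.Iio ε from htε) _
        have hA0 := AH_nonneg ν T hT0 β ht0.le
        have hφ0 := phiH_nonneg ν T t
        rw [this, Real.norm_of_nonneg (by positivity)]
        have hφ : phiH ν T t ^ n ≤ Real.exp (-(n * (1 - phiH ν T t))) := by
          have : phiH ν T t ≤ Real.exp (-(1 - phiH ν T t)) := by
            have := Real.add_one_le_exp (-(1 - phiH ν T t)); linarith
          calc _ ≤ (Real.exp (-(1 - phiH ν T t))) ^ n := by gcongr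
            _ = _ := by rw [← Real.exp_nat_mul]; congr 1; ring
        have hd := dom_ineq hL hs' (by
          have h1 : s = n * Real.log n * t := by rw [ht]; field_simp
          have h2 : Real.exp 1 * t ≤ 1 := le_trans (by gcongr) hε1
          rw [h1]
          calc _ = n * Real.log n * (Real.exp 1 * t) := by ring
            _ ≤ n * Real.log n * 1 := by gcongr
            _ = _ := mul_one _)
        have h1t : 1 / t = n * Real.log n / s := by rw [ht]; field_simp
        have hp := hψc t ht0 htε
        rw [h1t] at hp
        have hnt : n * t = s / Real.log n := by rw [ht]; field_simp
        gcongr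
        · exact hAK t ht0 htε
        · refine hφ.trans (Real.exp_le_exp.2 ?_)
          have h6 : n * (c / 2 * (t * Real.log (n * Real.log n / s))) ≤ n * (1 - phiH ν T t) := by
            gcongr
          have h7 : n * (c / 2 * (t * Real.log (n * Real.log n / s)))
              = c / 2 * (s / Real.log n * Real.log (n * Real.log n / s)) := by
            rw [← hnt]; ring
          have h8 : c / 2 * ((1 / 4) * (Real.sqrt s - 1)) ≤
            c / 2 * (s / Real.log n * Real.log (n * Real.log n / s)) := by gcongr
          linarith
      · have : f n t = 0 := Set.indicator_of_notMem (show t ∉ Set.Iio ε from htε) _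
        rw [this, norm_zero]
        positivity
    · apply Integrable.const_mul
      have h1 := integral_exp_neg_mul_rpow (p := 1 / 2) (b := c / 8) (by norm_num) (by positivity)
      have h2 : Integrable (fun s : ℝ => Real.exp (-(c / 8) * s ^ (1 / 2 : ℝ)))
          (volume.restrict (Set.Ioi 0)) := by
        by_contra hcon
        rw [integral_undef hcon] at h1
        have : 0 < (c / 8) ^ (-1 / (1 / 2) : ℝ) * Real.Gamma (1 / (1 / 2) + 1) := by
          have := Real.Gamma_pos_of_pos (show (0:ℝ) < 1 / (1 / 2) + 1 by norm_num)
          positivity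
        linarith
      refine (h2.const_mul (Real.exp (c / 8))).congr (ae_of_all _ fun s => ?_)
      simp only
      rw [← Real.exp_add, Real.sqrt_eq_rpow]
      congr 1; ring
    · refine (ae_restrict_iff' measurableSet_Ioi).2 (ae_of_all _ fun s hs => ?_)
      have hs' : (0:ℝ) < s := hs
      have ht : Tendsto (fun n : ℕ => (n * Real.log n)⁻¹ * s) atTop (nhdsWithin 0 (Set.Ioi 0)) := by
        rw [tendsto_nhdsWithin_iff]
        constructor
        · simpa using (tendsto_inv_atTop_zero.comp hNt).mul_const s
        · filter_upwards [hNt.eventually_gt_atTop 0] with n hn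
          rw [Set.mem_Ioi]
          positivity
      have hlog1 : Tendsto (fun n : ℕ => Real.log (n * Real.log n / s) / Real.log n) atTop (nhds 1) := by
        have h1 : Tendsto (fun y : ℝ => Real.log y / y) atTop (nhds 0) := by
          simpa using Real.isLittleO_log_id_atTop.tendsto_div_nhds_zero
        have h2 := h1.comp hlogt
        have h3 : Tendsto (fun n : ℕ => Real.log s / Real.log n) atTop (nhds 0) :=
          hlogt.const_div_atTop _
        have h4 := ((tendsto_const_nhds (x := (1:ℝ))).add h2).sub h3
        simp only [add_zero, sub_zero] at h4
        refine h4.congr' ?_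
        filter_upwards [hlogt.eventually_ge_atTop 1, eventually_gt_atTop 0] with n hL hn
        have hn' : (0:ℝ) < n := by exact_mod_cast hn
        have hL0 : 0 < Real.log n := by linarith
        rw [Real.log_div (by positivity) hs'.ne', Real.log_mul hn'.ne' hL0.ne']
        simp only [Function.comp]
        field_simp
      have hφ : Tendsto (fun n : ℕ => phiH ν T ((n * Real.log n)⁻¹ * s) ^ n) atTop
          (nhds (Real.exp (-(c * s)))) := by
        have h5 : Tendsto (fun n : ℕ => (n:ℝ) * (-(1 - phiH ν T ((n * Real.log n)⁻¹ * s)))) atTop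
            (nhds (-(c * s))) := by
          have h6 := (((hψ.comp ht).mul (hlog1.const_mul s))).neg
          rw [mul_one] at h6
          refine h6.congr' ?_
          filter_upwards [hlogt.eventually_ge_atTop 1, eventually_gt_atTop 0,
            ht.eventually (nhdsWithin_le_nhds (gt_mem_nhds one_pos))] with n hL hn ht1
          have hn' : (0:ℝ) < n := by exact_mod_cast hn
          have hL0 : 0 < Real.log n := by linarith
          simp only [Function.comp]
          have ht0 : 0 < (n * Real.log n)⁻¹ * s := by positivity
          have h1t : 1 / ((n * Real.log n)⁻¹ * s) = n * Real.log n / s := by field_simp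
          have h8 : 0 < Real.log (1 / ((n * Real.log n)⁻¹ * s)) :=
            Real.log_pos (by rw [lt_div_iff₀ ht0]; linarith)
          rw [h1t] at h8 ⊢
          generalize Real.log (n * Real.log n / s) = q at h8 ⊢
          generalize phiH ν T ((n * Real.log n)⁻¹ * s) = p
          field_simp
        have := Real.tendsto_one_add_pow_exp_of_tendsto h5
        refine this.congr fun n => ?_
        congr 1; ring
      refine ((hA.comp ht).mul hφ).congr' ?_
      filter_upwards [ht.eventually (nhdsWithin_le_nhds (gt_mem_nhds hε))] with n hn
      have : f n ((n * Real.log n)⁻¹ * s) = AH ν T β ((n * Real.log n)⁻¹ * s) *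
          phiH ν T ((n * Real.log n)⁻¹ * s) ^ n :=
        Set.indicator_of_mem (show (n * Real.log n)⁻¹ * s ∈ Set.Iio ε from hn) _
      rw [this]
      rfl
  have hval : ∫ s in Set.Ioi 0, (c * Real.Gamma (β - 1)) * Real.exp (-(c * s))
      = Real.Gamma (β - 1) := by
    rw [integral_const_mul, integral_comp_mul_left_Ioi (fun s => Real.exp (-s)) 0 hc]
    simp only [mul_zero, integral_exp_neg_Ioi]
    simp; field_simp
  rw [hval] at near
  -- far part
  have hφε : phiH ν T ε < 1 := phiH_lt_one ν T hT hT0 hTpos hε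
  have hφε0 := phiH_nonneg ν T ε
  have hfar : Tendsto (fun n : ℕ => (n * Real.log n) * ∫ t in Set.Ioi 0, f2 n t) atTop (nhds 0) := by
    have hz : Tendsto (fun n : ℕ => ((n:ℝ) ^ 2 * phiH ν T ε ^ n) * ∫ t in Set.Ioi 0, AH ν T β t)
        atTop (nhds 0) := by
      simpa using (tendsto_pow_const_mul_const_pow_of_lt_one 2 hφε0 hφε).mul_const
        (∫ t in Set.Ioi 0, AH ν T β t)
    have hf2n : ∀ n, ∀ t ∈ Set.Ioi (0:ℝ), 0 ≤ f2 n t := by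
      intro n t ht
      apply Set.indicator_nonneg
      intro t ht
      have ht0 : 0 ≤ t := hε.le.trans ht
      have := AH_nonneg ν T hT0 β ht0
      have := phiH_nonneg ν T t
      positivity
    refine squeeze_zero' ?_ ?_ hz
    · filter_upwards [hNt.eventually_ge_atTop 0] with n hn
      exact mul_nonneg hn (setIntegral_nonneg measurableSet_Ioi (hf2n n))
    · filter_upwards [hNt.eventually_ge_atTop 0] with n hn
      have h1 : ∫ t in Set.Ioi 0, f2 n t ≤ ∫ t in Set.Ioi 0, phiH ν T ε ^ n * AH ν T β t := by
        apply setIntegral_mono_on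
        · exact ((laplace_step ν T hT hT0 hTpos β hβ n).1).indicator measurableSet_Ici
        · exact hAi.const_mul _
        · exact measurableSet_Ioi
        · intro t ht
          have ht0 : (0:ℝ) < t := ht
          have a1 := AH_nonneg ν T hT0 β ht0.le
          by_cases h : t ∈ Set.Ici ε
          · have : f2 n t = AH ν T β t * phiH ν T t ^ n := Set.indicator_of_mem h _
            rw [this, mul_comm]
            have a2 := phiH_anti ν T hT hT0 hε.le h
            have a3 := phiH_nonneg ν T t
            gcongr
          · have : f2 n t = 0 := Set.indicator_of_notMem h _
            rw [this]; positivity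
      rw [integral_const_mul] at h1
      have h2 : 0 ≤ ∫ t in Set.Ioi 0, AH ν T β t :=
        setIntegral_nonneg measurableSet_Ioi fun t ht => AH_nonneg ν T hT0 β (le_of_lt ht)
      have h3 : (n:ℝ) * Real.log n ≤ n ^ 2 := by
        have := Real.log_le_self (Nat.cast_nonneg (α := ℝ) n)
        have := Nat.cast_nonneg (α := ℝ) n
        nlinarith
      calc _ ≤ (n * Real.log n) * (phiH ν T ε ^ n * ∫ t in Set.Ioi 0, AH ν T β t) := by gcongr
        _ ≤ (n:ℝ) ^ 2 * (phiH ν T ε ^ n * ∫ t in Set.Ioi 0, AH ν T β t) := by gcongr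
        _ = _ := by ring
  have := near.add hfar
  rw [add_zero] at this
  refine this.congr' ?_
  filter_upwards [hNt.eventually_gt_atTop 0] with n hn
  have hi := (laplace_step ν T hT hT0 hTpos β hβ n).1
  rw [integral_comp_mul_left_Ioi (f n) 0 (inv_pos.2 hn), mul_zero, inv_inv, smul_eq_mul,
    ← mul_add, ← integral_add]
  · congr 1
    apply integral_congr_ae
    refine ae_of_all _ fun t => ?_
    have := Set.indicator_self_add_compl (Set.Iio ε) (fun t => AH ν T β t * phiH ν T t ^ n)
    rw [Set.compl_Iio] at this
    exact congrFun this t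
  · exact hi.indicator measurableSet_Iio
  · exact hi.indicator measurableSet_Ici

lemma pi_density {E : Type*} [MeasureSpace E] [SigmaFinite (volume : Measure E)] (ρ : E → ℝ)
    (hm : Measurable ρ) (h0 : ∀ y, 0 ≤ ρ y) (hi : Integrable ρ) (n : ℕ) :
    (Measure.pi fun _ : Fin n => (volume : Measure E).withDensity fun y => ENNReal.ofReal (ρ y))
      = (volume : Measure (Fin n → E)).withDensity fun xs => ENNReal.ofReal (∏ i, ρ (xs i)) := by
  apply Measure.pi_eq
  intro s hs
  have hint : ∀ i, IntegrableOn ρ (s i) := fun i => hi.integrableOn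
  rw [withDensity_apply _ (MeasurableSet.univ_pi hs), volume_pi, Measure.restrict_pi_pi,
    ← ofReal_integral_eq_lintegral_ofReal, integral_fintype_prod_eq_prod (fun _ => ρ),
    ENNReal.ofReal_prod_of_nonneg]
  · refine Finset.prod_congr rfl fun i _ => ?_
    rw [withDensity_apply _ (hs i), ← ofReal_integral_eq_lintegral_ofReal (hint i)
      (ae_of_all _ h0)]
  · intro i _
    exact integral_nonneg h0
  · exact Integrable.fintype_prod (f := fun _ => ρ) hint
  · exact ae_of_all _ fun xs => Finset.prod_nonneg fun i _ => h0 _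

lemma tail_euc (d : ℕ) (hd : 1 ≤ d) (ρ : Euc d → ℝ) (hm : Measurable ρ) (h0 : ∀ y, 0 ≤ ρ y)
    (hi : Integrable ρ) (x : Euc d) (hρ_cont : ContinuousAt ρ x) :
    Tendsto (fun s : ℝ => s * ((volume : Measure (Euc d)).withDensity
      fun y => ENNReal.ofReal (ρ y)).real {y | s < ‖x - y‖ ^ (-(d : ℝ))}) atTop
      (nhds ((volume : Measure (Euc d)).real (Metric.ball 0 1) * ρ x)) := by
  have hd0 : (0:ℝ) < d := by exact_mod_cast hd
  have : Nontrivial (Euc d) := by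
    apply Module.nontrivial_of_finrank_pos (R := ℝ)
    simpa using Nat.lt_of_lt_of_le Nat.zero_lt_one hd
  set V := (volume : Measure (Euc d)).real (Metric.ball 0 1) with hV
  have hV0 : 0 < V := by
    rw [hV, measureReal_def]
    exact ENNReal.toReal_pos (Metric.measure_ball_pos _ _ one_pos).ne' measure_ball_lt_top.ne
  let r : ℝ → ℝ := fun s => s ^ (-(1 / (d:ℝ)))
  have hr : Tendsto r atTop (nhds 0) := tendsto_rpow_neg_atTop (by positivity)
  have hball : Tendsto (fun s => Metric.ball x (r s)) atTop (nhds x).smallSets := by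
    rw [tendsto_smallSets_iff]
    intro t ht
    obtain ⟨δ, hδ, hδt⟩ := Metric.mem_nhds_iff.1 ht
    filter_upwards [hr.eventually (gt_mem_nhds hδ)] with s hs
    exact (Metric.ball_subset_ball hs.le).trans hδt
  have hvol : ∀ s, 0 < s → (volume : Measure (Euc d)).real (Metric.ball x (r s)) = s⁻¹ * V := by
    intro s hs
    have hrs : 0 ≤ r s := Real.rpow_nonneg hs.le _
    rw [measureReal_def, Measure.addHaar_ball _ _ hrs, ENNReal.toReal_mul,
      ENNReal.toReal_ofReal (by positivity), hV, measureReal_def]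
    congr 1
    simp only [finrank_euclideanSpace, Fintype.card_fin, r]
    rw [← Real.rpow_natCast, ← Real.rpow_mul hs.le, ← Real.rpow_neg_one]
    congr 1
    field_simp
  have hlo := hρ_cont.integral_sub_linear_isLittleO_ae (μ := volume)
    (hm.stronglyMeasurable.stronglyMeasurableAtFilter) hball
  have hlim := hlo.tendsto_div_nhds_zero
  have hlim2 : Tendsto (fun s => V * (((∫ y in Metric.ball x (r s), ρ y) -
      (volume : Measure (Euc d)).real (Metric.ball x (r s)) • ρ x) /
      (volume : Measure (Euc d)).real (Metric.ball x (r s))) + V * ρ x) atTop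
      (nhds (V * ρ x)) := by
    simpa using (hlim.const_mul V).add_const (V * ρ x)
  refine hlim2.congr' ?_
  filter_upwards [eventually_gt_atTop 0] with s hs
  have hset : {y | s < ‖x - y‖ ^ (-(d : ℝ))} = Metric.ball x (r s) \ {x} := by
    ext y
    simp only [Set.mem_ofPred_eq, Set.mem_sdiff, Metric.mem_ball, Set.mem_singleton_iff]
    rw [dist_comm, dist_eq_norm]
    by_cases hy : y = x
    · subst hy
      simp [Real.zero_rpow (show -(d:ℝ) ≠ 0 by linarith), hs.le]
    · have hpos : 0 < ‖x - y‖ := norm_pos_iff.2 (sub_ne_zero.2 (Ne.symm hy))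
      simp only [hy, not_false_eq_true, and_true, r]
      have h1 : -(1 / (d:ℝ)) = (-(d:ℝ))⁻¹ := by rw [one_div, inv_neg]
      rw [h1]
      exact (Real.lt_rpow_inv_iff_of_neg hpos hs (by linarith)).symm
  have hmeas : ((volume : Measure (Euc d)).withDensity
      fun y => ENNReal.ofReal (ρ y)).real {y | s < ‖x - y‖ ^ (-(d : ℝ))}
      = ∫ y in Metric.ball x (r s), ρ y := by
    rw [hset, measureReal_def, measure_sdiff_null, withDensity_apply _ measurableSet_ball,
      ← ofReal_integral_eq_lintegral_ofReal hi.integrableOn (ae_of_all _ h0),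
      ENNReal.toReal_ofReal (integral_nonneg h0)]
    exact withDensity_absolutelyContinuous _ _ (measure_singleton x)
  rw [hmeas, hvol s hs, smul_eq_mul]
  field_simp
  ring

/-- for a probability density `ρ` on `ℝ^d` with finite variance, `x` in the
interior of the support of `ρ`, `ρ` continuous at `x`, and `β > 1`, the β-th moment of the
Hilbert kernel weight `w_0(x)` for `n+1` i.i.d. samples with density `ρ` (expressed as an
integral against the product density `∏ ρ(x_i)`) satisfies
`E[w_0(x)^β] ~ 1/((β−1)·n·ln n)` as `n → ∞` (the ratio of the two sides tends to 1). -/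
theorem hilbert_moment_asymptotic_beta_gt_one
    (d : ℕ) (hd : 1 ≤ d)
    (ρ : Euc d → ℝ) (hρ_meas : Measurable ρ) (hρ_nonneg : ∀ y, 0 ≤ ρ y)
    (hρ_prob : (∫ y, ρ y) = 1)
    (hρ_var : Integrable (fun y => ρ y * ‖y‖ ^ 2))
    (x : Euc d) (hx : x ∈ interior {y | 0 < ρ y}) (hρ_cont : ContinuousAt ρ x)
    (β : ℝ) (hβ : 1 < β) :
    Tendsto (fun n : ℕ =>
        (∫ xs : Fin (n + 1) → Euc d,
            hilbertWeight d n x xs 0 ^ β * ∏ i : Fin (n + 1), ρ (xs i)) /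
          (1 / ((β - 1) * (n : ℝ) * Real.log n)))
      atTop (nhds 1) := by
  have hd0 : (0:ℝ) < d := by exact_mod_cast hd
  have : Nontrivial (Euc d) := by
    apply Module.nontrivial_of_finrank_pos (R := ℝ)
    simpa using Nat.lt_of_lt_of_le Nat.zero_lt_one hd
  have hi : Integrable ρ := by
    by_contra h
    rw [integral_undef h] at hρ_prob
    norm_num at hρ_prob
  have hρx : 0 < ρ x := (interior_subset hx : x ∈ {y | 0 < ρ y})
  set ν : Measure (Euc d) := volume.withDensity fun y => ENNReal.ofReal (ρ y) with hν
  have : IsProbabilityMeasure ν := ⟨by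
    rw [hν, withDensity_apply _ MeasurableSet.univ, Measure.restrict_univ,
      ← ofReal_integral_eq_lintegral_ofReal hi (ae_of_all _ hρ_nonneg), hρ_prob]
    simp⟩
  let T : Euc d → ℝ := fun y => ‖x - y‖ ^ (-(d : ℝ))
  have hT : Measurable T := by unfold T; fun_prop
  have hT0 : ∀ y, 0 ≤ T y := fun y => Real.rpow_nonneg (norm_nonneg _) _
  have hTpos : ∀ᵐ y ∂ν, 0 < T y := by
    have hae : ∀ᵐ y ∂ν, y ∉ ({x} : Set (Euc d)) := by
      rw [← measure_eq_zero_iff_ae_notMem]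
      exact withDensity_absolutelyContinuous _ _ (measure_singleton x)
    filter_upwards [hae] with y hy
    exact Real.rpow_pos_of_pos (norm_pos_iff.2 (sub_ne_zero.2 (Ne.symm hy))) _
  have hV0 : 0 < (volume : Measure (Euc d)).real (Metric.ball 0 1) := by
    rw [measureReal_def]
    exact ENNReal.toReal_pos (Metric.measure_ball_pos _ _ one_pos).ne' measure_ball_lt_top.ne
  have htail := tail_euc d hd ρ hρ_meas hρ_nonneg hi x hρ_cont
  have main := abstract_main ν T hT hT0 hTpos _ (mul_pos hV0 hρx) htail β hβ
  have hΓ1 : 0 < Real.Gamma (β - 1) := Real.Gamma_pos_of_pos (by linarith)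
  have hΓ : Real.Gamma β = (β - 1) * Real.Gamma (β - 1) := by
    have := Real.Gamma_add_one (s := β - 1) (by linarith)
    simpa using this
  have hb : 0 < β - 1 := by linarith
  have := main.const_mul ((β - 1) / Real.Gamma β)
  have e1 : (β - 1) / Real.Gamma β * Real.Gamma (β - 1) = 1 := by
    rw [hΓ]; field_simp
  rw [e1] at this
  refine this.congr fun n => ?_
  have hE : (∫ xs : Fin (n + 1) → Euc d,
      hilbertWeight d n x xs 0 ^ β * ∏ i : Fin (n + 1), ρ (xs i))
      = (∫ t in Set.Ioi 0, AH ν T β t * phiH ν T t ^ n) / Real.Gamma β := by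
    rw [← (laplace_step ν T hT hT0 hTpos β hβ n).2, hν,
      pi_density ρ hρ_meas hρ_nonneg hi (n + 1),
      integral_withDensity_eq_integral_toReal_smul (by fun_prop) (ae_of_all _ fun _ => ENNReal.ofReal_lt_top)]
    apply integral_congr_ae
    refine ae_of_all _ fun xs => ?_
    simp only [smul_eq_mul]
    rw [ENNReal.toReal_ofReal (Finset.prod_nonneg fun i _ => hρ_nonneg _), mul_comm]
    rfl
  rw [hE, div_div_eq_mul_div, div_one]
  ring

end
end

section
/- Let d ≥ 1 and let ρ be a probability density on ℝ^d with finite variance. Fix x in the interior of the support of ρ (so ρ(x) > 0), assume ρ is continuous at x, and let X_0,…,X_n be i.i.d. with density ρ. For 0 < β < 1, define κ_β(x) = ∫ ρ(x+y)·‖y‖^{−βd} d^d y, which is finite. Then the Hilbert kernel weight w_0(x) = ‖x−X_0‖^{−d} / Σ_{j=0}^n ‖x−X_j‖^{−d} satisfies E[w_0(x)^β] ~ κ_β(x) / (V_d · ρ(x) · n · ln n)^β as n → ∞, where V_d = π^{d/2}/Γ(d/2+1) is the volume of the unit ball in ℝ^d. -/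
open MeasureTheory Filter

noncomputable section

/-- The volume `V_d = π^{d/2}/Γ(d/2+1)` of the unit ball in `ℝ^d`. -/
def unitBallVol (d : ℕ) : ℝ := Real.pi ^ ((d : ℝ) / 2) / Real.Gamma ((d : ℝ) / 2 + 1)



lemma hk_int_abs : Integrable (fun u : ℝ => Real.exp (-|u|)) := by
  rw [← integrableOn_univ, ← Set.Iic_union_Ioi (a := (0:ℝ))]
  apply IntegrableOn.union
  · refine (integrableOn_exp_Iic 0).congr_fun ?_ measurableSet_Iic
    intro u hu
    simp only [Set.mem_Iic] at hu
    simp [abs_of_nonpos hu]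
  · refine (integrableOn_exp_neg_Ioi 0).congr_fun ?_ measurableSet_Ioi
    intro u hu
    simp only [Set.mem_Ioi] at hu
    simp [abs_of_pos hu]

lemma hk_M {F : ℝ → ℝ} {c : ℝ} (hF1 : ∀ s, F s ≤ 1)
    (tail : Tendsto (fun s => s * F s) atTop (nhds c)) :
    ∃ M : ℝ, 1 ≤ M ∧ ∀ s, 0 < s → s * F s ≤ M := by
  have h := tail.eventually (eventually_le_nhds (show c < c + 1 by linarith))
  obtain ⟨s0, hs0⟩ := eventually_atTop.1 h
  refine ⟨max 1 (max (c+1) s0), le_max_left _ _, fun s hs => ?_⟩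
  by_cases hss : s0 ≤ s
  · exact (hs0 s hss).trans ((le_max_left _ _).trans (le_max_right _ _))
  · push Not at hss
    refine le_trans ?_ ((le_max_right (c+1) s0).trans (le_max_right _ _))
    nlinarith [hF1 s]

lemma hk_DCT {F : ℝ → ℝ} {c : ℝ} (hFm : Measurable F) (hF0 : ∀ s, 0 ≤ F s) (hF1 : ∀ s, F s ≤ 1)
    (tail : Tendsto (fun s => s * F s) atTop (nhds c)) :
    Tendsto (fun L : ℝ => ∫ u : ℝ, Real.exp (L * u) * F (Real.exp (L * u)) *
      Real.exp (-(Real.exp (L * (u - 1))))) atTop (nhds c) := by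
  obtain ⟨M, hM1, hM⟩ := hk_M hF1 tail
  have hlim : (∫ u : ℝ, (Set.Ioo (0:ℝ) 1).indicator (fun _ => c) u) = c := by
    rw [integral_indicator measurableSet_Ioo]; simp
  rw [← hlim]
  apply tendsto_integral_filter_of_dominated_convergence
    (fun u => M * Real.exp 1 * Real.exp (-|u|))
  · refine Eventually.of_forall fun L => Measurable.aestronglyMeasurable ?_
    have : Measurable fun u : ℝ => F (Real.exp (L * u)) := hFm.comp (by fun_prop)
    fun_prop
  · filter_upwards [eventually_ge_atTop (1:ℝ)] with L hL
    refine Eventually.of_forall fun u => ?_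
    rw [Real.norm_of_nonneg (by have := hF0 (Real.exp (L*u)); positivity)]
    rcases le_total u 0 with hu | hu
    · rw [abs_of_nonpos hu, neg_neg]
      have h1 : Real.exp (L * u) ≤ Real.exp u := Real.exp_le_exp.2 (by nlinarith)
      have h2 : Real.exp (-(Real.exp (L * (u - 1)))) ≤ 1 := Real.exp_le_one_iff.2 (by
        have := Real.exp_pos (L * (u-1)); linarith)
      have h3 : 1 ≤ Real.exp 1 := Real.one_le_exp (by norm_num)
      calc _ ≤ Real.exp u * 1 * 1 := by
              gcongr
              · exact hF0 _
              · exact hF1 _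
        _ ≤ _ := by nlinarith [Real.exp_pos u, mul_le_mul hM1 h3 zero_le_one (by linarith)]
    · rw [abs_of_nonneg hu, mul_assoc M, ← Real.exp_add]
      have h2 : Real.exp (-(Real.exp (L * (u - 1)))) ≤ Real.exp (1 + -u) := by
        apply Real.exp_le_exp.2
        rcases le_total u 1 with h | h
        · have := Real.exp_pos (L * (u-1)); linarith
        · have := Real.add_one_le_exp (L * (u-1)); nlinarith
      exact mul_le_mul (hM _ (Real.exp_pos _)) h2 (Real.exp_pos _).le (by linarith)
  · exact hk_int_abs.const_mul _
  · have hne0 : ∀ᵐ u : ℝ, u ≠ 0 := by simp [ae_iff]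
    have hne1 : ∀ᵐ u : ℝ, u ≠ 1 := by simp [ae_iff]
    filter_upwards [hne0, hne1] with u h0 h1
    rcases lt_or_gt_of_ne h0 with h | h
    · rw [Set.indicator_of_notMem (by simp; intro h'; linarith)]
      have hz : Tendsto (fun L : ℝ => Real.exp (L * u)) atTop (nhds 0) :=
        Real.tendsto_exp_atBot.comp (tendsto_id.atTop_mul_const_of_neg h)
      refine squeeze_zero (fun L => ?_) (fun L => ?_) hz
      · have := hF0 (Real.exp (L*u)); positivity
      · have h2 : Real.exp (-(Real.exp (L * (u - 1)))) ≤ 1 := Real.exp_le_one_iff.2 (by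
          have := Real.exp_pos (L * (u-1)); linarith)
        calc _ ≤ Real.exp (L * u) * 1 * 1 := by
              gcongr
              · exact hF1 _
          _ = _ := by ring
    · have hA : Tendsto (fun L : ℝ => Real.exp (L * u) * F (Real.exp (L * u))) atTop (nhds c) :=
        tail.comp (Real.tendsto_exp_atTop.comp (tendsto_id.atTop_mul_const h))
      rcases lt_or_gt_of_ne h1 with h' | h'
      · rw [Set.indicator_of_mem (by exact ⟨h, h'⟩)]
        have hz : Tendsto (fun L : ℝ => Real.exp (L * (u-1))) atTop (nhds 0) :=
          Real.tendsto_exp_atBot.comp (tendsto_id.atTop_mul_const_of_neg (by linarith))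
        have := hA.mul ((Real.continuous_exp.tendsto _).comp hz.neg)
        simpa using this
      · rw [Set.indicator_of_notMem (by simp; intro _; linarith)]
        have hz : Tendsto (fun L : ℝ => Real.exp (L * (u-1))) atTop atTop :=
          Real.tendsto_exp_atTop.comp (tendsto_id.atTop_mul_const (by linarith))
        have := hA.mul (Real.tendsto_exp_atBot.comp (tendsto_neg_atTop_atBot.comp hz))
        simpa using this

lemma hk_layer {E : Type*} [MeasurableSpace E] (μ : Measure E) [IsProbabilityMeasure μ]
    {a : E → ℝ} (ha : Measurable a) (ha0 : ∀ y, 0 ≤ a y) {L : ℝ} (hL : 0 < L) :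
    ∫ y, (1 - Real.exp (-(Real.exp (-L) * a y))) ∂μ = Real.exp (-L) * L *
     ∫ u : ℝ, Real.exp (L * u) * μ.real {y | Real.exp (L * u) < a y} *
      Real.exp (-(Real.exp (L * (u - 1)))) := by
  have hFm : Measurable fun s : ℝ => μ {y | s < a y} :=
    Antitone.measurable (fun s t hst => measure_mono fun y hy => lt_of_le_of_lt hst hy)
  have hFr : Measurable fun s : ℝ => μ.real {y | s < a y} := hFm.ennreal_toReal
  set t := Real.exp (-L) with ht
  have htpos : 0 < t := Real.exp_pos _
  rw [← integral_const_mul, integral_eq_lintegral_of_nonneg_ae, integral_eq_lintegral_of_nonneg_ae]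
  · congr 1
    have h1 := lintegral_comp_eq_lintegral_meas_lt_mul (f := a) (g := fun s => t * Real.exp (-(t * s))) μ
      (Eventually.of_forall ha0) ha.aemeasurable
      (fun s _ => Continuous.intervalIntegrable (by fun_prop) _ _)
      (Eventually.of_forall fun s => by positivity)
    have h2 : ∀ y, ∫ s in (0:ℝ)..a y, t * Real.exp (-(t * s)) = 1 - Real.exp (-(t * a y)) := by
      intro y
      have : ∀ s ∈ Set.uIcc 0 (a y), HasDerivAt (fun s => - Real.exp (-(t * s))) (t * Real.exp (-(t * s))) s := by
        intro s _
        have : HasDerivAt (fun s => - Real.exp (-(t * s))) (-(Real.exp (-(t * s)) * (-(t * 1)))) s :=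
          (((hasDerivAt_id s).const_mul t).neg.exp).neg
        exact this.congr_deriv (by ring)
      rw [intervalIntegral.integral_eq_sub_of_hasDerivAt this (Continuous.intervalIntegrable (by fun_prop) _ _)]
      simp; ring
    simp only [h2] at h1
    rw [h1]
    have himg : (fun u : ℝ => Real.exp (L * u)) '' Set.univ = Set.Ioi 0 := by
      ext s; simp only [Set.image_univ, Set.mem_range, Set.mem_Ioi]
      constructor
      · rintro ⟨u, rfl⟩; exact Real.exp_pos _
      · intro hs; refine ⟨Real.log s / L, ?_⟩
        rw [mul_div_cancel₀ _ hL.ne', Real.exp_log hs]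
    rw [← himg, lintegral_image_eq_lintegral_abs_deriv_mul (f' := fun u => L * Real.exp (L * u)) MeasurableSet.univ]
    · simp only [Measure.restrict_univ]
      refine lintegral_congr fun u => ?_
      rw [← ofReal_measureReal (μ := μ), abs_of_pos (by positivity), ← ENNReal.ofReal_mul (by positivity),
        ← ENNReal.ofReal_mul (by positivity)]
      congr 1
      have : Real.exp (L * (u - 1)) = t * Real.exp (L * u) := by
        rw [ht, ← Real.exp_add]; congr 1; ring
      rw [this]; ring
    · intro u _
      have : HasDerivAt (fun u => Real.exp (L * u)) (Real.exp (L * u) * (L * 1)) u :=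
        ((hasDerivAt_id u).const_mul L).exp
      exact (this.congr_deriv (by ring)).hasDerivWithinAt
    · intro u _ v _ h
      have := Real.exp_injective h
      exact mul_left_cancel₀ hL.ne' this
  · exact Eventually.of_forall fun u => by positivity
  · have : Measurable fun u : ℝ => μ.real {y | Real.exp (L * u) < a y} := hFr.comp (by fun_prop)
    exact Measurable.aestronglyMeasurable (by fun_prop)
  · refine Eventually.of_forall fun y => ?_
    have : Real.exp (-(t * a y)) ≤ 1 := Real.exp_le_one_iff.2 (by have := ha0 y; nlinarith)
    simp only [Pi.zero_apply]; linarith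
  · exact Measurable.aestronglyMeasurable (by fun_prop)

lemma hk_A {E : Type*} [MeasurableSpace E] (μ : Measure E) [IsProbabilityMeasure μ]
    {a : E → ℝ} (ha : Measurable a) (ha0 : ∀ y, 0 ≤ a y) {c : ℝ}
    (tail : Tendsto (fun s => s * μ.real {y | s < a y}) atTop (nhds c)) :
    Tendsto (fun t => (∫ y, (1 - Real.exp (-(t * a y))) ∂μ) / (t * Real.log (1 / t)))
      (nhdsWithin 0 (Set.Ioi 0)) (nhds c) := by
  have hFm : Measurable fun s : ℝ => μ {y | s < a y} :=
    Antitone.measurable (fun s t hst => measure_mono fun y hy => lt_of_le_of_lt hst hy)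
  have h := hk_DCT (F := fun s => μ.real {y | s < a y}) hFm.ennreal_toReal (fun s => by positivity)
    (fun s => measureReal_le_one) tail
  have hl : Tendsto (fun t : ℝ => - Real.log t) (nhdsWithin 0 (Set.Ioi 0)) atTop :=
    tendsto_neg_atBot_atTop.comp Real.tendsto_log_nhdsGT_zero
  refine (h.comp hl).congr' ?_
  filter_upwards [self_mem_nhdsWithin, hl.eventually_gt_atTop 0] with t ht hL
  have := hk_layer μ ha ha0 hL
  rw [neg_neg, Real.exp_log ht] at this
  rw [this]
  have h3 : Real.log (1 / t) = - Real.log t := by simp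
  rw [h3, mul_div_cancel_left₀]
  · rfl
  · have : 0 < t := ht
    positivity

lemma hk_int_pow {E : Type*} [MeasurableSpace E] (μ : Measure E) [IsProbabilityMeasure μ]
    {a : E → ℝ} (ha : Measurable a) (ha0 : ∀ y, 0 ≤ a y) {c : ℝ}
    (tail : Tendsto (fun s => s * μ.real {y | s < a y}) atTop (nhds c)) {β : ℝ} (h0 : 0 < β) (h1 : β < 1) :
    Integrable (fun y => a y ^ β) μ := by
  obtain ⟨M, hM1, hM⟩ := hk_M (F := fun s => μ.real {y | s < a y}) (fun s => measureReal_le_one) tail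
  refine ⟨(ha.pow_const β).aestronglyMeasurable, ?_⟩
  rw [hasFiniteIntegral_iff_ofReal (Eventually.of_forall fun y => Real.rpow_nonneg (ha0 y) _),
    lintegral_rpow_eq_lintegral_meas_lt_mul μ (Eventually.of_forall ha0) ha.aemeasurable h0]
  refine ENNReal.mul_lt_top ENNReal.ofReal_lt_top ?_
  rw [← Set.Ioc_union_Ioi_eq_Ioi (zero_le_one (α := ℝ))]
  refine (lintegral_union_le _ _ _).trans_lt (ENNReal.add_lt_top.2 ⟨?_, ?_⟩)
  · have : IntegrableOn (fun t : ℝ => t ^ (β - 1)) (Set.Ioc 0 1) := by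
      rw [← intervalIntegrable_iff_integrableOn_Ioc_of_le zero_le_one]
      exact intervalIntegral.intervalIntegrable_rpow' (by linarith)
    refine lt_of_le_of_lt ?_ (this.lintegral_lt_top)
    refine lintegral_mono fun s => ?_
    exact mul_le_of_le_one_left (by positivity) prob_le_one
  · have : IntegrableOn (fun t : ℝ => M * t ^ (β - 2)) (Set.Ioi 1) :=
      (integrableOn_Ioi_rpow_of_lt (by linarith) zero_lt_one).const_mul _
    refine lt_of_le_of_lt ?_ (this.lintegral_lt_top)
    refine setLIntegral_mono' measurableSet_Ioi fun s hs => ?_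
    have hs : 1 < s := hs
    have hs0 : 0 < s := by linarith
    rw [← ofReal_measureReal (μ := μ), ← ENNReal.ofReal_mul (by positivity)]
    apply ENNReal.ofReal_le_ofReal
    have e : s ^ (β - 1) = s * s ^ (β - 2) := by
      rw [← Real.rpow_one_add' hs0.le (by linarith)]; congr 1; ring
    rw [e, ← mul_assoc, mul_comm _ s]
    gcongr
    exact hM s hs0

lemma hk_E {E : Type*} [MeasureSpace E] [SigmaFinite (volume : Measure E)]
    {ρ a : E → ℝ} (hρm : Measurable ρ) (hρ0 : ∀ y, 0 ≤ ρ y) (hρi : Integrable ρ)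
    (ha : Measurable a) (ha0 : ∀ y, 0 ≤ a y) (hapos : ∀ᵐ y, 0 < a y) {β : ℝ} (h0 : 0 < β) (n : ℕ) :
    IntegrableOn (fun t : ℝ => t ^ (β - 1) * ((∫ y, ρ y * a y ^ β * Real.exp (-(t * a y))) *
      (∫ y, ρ y * Real.exp (-(t * a y))) ^ n)) (Set.Ioi 0) ∧
    ∫ t in Set.Ioi (0:ℝ), t ^ (β - 1) * ((∫ y, ρ y * a y ^ β * Real.exp (-(t * a y))) *
      (∫ y, ρ y * Real.exp (-(t * a y))) ^ n) = Real.Gamma β *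
      ∫ xs : Fin (n+1) → E, (a (xs 0) / ∑ j, a (xs j)) ^ β * ∏ i, ρ (xs i) := by
  set f : ℝ → (Fin (n+1) → E) → ℝ := fun t xs =>
    t ^ (β - 1) * (Real.exp (-((∑ j, a (xs j)) * t)) * (a (xs 0) ^ β * ∏ i, ρ (xs i))) with hf
  have hprod0 : ∀ xs : Fin (n+1) → E, 0 ≤ ∏ i, ρ (xs i) := fun xs => Finset.prod_nonneg fun i _ => hρ0 _
  have hsum : ∀ᵐ xs : Fin (n+1) → E, 0 < ∑ j, a (xs j) := by
    have : ∀ᵐ xs : Fin (n+1) → E, 0 < a (xs 0) :=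
      (Measure.quasiMeasurePreserving_eval (μ := fun _ : Fin (n+1) => (volume : Measure E)) 0).ae hapos
    filter_upwards [this] with xs h
    exact h.trans_le (Finset.single_le_sum (f := fun j => a (xs j)) (fun i _ => ha0 _) (Finset.mem_univ 0))
  -- t-integral
  have hin : ∀ xs : Fin (n+1) → E, 0 < ∑ j, a (xs j) →
      IntegrableOn (fun t => f t xs) (Set.Ioi 0) ∧ ∫ t in Set.Ioi (0:ℝ), f t xs =
       Real.Gamma β * ((a (xs 0) / ∑ j, a (xs j)) ^ β * ∏ i, ρ (xs i)) := by
    intro xs hS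
    constructor
    · have := integrableOn_rpow_mul_exp_neg_mul_rpow (s := β - 1) (p := 1) (by linarith) one_pos hS
      have := Integrable.mul_const this (a (xs 0) ^ β * ∏ i, ρ (xs i))
      refine IntegrableOn.congr_fun this (fun t _ => ?_) measurableSet_Ioi
      simp [hf, mul_assoc]
    · have := Real.integral_rpow_mul_exp_neg_mul_Ioi h0 hS
      simp only [hf, ← mul_assoc]
      rw [integral_mul_const, integral_mul_const, this, Real.div_rpow (ha0 _) hS.le,
        Real.div_rpow zero_le_one hS.le, Real.one_rpow]
      ring
  have hm : Measurable (Function.uncurry f) := by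
    have h1 : ∀ i : Fin (n+1), Measurable fun p : ℝ × (Fin (n+1) → E) => a (p.2 i) := fun i =>
      ha.comp ((measurable_pi_apply i).comp measurable_snd)
    have h2 : ∀ i : Fin (n+1), Measurable fun p : ℝ × (Fin (n+1) → E) => ρ (p.2 i) := fun i =>
      hρm.comp ((measurable_pi_apply i).comp measurable_snd)
    have h3 := h1 0
    simp only [hf, Function.uncurry_def]
    fun_prop
  have hprodi : Integrable fun xs : Fin (n+1) → E => ∏ i, ρ (xs i) :=
    Integrable.fintype_prod (f := fun _ => ρ) fun _ => hρi
  have hint : Integrable (Function.uncurry f) ((volume.restrict (Set.Ioi (0:ℝ))).prod volume) := by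
    rw [integrable_prod_iff' hm.aestronglyMeasurable]
    constructor
    · filter_upwards [hsum] with xs hS
      exact (hin xs hS).1
    · have hmm : AEStronglyMeasurable (fun xs : Fin (n+1) → E => ∫ t in Set.Ioi (0:ℝ), ‖Function.uncurry f (t, xs)‖) volume :=
        (hm.norm.stronglyMeasurable.integral_prod_left').aestronglyMeasurable
      refine (hprodi.const_mul (Real.Gamma β)).mono' hmm ?_
      filter_upwards [hsum] with xs hS
      have e : ∫ t in Set.Ioi (0:ℝ), ‖Function.uncurry f (t, xs)‖ = ∫ t in Set.Ioi (0:ℝ), f t xs := by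
        refine setIntegral_congr_fun measurableSet_Ioi fun t ht => ?_
        have ht : 0 < t := ht
        simp only [Function.uncurry]
        refine Real.norm_of_nonneg ?_
        have := hprod0 xs
        have := ha0 (xs 0)
        simp only [hf]; positivity
      have hle : (a (xs 0) / ∑ j, a (xs j)) ^ β ≤ 1 := by
        apply Real.rpow_le_one (div_nonneg (ha0 _) hS.le) _ h0.le
        rw [div_le_one hS]
        exact Finset.single_le_sum (f := fun j => a (xs j)) (fun i _ => ha0 _) (Finset.mem_univ 0)
      have hG := Real.Gamma_pos_of_pos h0
      rw [e, (hin xs hS).2, Real.norm_of_nonneg]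
      · gcongr
        exact mul_le_of_le_one_left (hprod0 xs) hle
      · have := hprod0 xs
        have := div_nonneg (ha0 (xs 0)) hS.le
        positivity
  have hprod : ∀ t : ℝ, ∫ xs, f t xs = t ^ (β - 1) * ((∫ y, ρ y * a y ^ β * Real.exp (-(t * a y))) *
      (∫ y, ρ y * Real.exp (-(t * a y))) ^ n) := by
    intro t
    have := integral_fintype_prod_volume_eq_prod (𝕜 := ℝ) (E := fun _ : Fin (n+1) => E)
      (fun i y => if i = 0 then ρ y * a y ^ β * Real.exp (-(t * a y)) else ρ y * Real.exp (-(t * a y)))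
    simp only [Fin.prod_univ_succ, if_true, Fin.succ_ne_zero, if_false, Finset.prod_const, Finset.card_univ,
      Fintype.card_fin] at this
    rw [← this]
    simp only [hf]
    rw [integral_const_mul]
    congr 2
    ext xs
    rw [Finset.sum_mul, ← Finset.sum_neg_distrib, Real.exp_sum, Fin.prod_univ_succ, Fin.prod_univ_succ,
      Finset.prod_mul_distrib]
    simp only [mul_comm t]
    ring
  have h1 := hint.integral_prod_left
  simp only [Function.uncurry, hprod] at h1
  refine ⟨h1, ?_⟩
  simp only [← hprod]
  rw [integral_integral_swap hint, ← integral_const_mul]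
  refine integral_congr_ae ?_
  filter_upwards [hsum] with xs hS
  exact (hin xs hS).2

lemma hk_m_tendsto {c : ℝ} (hc : 0 < c) : Tendsto (fun n : ℕ => c * n * Real.log n) atTop atTop := by
  have h1 : Tendsto (fun n : ℕ => c * (n:ℝ)) atTop atTop := tendsto_natCast_atTop_atTop.const_mul_atTop hc
  exact h1.atTop_mul_atTop₀ (Real.tendsto_log_atTop.comp tendsto_natCast_atTop_atTop)

lemma hk_pt {h : ℝ → ℝ} {c : ℝ} (hc : 0 < c)
    (hlim : Tendsto (fun t => h t / (t * Real.log (1 / t))) (nhdsWithin 0 (Set.Ioi 0)) (nhds c))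
    {s : ℝ} (hs : 0 < s) :
    Tendsto (fun n : ℕ => (n:ℝ) * h (s / (c * n * Real.log n))) atTop (nhds s) := by
  have hm := hk_m_tendsto hc
  have ht : Tendsto (fun n : ℕ => s / (c * n * Real.log n)) atTop (nhdsWithin 0 (Set.Ioi 0)) := by
    rw [tendsto_nhdsWithin_iff]
    refine ⟨hm.const_div_atTop s, ?_⟩
    filter_upwards [hm.eventually_gt_atTop 0] with n hn
    exact div_pos hs hn
  have h1 := hlim.comp ht
  have hlog : Tendsto (fun n : ℕ => Real.log n) atTop atTop :=
    Real.tendsto_log_atTop.comp tendsto_natCast_atTop_atTop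
  -- log log n / log n → 0
  have hll : Tendsto (fun n : ℕ => Real.log (Real.log n) / Real.log n) atTop (nhds 0) := by
    have := (Real.isLittleO_log_id_atTop.tendsto_div_nhds_zero).comp hlog
    exact this
  have hcl : Tendsto (fun n : ℕ => Real.log (c / s) / Real.log n) atTop (nhds 0) :=
    hlog.const_div_atTop _
  have h2 : Tendsto (fun n : ℕ => s / c * (1 + Real.log (Real.log n) / Real.log n + Real.log (c / s) / Real.log n)) atTop
      (nhds (s / c * (1 + 0 + 0))) := ((tendsto_const_nhds.add hll).add hcl).const_mul _
  have h3 := h1.mul h2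
  have e : c * (s / c * (1 + 0 + 0)) = s := by field_simp; ring
  rw [e] at h3
  refine h3.congr' ?_
  have hpos : ∀ᶠ n : ℕ in atTop, 0 < Real.log (1 / (s / (c * n * Real.log n))) := by
    have : Tendsto (fun n : ℕ => Real.log (1 / (s / (c * n * Real.log n)))) atTop atTop := by
      apply Real.tendsto_log_atTop.comp
      simp only [one_div_div]
      exact hm.atTop_div_const hs
    exact this.eventually_gt_atTop 0
  filter_upwards [hpos, hlog.eventually_gt_atTop 0, eventually_gt_atTop 0] with n hn hl hn0
  have hn0' : (0:ℝ) < n := by exact_mod_cast hn0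
  have hlg : Real.log (1 / (s / (c * n * Real.log n))) = Real.log n + Real.log (Real.log n) + Real.log (c / s) := by
    rw [← Real.log_mul hn0'.ne' hl.ne', ← Real.log_mul (by positivity) (by positivity)]
    congr 1; field_simp
  have e2 : 1 + Real.log (Real.log n) / Real.log n + Real.log (c / s) / Real.log n
      = Real.log (1 / (s / (c * n * Real.log n))) / Real.log n := by
    rw [hlg]; field_simp
  simp only [Function.comp]
  rw [e2]
  set Λ := Real.log (1 / (s / (c * n * Real.log n)))
  set l := Real.log n
  generalize h (s / (c * n * l)) = H
  field_simp

lemma hk_bd {φ : ℝ → ℝ} {c : ℝ} (hc : 0 < c) (hφ0 : ∀ t, 0 ≤ φ t)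
    (hlim : Tendsto (fun t => (1 - φ t) / (t * Real.log (1 / t))) (nhdsWithin 0 (Set.Ioi 0)) (nhds c)) :
    ∀ᶠ n : ℕ in atTop, ∀ s, 0 < s → s ≤ √n → φ (s / (c * n * Real.log n)) ^ n ≤ Real.exp (-(s / 4)) := by
  have hlog : Tendsto (fun n : ℕ => Real.log n) atTop atTop :=
    Real.tendsto_log_atTop.comp tendsto_natCast_atTop_atTop
  have h1 := hlim.eventually (eventually_ge_nhds (show c / 2 < c by linarith))
  rw [eventually_nhdsWithin_iff, Metric.eventually_nhds_iff] at h1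
  obtain ⟨δ, hδ, h1⟩ := h1
  have hsq : Tendsto (fun n : ℕ => √(n:ℝ)) atTop atTop :=
    Real.tendsto_sqrt_atTop.comp tendsto_natCast_atTop_atTop
  filter_upwards [hlog.eventually_gt_atTop 0, hlog.eventually_ge_atTop (1 / c), eventually_gt_atTop 1,
    hsq.eventually_gt_atTop (1 / δ)] with n hl hlc hn hδn s hs hsn
  have hn0 : (0:ℝ) < n := by positivity
  have hn1 : (1:ℝ) < n := by exact_mod_cast hn
  have hsqpos : 0 < √(n:ℝ) := Real.sqrt_pos.2 hn0
  have hsqn : √(n:ℝ) * √(n:ℝ) = n := Real.mul_self_sqrt hn0.le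
  have hmn : (n:ℝ) ≤ c * n * Real.log n := by
    rw [div_le_iff₀ hc] at hlc
    nlinarith
  set m := c * n * Real.log n with hm
  have hmpos : 0 < m := by positivity
  have hinv : √(n:ℝ) ≤ 1 / (s / m) := by
    rw [one_div_div, le_div_iff₀ hs]; nlinarith
  have htpos : 0 < s / m := by positivity
  have ht : s / m < δ := by
    have := hδn.trans_le hinv
    exact (one_div_lt_one_div hδ htpos).1 this
  have h2 := h1 (y := s / m) (by rw [Real.dist_eq, sub_zero, abs_of_pos htpos]; exact ht) htpos
  have hlg : Real.log n / 2 ≤ Real.log (1 / (s / m)) := by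
    rw [← Real.log_sqrt hn0.le]
    exact Real.log_le_log hsqpos hinv
  rw [le_div_iff₀ (mul_pos htpos (by linarith))] at h2
  have h3 : s / 4 ≤ n * (1 - φ (s / m)) := by
    calc s / 4 = n * (c / 2 * (s / m * (Real.log n / 2))) := by rw [hm]; field_simp; norm_num
      _ ≤ n * (c / 2 * (s / m * Real.log (1 / (s / m)))) := by gcongr
      _ ≤ _ := by gcongr
  have h4 : φ (s / m) ≤ Real.exp (-(1 - φ (s/m))) := by
    have := Real.add_one_le_exp (-(1 - φ (s/m))); linarith
  calc φ (s/m) ^ n ≤ Real.exp (-(1 - φ (s/m))) ^ n := pow_le_pow_left₀ (hφ0 _) h4 n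
    _ = Real.exp (n * (-(1 - φ (s/m)))) := by rw [← Real.exp_nat_mul]
    _ ≤ _ := Real.exp_le_exp.2 (by linarith)

lemma hk_small {c β : ℝ} (hc : 0 < c) (hβ : 0 < β) :
    Tendsto (fun n : ℕ => Real.exp (-(√n / 4)) * (c * n * Real.log n) ^ β) atTop (nhds 0) := by
  have hsq : Tendsto (fun n : ℕ => √(n:ℝ)) atTop atTop :=
    Real.tendsto_sqrt_atTop.comp tendsto_natCast_atTop_atTop
  have h := ((tendsto_rpow_mul_exp_neg_mul_atTop_nhds_zero (4 * β) (1/4) (by norm_num)).comp hsq).const_mul (c ^ β)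
  rw [mul_zero] at h
  refine squeeze_zero' ?_ ?_ h
  · filter_upwards [eventually_gt_atTop 0] with n hn
    have : 0 ≤ Real.log n := Real.log_natCast_nonneg n
    positivity
  · filter_upwards [eventually_gt_atTop 0] with n hn
    have hn0 : (0:ℝ) < n := by exact_mod_cast hn
    have hl : 0 ≤ Real.log n := Real.log_natCast_nonneg n
    have hl2 : Real.log n ≤ n := (Real.log_le_sub_one_of_pos hn0).trans (by linarith)
    have e : √(n:ℝ) ^ (4 * β) = ((n:ℝ) * n) ^ β := by
      rw [Real.rpow_mul (Real.sqrt_nonneg _)]; congr 1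
      have : √(n:ℝ) * √(n:ℝ) = n := Real.mul_self_sqrt hn0.le
      rw [show (4:ℝ) = ((4:ℕ):ℝ) by norm_num, Real.rpow_natCast]
      calc √(n:ℝ)^4 = (√(n:ℝ) * √(n:ℝ)) * (√(n:ℝ) * √(n:ℝ)) := by ring
        _ = _ := by rw [this]
    simp only [Function.comp]
    rw [e, ← mul_assoc, ← Real.mul_rpow hc.le (by positivity), mul_comm]
    have e3 : -(√(n:ℝ) / 4) = -(1/4) * √(n:ℝ) := by ring
    rw [e3]
    gcongr ?_ ^ β * _
    rw [mul_assoc]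
    gcongr

lemma hk_main {φ ψ : ℝ → ℝ} {c κ β : ℝ} (hc : 0 < c) (hβ : 0 < β) (hφ0 : ∀ t, 0 ≤ φ t)
    (hφa : ∀ t t', 0 < t → t ≤ t' → φ t' ≤ φ t)
    (hlim : Tendsto (fun t => (1 - φ t) / (t * Real.log (1 / t))) (nhdsWithin 0 (Set.Ioi 0)) (nhds c))
    (hψ0 : ∀ t, 0 ≤ ψ t) (hψκ : ∀ t, 0 < t → ψ t ≤ κ)
    (hψlim : Tendsto ψ (nhdsWithin 0 (Set.Ioi 0)) (nhds κ))
    (hint : ∀ n : ℕ, IntegrableOn (fun t : ℝ => t ^ (β - 1) * (ψ t * φ t ^ n)) (Set.Ioi 0)) :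
    Tendsto (fun n : ℕ => (c * n * Real.log n) ^ β * ∫ t in Set.Ioi (0:ℝ), t ^ (β - 1) * (ψ t * φ t ^ n))
      atTop (nhds (κ * Real.Gamma β)) := by
  set m : ℕ → ℝ := fun n => c * n * Real.log n with hm
  have hmt : Tendsto m atTop atTop := hk_m_tendsto hc
  set H : ℕ → ℕ → ℝ → ℝ := fun n k s => s ^ (β - 1) * (ψ (s / m n) * φ (s / m n) ^ k) with hH
  have hHeq : ∀ n k s, 0 < m n → 0 < s → H n k s = m n ^ (β - 1) * (((m n)⁻¹ * s) ^ (β - 1) * (ψ ((m n)⁻¹ * s) * φ ((m n)⁻¹ * s) ^ k)) := by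
    intro n k s hmn hs
    simp only [hH]
    rw [← mul_assoc (m n ^ (β - 1)), ← Real.mul_rpow hmn.le (by positivity), mul_inv_cancel_left₀ hmn.ne', div_eq_inv_mul]
  have hHi : ∀ n k, 0 < m n → IntegrableOn (H n k) (Set.Ioi 0) := by
    intro n k hmn
    have := (integrableOn_Ioi_comp_mul_left_iff (fun t : ℝ => t ^ (β - 1) * (ψ t * φ t ^ k)) 0 (inv_pos.2 hmn)).2
      (by simpa using hint k)
    refine IntegrableOn.congr_fun (Integrable.const_mul this (m n ^ (β - 1))) (fun s hs => ?_) measurableSet_Ioi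
    exact (hHeq n k s hmn hs).symm
  have hHint : ∀ n k, 0 < m n → ∫ s in Set.Ioi (0:ℝ), H n k s = m n ^ β * ∫ t in Set.Ioi (0:ℝ), t ^ (β - 1) * (ψ t * φ t ^ k) := by
    intro n k hmn
    rw [setIntegral_congr_fun measurableSet_Ioi (fun s hs => hHeq n k s hmn hs), integral_const_mul,
      integral_comp_mul_left_Ioi (fun t : ℝ => t ^ (β - 1) * (ψ t * φ t ^ k)) 0 (inv_pos.2 hmn)]
    simp only [mul_zero, inv_inv, smul_eq_mul]
    rw [← mul_assoc, ← Real.rpow_add_one hmn.ne']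
    simp
  have hH0 : ∀ n k s, 0 < s → 0 ≤ H n k s := by
    intro n k s hs
    have h1 := hψ0 (s / m n)
    have h2 := hφ0 (s / m n)
    simp only [hH]
    positivity
  have hbd := hk_bd hc hφ0 hlim
  have hmpos : ∀ᶠ n in atTop, 0 < m n := hmt.eventually_gt_atTop 0
  have hsq : Tendsto (fun n : ℕ => √(n:ℝ)) atTop atTop :=
    Real.tendsto_sqrt_atTop.comp tendsto_natCast_atTop_atTop
  have P1 : Tendsto (fun n : ℕ => ∫ s in Set.Ioi (0:ℝ), (Set.Iic √n).indicator (H n n) s) atTop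
      (nhds (∫ s in Set.Ioi (0:ℝ), s ^ (β - 1) * (κ * Real.exp (-s)))) := by
    apply tendsto_integral_filter_of_dominated_convergence (fun s => κ * (s ^ (β - 1) * Real.exp (-(1/4) * s ^ (1:ℝ))))
    · filter_upwards [hmpos] with n hn
      exact (hHi n n hn).aestronglyMeasurable.indicator measurableSet_Iic
    · filter_upwards [hmpos, hbd] with n hn hb
      rw [ae_restrict_iff' measurableSet_Ioi]
      refine Eventually.of_forall fun s hs => ?_
      have hs : 0 < s := hs
      have hκ : 0 ≤ κ := (hψ0 1).trans (hψκ 1 one_pos)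
      by_cases hsn : s ≤ √n
      · rw [Set.indicator_of_mem (by exact hsn), Real.norm_of_nonneg (hH0 n n s hs)]
        have h1 := hb s hs hsn
        have h2 := hψκ (s / m n) (div_pos hs hn)
        have h3 := hφ0 (s / m n)
        calc H n n s ≤ s ^ (β - 1) * (κ * Real.exp (-(s/4))) := by
              simp only [hH]; gcongr
          _ = _ := by
              rw [Real.rpow_one, show -(s/4) = -(1/4) * s by ring]; ring
      · rw [Set.indicator_of_notMem (by exact hsn), norm_zero]
        positivity
    · exact (integrableOn_rpow_mul_exp_neg_mul_rpow (by linarith) one_pos (by norm_num)).const_mul _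
    · rw [ae_restrict_iff' measurableSet_Ioi]
      refine Eventually.of_forall fun s hs => ?_
      have hs : 0 < s := hs
      have ht : Tendsto (fun n : ℕ => s / m n) atTop (nhdsWithin 0 (Set.Ioi 0)) := by
        rw [tendsto_nhdsWithin_iff]
        refine ⟨hmt.const_div_atTop s, ?_⟩
        filter_upwards [hmpos] with n hn
        exact div_pos hs hn
      have h1 := hk_pt (h := fun t => 1 - φ t) hc hlim hs
      have h2 := Real.tendsto_one_add_pow_exp_of_tendsto (g := fun n => -(1 - φ (s / m n))) (t := -s)
        (by simpa only [mul_neg] using h1.neg)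
      simp only [neg_sub, add_sub_cancel] at h2
      refine (((hψlim.comp ht).mul h2).const_mul (s ^ (β - 1))).congr' ?_
      filter_upwards [hsq.eventually_ge_atTop s] with n hn
      rw [Set.indicator_of_mem (by exact hn)]
      rfl
  have hval : ∫ s in Set.Ioi (0:ℝ), s ^ (β - 1) * (κ * Real.exp (-s)) = κ * Real.Gamma β := by
    rw [Real.Gamma_eq_integral hβ, ← integral_const_mul]
    congr 1; ext s; ring
  rw [hval] at P1
  have P2 : Tendsto (fun n : ℕ => ∫ s in Set.Ioi (0:ℝ), (Set.Ioi √n).indicator (H n n) s) atTop (nhds 0) := by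
    have h := (hk_small hc hβ).mul_const (∫ t in Set.Ioi (0:ℝ), t ^ (β - 1) * (ψ t * φ t ^ 0))
    rw [zero_mul] at h
    refine squeeze_zero' ?_ ?_ h
    · refine Eventually.of_forall fun n => setIntegral_nonneg measurableSet_Ioi fun s hs => ?_
      exact Set.indicator_nonneg (fun s hs => hH0 n n s ((Real.sqrt_nonneg _).trans_lt hs)) _
    · filter_upwards [hmpos, hbd, eventually_gt_atTop 0] with n hn hb hn0
      have hsp : 0 < √(n:ℝ) := Real.sqrt_pos.2 (by exact_mod_cast hn0)
      rw [mul_assoc, ← hHint n 0 hn, ← integral_const_mul]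
      refine setIntegral_mono_on ((hHi n n hn).indicator measurableSet_Ioi)
        (Integrable.const_mul (hHi n 0 hn) _) measurableSet_Ioi fun s hs => ?_
      have hs : 0 < s := hs
      by_cases hsn : √n < s
      · rw [Set.indicator_of_mem (by exact hsn)]
        have h1 := hb _ hsp le_rfl
        have h2 : φ (s / m n) ≤ φ (√n / m n) := hφa _ _ (div_pos hsp hn) (by gcongr)
        have h3 := hφ0 (s / m n)
        have h4 := hψ0 (s / m n)
        have h5 : φ (s / m n) ^ n ≤ Real.exp (-(√n/4)) := (pow_le_pow_left₀ h3 h2 n).trans h1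
        calc H n n s ≤ s ^ (β - 1) * (ψ (s / m n) * Real.exp (-(√n/4))) := by
              simp only [hH]; gcongr
          _ = _ := by simp only [hH, pow_zero]; ring
      · rw [Set.indicator_of_notMem (by exact hsn)]
        have := hH0 n 0 s hs
        positivity
  have P := P1.add P2
  rw [add_zero] at P
  refine P.congr' ?_
  filter_upwards [hmpos] with n hn
  rw [← integral_add ((hHi n n hn).indicator measurableSet_Iic) ((hHi n n hn).indicator measurableSet_Ioi),
    ← hHint n n hn]
  refine integral_congr_ae (Eventually.of_forall fun s => ?_)
  have := Set.indicator_self_add_compl (Set.Iic √(n:ℝ)) (H n n)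
  rw [Set.compl_Iic] at this
  exact congrFun this s

lemma hk_tail (d : ℕ) (hd : 1 ≤ d) (ρ : Euc d → ℝ) (hρm : Measurable ρ) (hρ0 : ∀ y, 0 ≤ ρ y)
    (hρi : Integrable ρ) (x : Euc d) (hc : ContinuousAt ρ x) :
    Tendsto (fun s : ℝ => s * (volume.withDensity (fun y => ENNReal.ofReal (ρ y))).real
      {y | s < ‖x - y‖ ^ (-(d:ℝ))}) atTop (nhds (unitBallVol d * ρ x)) := by
  have hdpos : (0:ℝ) < d := by exact_mod_cast hd
  haveI : Nonempty (Fin d) := ⟨⟨0, hd⟩⟩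
  have hV : 0 < unitBallVol d := by
    unfold unitBallVol
    have := Real.Gamma_pos_of_pos (show 0 < (d:ℝ)/2 + 1 by positivity)
    have := Real.pi_pos
    positivity
  set r : ℝ → ℝ := fun s => s ^ (-(1 / (d:ℝ))) with hr
  have hrt : Tendsto r atTop (nhds 0) := tendsto_rpow_neg_atTop (by positivity)
  have hset : ∀ s : ℝ, 0 < s → {y | s < ‖x - y‖ ^ (-(d:ℝ))} = Metric.ball x (r s) \ {x} := by
    intro s hs
    ext y
    simp only [Set.mem_setOf_eq, Set.mem_diff, Metric.mem_ball, Set.mem_singleton_iff, dist_comm y x, dist_eq_norm]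
    by_cases hy : y = x
    · subst hy
      simp [Real.zero_rpow (neg_ne_zero.2 hdpos.ne'), hs.le]
    · have hp : 0 < ‖x - y‖ := norm_pos_iff.2 (sub_ne_zero.2 (Ne.symm hy))
      simp only [hy, not_false_eq_true, and_true]
      have e : s = (r s) ^ (-(d:ℝ)) := by
        rw [hr, ← Real.rpow_mul hs.le]
        rw [show -(1 / (d:ℝ)) * -(d:ℝ) = 1 by field_simp, Real.rpow_one]
      have hrp : 0 < r s := Real.rpow_pos_of_pos hs _
      conv_lhs => rw [e]
      exact Real.rpow_lt_rpow_iff_of_neg hrp hp (by linarith)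
  have hvol : ∀ s : ℝ, 0 < s → volume.real (Metric.ball x (r s)) = unitBallVol d / s := by
    intro s hs
    have hrp : 0 < r s := Real.rpow_pos_of_pos hs _
    rw [measureReal_def, EuclideanSpace.volume_ball, ← ENNReal.ofReal_pow hrp.le, ← ENNReal.ofReal_mul (by positivity),
      Fintype.card_fin, ENNReal.toReal_ofReal]
    · have e1 : r s ^ d = s⁻¹ := by
        rw [hr, ← Real.rpow_natCast, ← Real.rpow_mul hs.le,
          show -(1 / (d:ℝ)) * (d:ℝ) = -1 by field_simp, Real.rpow_neg_one]
      have e2 : √Real.pi ^ d = Real.pi ^ ((d:ℝ)/2) := by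
        rw [Real.sqrt_eq_rpow, ← Real.rpow_natCast, ← Real.rpow_mul Real.pi_pos.le]
        congr 1; ring
      rw [e1, e2, unitBallVol]; field_simp
    · have := Real.Gamma_pos_of_pos (show 0 < (d:ℝ)/2 + 1 by positivity)
      positivity
  have hμ : ∀ s : ℝ, 0 < s → (volume.withDensity (fun y => ENNReal.ofReal (ρ y))).real
      {y | s < ‖x - y‖ ^ (-(d:ℝ))} = ∫ y in Metric.ball x (r s), ρ y := by
    intro s hs
    rw [hset s hs, measureReal_def, withDensity_apply _ (Metric.isOpen_ball.measurableSet.diff (measurableSet_singleton x)),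
      ← integral_eq_lintegral_of_nonneg_ae (Eventually.of_forall hρ0) hρm.aestronglyMeasurable]
    refine setIntegral_congr_set ?_
    exact diff_null_ae_eq_self (by simp)
  have hsm : Tendsto (fun s => Metric.ball x (r s)) atTop (nhds x).smallSets := by
    rw [tendsto_smallSets_iff]
    intro t ht
    obtain ⟨ε, hε, hεt⟩ := Metric.mem_nhds_iff.1 ht
    filter_upwards [hrt.eventually (gt_mem_nhds hε)] with s hs
    exact (Metric.ball_subset_ball hs.le).trans hεt
  have hev : (fun s => volume.real (Metric.ball x (r s))) =ᶠ[atTop] fun s => unitBallVol d / s := by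
    filter_upwards [eventually_gt_atTop 0] with s hs using hvol s hs
  have ho := ContinuousAt.integral_sub_linear_isLittleO_ae (μ := volume) hc
    (hρm.stronglyMeasurable.stronglyMeasurableAtFilter) hsm (fun s => unitBallVol d / s) hev
  have h1 := (ho.tendsto_div_nhds_zero.const_mul (unitBallVol d)).add_const (unitBallVol d * ρ x)
  rw [mul_zero, zero_add] at h1
  refine h1.congr' ?_
  filter_upwards [eventually_gt_atTop 0] with s hs
  rw [hμ s hs, smul_eq_mul]
  field_simp
  ring

/-- for a probability density `ρ` on `ℝ^d` with finite variance, `x` in the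
interior of the support of `ρ`, `ρ` continuous at `x`, and `0 < β < 1`, the quantity
`κ_β(x) = ∫ ρ(x+y)·‖y‖^{−βd} dy` is finite and the β-th moment of the Hilbert kernel weight
`w_0(x)` satisfies `E[w_0(x)^β] ~ κ_β(x)/(V_d·ρ(x)·n·ln n)^β` as `n → ∞`. -/
theorem hilbert_moment_asymptotic_beta_lt_one
    (d : ℕ) (hd : 1 ≤ d)
    (ρ : Euc d → ℝ) (hρ_meas : Measurable ρ) (hρ_nonneg : ∀ y, 0 ≤ ρ y)
    (hρ_prob : (∫ y, ρ y) = 1)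
    (hρ_var : Integrable (fun y => ρ y * ‖y‖ ^ 2))
    (x : Euc d) (hx : x ∈ interior {y | 0 < ρ y}) (hρ_cont : ContinuousAt ρ x)
    (β : ℝ) (hβ0 : 0 < β) (hβ1 : β < 1) :
    Integrable (fun y : Euc d => ρ (x + y) * ‖y‖ ^ (-(β * d))) ∧
    Tendsto (fun n : ℕ =>
        (∫ xs : Fin (n + 1) → Euc d,
            hilbertWeight d n x xs 0 ^ β * ∏ i : Fin (n + 1), ρ (xs i)) /
          ((∫ y : Euc d, ρ (x + y) * ‖y‖ ^ (-(β * d))) /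
            (unitBallVol d * ρ x * (n : ℝ) * Real.log n) ^ β))
      atTop (nhds 1) := by
  have hdpos : (0:ℝ) < d := by exact_mod_cast hd
  haveI : Nonempty (Fin d) := ⟨⟨0, hd⟩⟩
  have hρx : 0 < ρ x := by
    have h := interior_subset hx
    exact h
  have hV : 0 < unitBallVol d := by
    unfold unitBallVol
    have := Real.Gamma_pos_of_pos (show 0 < (d:ℝ)/2 + 1 by positivity)
    have := Real.pi_pos
    positivity
  have hρi : Integrable ρ := by
    by_contra h
    rw [integral_undef h] at hρ_prob
    exact zero_ne_one hρ_prob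
  set a : Euc d → ℝ := fun y => ‖x - y‖ ^ (-(d:ℝ)) with ha_def
  have ha : Measurable a := by
    have : Measurable fun y : Euc d => ‖x - y‖ := by fun_prop
    exact this.pow_const _
  have ha0 : ∀ y, 0 ≤ a y := fun y => Real.rpow_nonneg (norm_nonneg _) _
  have hapos : ∀ᵐ y, 0 < a y := by
    have : ∀ᵐ y : Euc d, y ≠ x := by simp [ae_iff]
    filter_upwards [this] with y hy
    exact Real.rpow_pos_of_pos (norm_pos_iff.2 (sub_ne_zero.2 hy.symm)) _
  set μ : Measure (Euc d) := volume.withDensity (fun y => ENNReal.ofReal (ρ y)) with hμ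
  have hof : Measurable fun y => ENNReal.ofReal (ρ y) := hρ_meas.ennreal_ofReal
  haveI : IsProbabilityMeasure μ := by
    constructor
    rw [hμ, withDensity_apply _ MeasurableSet.univ, Measure.restrict_univ,
      ← ofReal_integral_eq_lintegral_ofReal hρi (Eventually.of_forall hρ_nonneg), hρ_prob, ENNReal.ofReal_one]
  have hμint : ∀ g : Euc d → ℝ, ∫ y, g y ∂μ = ∫ y, ρ y * g y := by
    intro g
    rw [hμ, integral_withDensity_eq_integral_toReal_smul hof (Eventually.of_forall fun _ => ENNReal.ofReal_lt_top)]
    congr 1; ext y; rw [ENNReal.toReal_ofReal (hρ_nonneg y), smul_eq_mul]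
  have hμI : ∀ g : Euc d → ℝ, Integrable g μ → Integrable fun y => ρ y * g y := by
    intro g hg
    rw [hμ, integrable_withDensity_iff_integrable_smul' hof (Eventually.of_forall fun _ => ENNReal.ofReal_lt_top)] at hg
    refine hg.congr (Eventually.of_forall fun y => ?_)
    simp only [ENNReal.toReal_ofReal (hρ_nonneg y), smul_eq_mul]
  have tail := hk_tail d hd ρ hρ_meas hρ_nonneg hρi x hρ_cont
  have hIβ : Integrable fun y => ρ y * a y ^ β := hμI _ (hk_int_pow μ ha ha0 tail hβ0 hβ1)
  have hshift : ∀ y : Euc d, ρ (x + y) * ‖y‖ ^ (-(β * d)) = ρ (x + y) * a (x + y) ^ β := by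
    intro y
    simp only [ha_def]
    rw [← Real.rpow_mul (norm_nonneg _)]
    simp only [sub_add_cancel_left, norm_neg]
    congr 2; ring
  simp only [hshift]
  refine ⟨hIβ.comp_add_left x, ?_⟩
  rw [integral_add_left_eq_self (fun y => ρ y * a y ^ β) x]
  set κ := ∫ y, ρ y * a y ^ β with hκ
  have hκpos : 0 < κ := by
    rw [hκ, integral_pos_iff_support_of_nonneg (fun y => mul_nonneg (hρ_nonneg y) (Real.rpow_nonneg (ha0 y) _)) hIβ]
    have h1 : 0 < volume (Function.support ρ) := by
      rw [← integral_pos_iff_support_of_nonneg hρ_nonneg hρi, hρ_prob]; exact one_pos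
    refine h1.trans_le (measure_mono_ae ?_)
    filter_upwards [hapos] with y hy hys
    exact mul_ne_zero hys (Real.rpow_pos_of_pos hy _).ne'
  have hexp1 : ∀ t y, 0 ≤ t → Real.exp (-(t * a y)) ≤ 1 := fun t y ht =>
    Real.exp_le_one_iff.2 (by have := mul_nonneg ht (ha0 y); linarith)
  have hφi : ∀ t, 0 ≤ t → Integrable fun y => ρ y * Real.exp (-(t * a y)) := by
    intro t ht
    refine hρi.mono' (Measurable.aestronglyMeasurable (by fun_prop)) (Eventually.of_forall fun y => ?_)
    rw [Real.norm_of_nonneg (mul_nonneg (hρ_nonneg y) (Real.exp_pos _).le)]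
    exact mul_le_of_le_one_right (hρ_nonneg y) (hexp1 t y ht)
  have hψle : ∀ t, 0 ≤ t → ∀ y, ‖ρ y * a y ^ β * Real.exp (-(t * a y))‖ ≤ ρ y * a y ^ β := by
    intro t ht y
    have h0 := mul_nonneg (hρ_nonneg y) (Real.rpow_nonneg (ha0 y) β)
    rw [Real.norm_of_nonneg (mul_nonneg h0 (Real.exp_pos _).le)]
    exact mul_le_of_le_one_right h0 (hexp1 t y ht)
  have hψm : ∀ t, Measurable fun y => ρ y * a y ^ β * Real.exp (-(t * a y)) := by
    intro t; fun_prop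
  have hE := hk_E hρ_meas hρ_nonneg hρi ha ha0 hapos hβ0
  have hmain := hk_main (φ := fun t => ∫ y, ρ y * Real.exp (-(t * a y)))
    (ψ := fun t => ∫ y, ρ y * a y ^ β * Real.exp (-(t * a y))) (c := unitBallVol d * ρ x) (κ := κ) (β := β)
    (mul_pos hV hρx) hβ0
    (fun t => integral_nonneg fun y => mul_nonneg (hρ_nonneg y) (Real.exp_pos _).le)
    (by
      intro t t' ht htt
      refine integral_mono (hφi t' (ht.le.trans htt)) (hφi t ht.le) fun y => ?_
      refine mul_le_mul_of_nonneg_left (Real.exp_le_exp.2 ?_) (hρ_nonneg y)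
      have := mul_le_mul_of_nonneg_right htt (ha0 y)
      linarith)
    (by
      refine (hk_A μ ha ha0 tail).congr' ?_
      filter_upwards [self_mem_nhdsWithin] with t ht
      have ht : 0 < t := ht
      rw [hμint]
      simp only [mul_sub, mul_one]
      rw [integral_sub hρi (hφi t ht.le), hρ_prob])
    (fun t => integral_nonneg fun y => mul_nonneg (mul_nonneg (hρ_nonneg y) (Real.rpow_nonneg (ha0 y) _)) (Real.exp_pos _).le)
    (by
      intro t ht
      refine integral_mono (hIβ.mono' (hψm t).aestronglyMeasurable (Eventually.of_forall (hψle t ht.le))) hIβ fun y => ?_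
      exact (le_abs_self _).trans (hψle t ht.le y))
    (by
      refine tendsto_integral_filter_of_dominated_convergence (fun y => ρ y * a y ^ β)
        (Eventually.of_forall fun t => (hψm t).aestronglyMeasurable) ?_ hIβ ?_
      · filter_upwards [self_mem_nhdsWithin] with t ht
        exact Eventually.of_forall (hψle t (le_of_lt ht))
      · refine Eventually.of_forall fun y => ?_
        have : Continuous fun t : ℝ => ρ y * a y ^ β * Real.exp (-(t * a y)) := by fun_prop
        have := (this.tendsto 0).mono_left (nhdsWithin_le_nhds (s := Set.Ioi 0))
        simpa using this)
    (fun n => (hE n).1)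
  have hG := Real.Gamma_pos_of_pos hβ0
  have hfin := hmain.div_const (κ * Real.Gamma β)
  rw [div_self (by positivity)] at hfin
  refine hfin.congr fun n => ?_
  rw [(hE n).2]
  simp only [hilbertWeight, ha_def]
  field_simp

end
end

section
/- Let d ≥ 1 and let ρ be a probability density on ℝ^d with finite variance. Fix x in the interior of the support of ρ (so ρ(x) > 0) with ρ continuous at x. Let X_1,…,X_n be i.i.d. with density ρ, hold the point x_0 ≠ x fixed, and define the expected Lagrange function L_0(x) = E[ ‖x−x_0‖^{−d} / (‖x−x_0‖^{−d} + Σ_{j=1}^n ‖x−X_j‖^{−d}) ]. Then for every Z ≥ 0, in the joint limit n → ∞ and x_0 → x such that z_x(n,x_0) = V_d·ρ(x)·‖x−x_0‖^d·n·ln(n) → Z, one has L_0(x) → 1/(1+Z), where V_d is the volume of the unit ball in ℝ^d. -/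
open MeasureTheory Filter

noncomputable section

/-- The expected Lagrange function `L_0(x) = E[w_0(x)]` where `x_0` is held fixed and
`X_1,…,X_n` are i.i.d. with density `ρ` (expressed as an integral against `∏ ρ(x_j)`). -/
def lagrangeFn (d n : ℕ) (x x₀ : Euc d) (ρ : Euc d → ℝ) : ℝ :=
  ∫ xs : Fin n → Euc d,
    (‖x - x₀‖ ^ (-(d : ℝ)) /
        (‖x - x₀‖ ^ (-(d : ℝ)) + ∑ j : Fin n, ‖x - xs j‖ ^ (-(d : ℝ)))) *
      ∏ j : Fin n, ρ (xs j)


theorem HL_laplace (d n : ℕ) (x x₀ : Euc d) (ρ : Euc d → ℝ) (hx : x₀ ≠ x)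
    (hm : Measurable ρ) (hi : Integrable ρ) :
    lagrangeFn d n x x₀ ρ = ∫ t in Set.Ioi (0:ℝ), Real.exp (-t) *
      (∫ y, Real.exp (-(t * ‖x - x₀‖ ^ (d:ℝ) * ‖x - y‖ ^ (-(d : ℝ)))) * ρ y) ^ n := by
  unfold lagrangeFn
  set a := ‖x - x₀‖ ^ (d:ℝ) with ha
  have hpos : 0 < ‖x - x₀‖ := norm_pos_iff.2 (sub_ne_zero.2 hx.symm)
  have ha0 : 0 < a := Real.rpow_pos_of_pos hpos _
  have hinv : ‖x - x₀‖ ^ (-(d : ℝ)) = a⁻¹ := Real.rpow_neg hpos.le _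
  rw [hinv]
  clear_value a
  have h1 : ∀ xs : Fin n → Euc d,
      (a⁻¹ / (a⁻¹ + ∑ j : Fin n, ‖x - xs j‖ ^ (-(d : ℝ)))) * ∏ j : Fin n, ρ (xs j)
      = ∫ t in Set.Ioi (0:ℝ), Real.exp (-t) *
        ∏ j, (Real.exp (-(t * a * ‖x - xs j‖ ^ (-(d : ℝ)))) * ρ (xs j)) := by
    intro xs
    set S := ∑ j : Fin n, ‖x - xs j‖ ^ (-(d : ℝ)) with hS
    have hS0 : 0 ≤ S := Finset.sum_nonneg fun j _ => Real.rpow_nonneg (norm_nonneg _) _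
    clear_value S
    have h2 : ∀ t : ℝ, Real.exp (-t) *
        ∏ j, (Real.exp (-(t * a * ‖x - xs j‖ ^ (-(d : ℝ)))) * ρ (xs j)) =
        Real.exp (-(1 + a * S) * t) * ∏ j, ρ (xs j) := by
      intro t
      rw [Finset.prod_mul_distrib, ← Real.exp_sum, ← mul_assoc, ← Real.exp_add,
        Finset.sum_neg_distrib, ← Finset.mul_sum]
      congr 2
      rw [← hS]; ring
    have hp : 0 < 1 + a * S := by positivity
    simp_rw [h2]
    rw [integral_mul_const, integral_exp_mul_Ioi (neg_lt_zero.2 hp)]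
    congr 1
    simp only [mul_zero, Real.exp_zero]
    have := hp.ne'
    have : a⁻¹ + S ≠ 0 := by positivity
    field_simp
  simp_rw [h1]
  rw [integral_integral_swap]
  · congr 1
    ext t
    rw [integral_const_mul]
    congr 1
    have := integral_fintype_prod_volume_eq_pow (ι := Fin n)
      (fun y : Euc d => Real.exp (-(t * a * ‖x - y‖ ^ (-(d : ℝ)))) * ρ y)
    rw [this, Fintype.card_fin]
  · have hg : Integrable (fun p : (Fin n → Euc d) × ℝ => (∏ j, ‖ρ (p.1 j)‖) * Real.exp (-p.2))
        ((volume : Measure (Fin n → Euc d)).prod (volume.restrict (Set.Ioi (0:ℝ)))) := by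
      refine Integrable.mul_prod (f := fun xs : Fin n → Euc d => ∏ j, ‖ρ (xs j)‖)
        (g := fun t : ℝ => Real.exp (-t)) ?_ ?_
      · exact Integrable.fintype_prod (f := fun _ y => ‖ρ y‖) (fun _ => hi.norm)
      · have := integrableOn_exp_mul_Ioi (a := -1) (by norm_num) 0
        simpa [IntegrableOn] using this
    refine hg.mono' ?_ ?_
    · apply Measurable.aestronglyMeasurable
      unfold Function.uncurry
      fun_prop
    · have : ∀ᵐ p ∂((volume : Measure (Fin n → Euc d)).prod (volume.restrict (Set.Ioi (0:ℝ)))),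
          p.2 ∈ Set.Ioi (0:ℝ) :=
        Measure.quasiMeasurePreserving_snd.ae (ae_restrict_mem measurableSet_Ioi)
      filter_upwards [this] with p hp
      have hp0 : 0 < p.2 := hp
      simp only [Function.uncurry]
      rw [norm_mul, mul_comm, Real.norm_of_nonneg (Real.exp_pos _).le, norm_prod]
      gcongr with j hj
      rw [norm_mul, Real.norm_of_nonneg (Real.exp_pos _).le]
      refine mul_le_of_le_one_left (norm_nonneg _) (Real.exp_le_one_iff.2 (neg_nonpos.2 ?_))
      have := Real.rpow_nonneg (norm_nonneg (x - p.1 j)) (-(d : ℝ))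
      positivity

theorem HL_tail (d : ℕ) (hd : 1 ≤ d) (ρ : Euc d → ℝ) (hm : Measurable ρ)
    (x : Euc d) (hc : ContinuousAt ρ x) :
    Tendsto (fun t : ℝ => t * ∫ y in {y | t ≤ ‖x - y‖ ^ (-(d : ℝ))}, ρ y) atTop
      (nhds (unitBallVol d * ρ x)) := by
  have hd0 : (0:ℝ) < d := by exact_mod_cast hd
  have hset : ∀ t : ℝ, 0 < t → {y | t ≤ ‖x - y‖ ^ (-(d : ℝ))} =
      Metric.closedBall x (t ^ (-(d:ℝ)⁻¹)) \ {x} := by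
    intro t ht
    ext y
    simp only [Set.mem_ofPred_eq, Set.mem_sdiff, Metric.mem_closedBall, Set.mem_singleton_iff,
      dist_eq_norm, norm_sub_rev y x]
    by_cases hy : y = x
    · subst hy
      simp [Real.zero_rpow (neg_ne_zero.2 hd0.ne'), ht]
    · have hp : 0 < ‖x - y‖ := norm_pos_iff.2 (sub_ne_zero.2 (Ne.symm hy))
      simp only [hy, not_false_eq_true, and_true]
      have := Real.le_rpow_inv_iff_of_neg hp ht (z := -(d:ℝ)) (by linarith)
      rw [← inv_neg, this]
  have hvol : (fun t : ℝ => volume.real {y | t ≤ ‖x - y‖ ^ (-(d : ℝ))}) =ᶠ[atTop]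
      fun t => t⁻¹ * unitBallVol d := by
    filter_upwards [eventually_gt_atTop 0] with t ht
    have : Nonempty (Fin d) := ⟨⟨0, hd⟩⟩
    rw [hset t ht, measureReal_def, measure_sdiff_null (by simp), EuclideanSpace.volume_closedBall]
    have e1 : Real.sqrt Real.pi ^ d = Real.pi ^ ((d:ℝ)/2) := by
      rw [Real.sqrt_eq_rpow, ← Real.rpow_natCast, ← Real.rpow_mul Real.pi_pos.le]
      congr 1; ring
    have e2 : (t ^ (-(d:ℝ)⁻¹)) ^ d = t⁻¹ := by
      rw [← Real.rpow_natCast, ← Real.rpow_mul ht.le, neg_mul, inv_mul_cancel₀ hd0.ne',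
        Real.rpow_neg_one]
    simp only [Fintype.card_fin, ENNReal.toReal_mul, ENNReal.toReal_pow]
    rw [ENNReal.toReal_ofReal (by positivity), ENNReal.toReal_ofReal (by positivity), e1, e2]
    rfl
  have hsmall : Tendsto (fun t : ℝ => {y | t ≤ ‖x - y‖ ^ (-(d : ℝ))}) atTop
      (nhds x).smallSets := by
    rw [tendsto_smallSets_iff]
    intro s hs
    obtain ⟨r, hr, hrs⟩ := Metric.nhds_basis_closedBall.mem_iff.1 hs
    have hlim : Tendsto (fun t : ℝ => t ^ (-(d:ℝ)⁻¹)) atTop (nhds 0) :=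
      tendsto_rpow_neg_atTop (inv_pos.2 hd0)
    filter_upwards [eventually_gt_atTop 0, hlim.eventually (ge_mem_nhds hr)] with t ht htr
    rw [hset t ht]
    exact Set.sdiff_subset.trans ((Metric.closedBall_subset_closedBall htr).trans hrs)
  have key := hc.integral_sub_linear_isLittleO_ae (μ := volume)
    (hm.stronglyMeasurable.stronglyMeasurableAtFilter) hsmall _ hvol
  have key2 : (fun i : ℝ => (∫ y in {y | i ≤ ‖x - y‖ ^ (-(d : ℝ))}, ρ y) -
      (i⁻¹ * unitBallVol d) • ρ x) =o[atTop] fun i => i⁻¹ :=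
    key.trans_isBigO (Asymptotics.isBigO_of_le' (c := |unitBallVol d|) _ fun t => by
      simp [mul_comm])
  have key3 := key2.tendsto_div_nhds_zero
  have key4 := key3.add_const (unitBallVol d * ρ x)
  rw [zero_add] at key4
  refine key4.congr' ?_
  filter_upwards [eventually_gt_atTop 0] with t ht
  rw [smul_eq_mul]
  field_simp
  ring

theorem HL_cesaro (P : ℝ → ℝ) (c : ℝ) (hP : AntitoneOn P (Set.Ici 0))
    (h : Tendsto (fun t => t * P t) atTop (nhds c)) :
    Tendsto (fun T => (∫ t in (0:ℝ)..T, P t) / Real.log T) atTop (nhds c) := by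
  have hint : ∀ u v : ℝ, 0 ≤ u → u ≤ v → IntervalIntegrable P volume u v := by
    intro u v hu huv
    apply AntitoneOn.intervalIntegrable
    apply hP.mono
    rw [Set.uIcc_of_le huv]
    exact fun y hy => hu.trans hy.1
  have hlog := Real.tendsto_log_atTop
  rw [Metric.tendsto_atTop'] at h
  rw [Metric.tendsto_nhds]
  intro ε hε
  obtain ⟨M', hM'⟩ := h (ε/2) (half_pos hε)
  obtain ⟨M, hM1, hMM⟩ : ∃ M : ℝ, 1 ≤ M ∧ M' < M := ⟨max 1 (M'+1), by simp, by simp⟩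
  set K := |(∫ t in (0:ℝ)..M, P t) - c * Real.log M|
  filter_upwards [eventually_ge_atTop M, hlog.eventually_gt_atTop (2 * K / ε),
    hlog.eventually_gt_atTop 0] with T hT hTK hT0
  have hM0 : 0 < M := by linarith
  have i1 : IntervalIntegrable (fun t : ℝ => t⁻¹) volume M T := by
    apply intervalIntegral.intervalIntegrable_inv _ continuousOn_id
    intro y hy
    rw [Set.uIcc_of_le hT] at hy
    exact (hM0.trans_le hy.1).ne'
  have e1 : ∫ t in M..T, t⁻¹ = Real.log T - Real.log M := by
    rw [integral_inv_of_pos hM0 (hM0.trans_le hT), Real.log_div (by linarith) (by linarith)]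
  have e2 : ‖∫ t in M..T, (P t - c * t⁻¹)‖ ≤ ∫ t in M..T, ε/2 * t⁻¹ := by
    apply intervalIntegral.norm_integral_le_of_norm_le hT _ (i1.const_mul _)
    refine Eventually.of_forall fun t ht => ?_
    have h1 := hM' t (hMM.trans ht.1)
    have ht0 : 0 < t := hM0.trans ht.1
    rw [Real.dist_eq] at h1
    have : P t - c * t⁻¹ = (t * P t - c) * t⁻¹ := by field_simp
    rw [this, norm_mul, Real.norm_eq_abs, Real.norm_of_nonneg (inv_pos.2 ht0).le]
    gcongr
  rw [intervalIntegral.integral_sub (hint M T hM0.le hT) (i1.const_mul _),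
    intervalIntegral.integral_const_mul, intervalIntegral.integral_const_mul, e1] at e2
  have e3 := intervalIntegral.integral_add_adjacent_intervals (hint 0 M le_rfl hM0.le)
    (hint M T hM0.le hT)
  rw [Real.dist_eq, ← e3]
  have e4 : ((∫ t in (0:ℝ)..M, P t) + ∫ t in M..T, P t) / Real.log T - c =
    (((∫ t in (0:ℝ)..M, P t) - c * Real.log M) +
      ((∫ t in M..T, P t) - c * (Real.log T - Real.log M))) / Real.log T := by
    field_simp; ring
  rw [e4, abs_div, abs_of_pos hT0, div_lt_iff₀ hT0]
  have hlM : 0 ≤ Real.log M := Real.log_nonneg hM1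
  rw [div_lt_iff₀ hε] at hTK
  refine (abs_add_le _ _).trans_lt ?_
  rw [Real.norm_eq_abs] at e2
  nlinarith

theorem HL_layer (d : ℕ) (ρ : Euc d → ℝ) (hm : Measurable ρ) (h0 : ∀ y, 0 ≤ ρ y)
    (hi : Integrable ρ) (W : Euc d → ℝ) (hW : Measurable W) (hW0 : ∀ y, 0 ≤ W y) (T : ℝ)
    (hT : 0 ≤ T) :
    ∫ y, min (W y) T * ρ y = ∫ t in (0:ℝ)..T, ∫ y in {y | t ≤ W y}, ρ y := by
  set μ : Measure (Euc d) := volume.withDensity (fun y => ENNReal.ofReal (ρ y)) with hμ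
  have hfin : IsFiniteMeasure μ := isFiniteMeasure_withDensity_ofReal hi.2
  have e1 : ∫ y, min (W y) T ∂μ = ∫ y, min (W y) T * ρ y := by
    rw [hμ, integral_withDensity_eq_integral_toReal_smul hm.ennreal_ofReal (by simp)]
    congr 1
    ext y
    rw [ENNReal.toReal_ofReal (h0 y), smul_eq_mul, mul_comm]
  have hint : Integrable (fun y => min (W y) T) μ := by
    refine Integrable.of_bound (hW.min measurable_const).aestronglyMeasurable T ?_
    refine Eventually.of_forall fun y => ?_
    rw [Real.norm_of_nonneg (le_min (hW0 y) hT)]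
    exact min_le_right _ _
  rw [← e1, hint.integral_eq_integral_Ioc_meas_le (M := T)
    (Eventually.of_forall fun y => le_min (hW0 y) hT)
    (Eventually.of_forall fun y => min_le_right _ _), intervalIntegral.integral_of_le hT]
  refine setIntegral_congr_fun measurableSet_Ioc fun t ht => ?_
  have : {a | t ≤ min (W a) T} = {a | t ≤ W a} := by
    ext a
    simp [ht.2]
  have hms : MeasurableSet {a | t ≤ W a} := measurableSet_le measurable_const hW
  simp only [this]
  rw [measureReal_def, hμ, withDensity_apply _ hms,
    integral_eq_lintegral_of_nonneg_ae (Eventually.of_forall h0) hm.aestronglyMeasurable]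

theorem HL_exp_lower (u e : ℝ) (hu : 0 ≤ u) (he : 0 < e) :
    (1 - e) * min u e ≤ 1 - Real.exp (-u) := by
  set m := min u e with hm
  have hm0 : 0 ≤ m := le_min hu he.le
  have h1 : Real.exp (-u) ≤ Real.exp (-m) := Real.exp_le_exp.2 (neg_le_neg (min_le_left _ _))
  have h2 : Real.exp (-m) ≤ 1 / (1 + m) := by
    rw [Real.exp_neg, ← one_div]
    apply one_div_le_one_div_of_le (by linarith)
    linarith [Real.add_one_le_exp m]
  have h3 : 1 / (1 + m) ≤ 1 - (1 - e) * m := by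
    rw [div_le_iff₀ (by linarith)]
    have : m ≤ e := min_le_right _ _
    nlinarith [mul_nonneg hm0 hm0, mul_nonneg (mul_nonneg hm0 hm0) he.le, mul_nonneg hm0 (sub_nonneg.2 this)]
  linarith

theorem HL_phi (d : ℕ) (hd : 1 ≤ d) (ρ : Euc d → ℝ) (hm : Measurable ρ) (h0 : ∀ y, 0 ≤ ρ y)
    (hi : Integrable ρ) (x : Euc d) (hc : ContinuousAt ρ x) :
    Tendsto (fun T : ℝ => T * (∫ y, (1 - Real.exp (-(T⁻¹ * ‖x - y‖ ^ (-(d : ℝ))))) * ρ y)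
      / Real.log T) atTop (nhds (unitBallVol d * ρ x)) := by
  set W : Euc d → ℝ := fun y => ‖x - y‖ ^ (-(d : ℝ)) with hWdef
  have hW : Measurable W := by fun_prop
  have hW0 : ∀ y, 0 ≤ W y := fun y => Real.rpow_nonneg (norm_nonneg _) _
  set G : ℝ → ℝ := fun T => ∫ y, min (W y) T * ρ y with hG
  have hGi : ∀ T, 0 ≤ T → Integrable (fun y => min (W y) T * ρ y) := by
    intro T hT
    refine hi.bdd_mul (c := T) (hW.min measurable_const).aestronglyMeasurable ?_
    refine Eventually.of_forall fun y => ?_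
    rw [Real.norm_of_nonneg (le_min (hW0 y) hT)]
    exact min_le_right _ _
  have hlim : Tendsto (fun T => G T / Real.log T) atTop (nhds (unitBallVol d * ρ x)) := by
    have h1 := HL_cesaro (fun t => ∫ y in {y | t ≤ W y}, ρ y) _ (by
      intro s _ t _ hst
      refine setIntegral_mono_set hi.integrableOn (Eventually.of_forall h0) ?_
      exact LE.le.eventuallyLE fun y (hy : t ≤ W y) => hst.trans hy)
      (HL_tail d hd ρ hm x hc)
    refine h1.congr' ?_
    filter_upwards [eventually_ge_atTop 0] with T hT
    rw [hG, ← HL_layer d ρ hm h0 hi W hW hW0 T hT]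
  have hφi : ∀ s, 0 ≤ s → Integrable (fun y => (1 - Real.exp (-(s * W y))) * ρ y) := by
    intro s hs
    refine hi.bdd_mul (c := 1) (by fun_prop) ?_
    refine Eventually.of_forall fun y => ?_
    have h1 : Real.exp (-(s * W y)) ≤ 1 := Real.exp_le_one_iff.2 (by have := mul_nonneg hs (hW0 y); linarith)
    have h2 := Real.exp_pos (-(s * W y))
    rw [Real.norm_of_nonneg (by linarith)]
    linarith
  have hlog := Real.tendsto_log_atTop
  have hll : Tendsto (fun T : ℝ => Real.log T / T) atTop (nhds 0) :=
    Real.isLittleO_log_id_atTop.tendsto_div_nhds_zero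
  have hS : Tendsto (fun T : ℝ => T / Real.log T) atTop atTop := by
    have : Tendsto (fun T : ℝ => Real.log T / T) atTop (nhdsWithin 0 (Set.Ioi 0)) := by
      refine tendsto_nhdsWithin_iff.2 ⟨hll, ?_⟩
      filter_upwards [eventually_gt_atTop 1] with T hT
      exact div_pos (Real.log_pos hT) (by linarith)
    refine this.inv_tendsto_nhdsGT_zero.congr fun T => ?_
    simp
  have hlow : Tendsto (fun T : ℝ => (1 - (Real.log T)⁻¹) * ((G (T / Real.log T) /
      Real.log (T / Real.log T)) * (1 - Real.log (Real.log T) / Real.log T))) atTop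
      (nhds (unitBallVol d * ρ x)) := by
    have := ((tendsto_const_nhds (x := (1:ℝ))).sub (tendsto_inv_atTop_zero.comp hlog)).mul
      ((hlim.comp hS).mul ((tendsto_const_nhds (x := (1:ℝ))).sub (hll.comp hlog)))
    simpa using this
  refine tendsto_of_tendsto_of_tendsto_of_le_of_le' hlow hlim ?_ ?_
  · filter_upwards [eventually_gt_atTop 1, hS.eventually_gt_atTop 1] with T hT hST
    have hL : 0 < Real.log T := Real.log_pos hT
    have hT0 : 0 < T := by linarith
    have e1 : Real.log (T / Real.log T) = Real.log T - Real.log (Real.log T) :=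
      Real.log_div hT0.ne' hL.ne'
    have e2 : 0 < Real.log T - Real.log (Real.log T) := e1 ▸ Real.log_pos hST
    rw [e1]
    have e3 : (1 - (Real.log T)⁻¹) * ((G (T / Real.log T) /
      (Real.log T - Real.log (Real.log T))) * (1 - Real.log (Real.log T) / Real.log T)) =
      (1 - (Real.log T)⁻¹) * G (T / Real.log T) / Real.log T := by
      have := e2.ne'
      field_simp
    rw [e3]
    refine div_le_div_of_nonneg_right ?_ hL.le
    rw [hG]
    simp only
    rw [← integral_const_mul, ← integral_const_mul]
    refine integral_mono ((hGi _ (by positivity)).const_mul _)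
      ((hφi _ (by positivity)).const_mul _) fun y => ?_
    simp only
    have := HL_exp_lower (T⁻¹ * W y) (Real.log T)⁻¹ (mul_nonneg (by positivity) (hW0 y))
      (by positivity)
    have e4 : min (W y) (T / Real.log T) = T * min (T⁻¹ * W y) (Real.log T)⁻¹ := by
      rw [mul_min_of_nonneg _ _ hT0.le, mul_inv_cancel_left₀ hT0.ne', div_eq_mul_inv]
    rw [e4]
    have := mul_le_mul_of_nonneg_left this (mul_nonneg hT0.le (h0 y))
    linarith
  · filter_upwards [eventually_gt_atTop 1] with T hT
    have hL : 0 < Real.log T := Real.log_pos hT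
    have hT0 : 0 < T := by linarith
    gcongr
    rw [hG]
    simp only
    rw [← integral_const_mul]
    refine integral_mono ((hφi _ (by positivity)).const_mul _) (hGi _ hT0.le) fun y => ?_
    simp only
    rw [← mul_assoc]
    refine mul_le_mul_of_nonneg_right ?_ (h0 y)
    have h1 := Real.add_one_le_exp (-(T⁻¹ * W y))
    have h2 := Real.exp_pos (-(T⁻¹ * W y))
    apply le_min
    · calc T * (1 - Real.exp (-(T⁻¹ * W y))) ≤ T * (T⁻¹ * W y) := by gcongr; linarith
        _ = W y := mul_inv_cancel_left₀ hT0.ne' _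
    · nlinarith

theorem HL_pow (N : ℕ → ℕ) (p : ℕ → ℝ) (z : ℝ)
    (hp : Tendsto p atTop (nhds 0))
    (h : Tendsto (fun k => (N k : ℝ) * p k) atTop (nhds z)) :
    Tendsto (fun k => (1 - p k) ^ N k) atTop (nhds (Real.exp (-z))) := by
  have h1 : Tendsto (fun k => (N k : ℝ) * Real.log (1 - p k)) atTop (nhds (-z)) := by
    have hl : Tendsto (fun k => -((N k : ℝ) * p k) * (1 - p k)⁻¹) atTop (nhds (-z)) := by
      have := h.neg.mul (((tendsto_const_nhds (x := (1:ℝ))).sub hp).inv₀ (by norm_num))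
      simpa using this
    refine tendsto_of_tendsto_of_tendsto_of_le_of_le' hl h.neg ?_ ?_
    · filter_upwards [hp.eventually (gt_mem_nhds one_pos)] with k hk
      have h2 : 0 < 1 - p k := by linarith
      have := Real.one_sub_inv_le_log_of_pos h2
      have e : -((N k : ℝ) * p k) * (1 - p k)⁻¹ = N k * (1 - (1 - p k)⁻¹) := by
        field_simp; ring
      rw [e]
      gcongr
    · filter_upwards [hp.eventually (gt_mem_nhds one_pos)] with k hk
      have h2 : 0 < 1 - p k := by linarith
      have := Real.log_le_sub_one_of_pos h2
      rw [← mul_neg]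
      gcongr
      linarith
  refine ((Real.continuous_exp.tendsto _).comp h1).congr' ?_
  filter_upwards [hp.eventually (gt_mem_nhds one_pos)] with k hk
  have h2 : 0 < 1 - p k := by linarith
  simp only [Function.comp]
  rw [Real.exp_nat_mul, Real.exp_log h2]

/-- with `u = a n log n → ζ`, `n t a log(1/(t a)) → t ζ`. -/
theorem HL_seq (N : ℕ → ℕ) (a : ℕ → ℝ) (ζ t : ℝ) (ht : 0 < t) (ha : ∀ k, 0 < a k)
    (hN : Tendsto N atTop atTop)
    (h : Tendsto (fun k => a k * (N k : ℝ) * Real.log (N k)) atTop (nhds ζ)) :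
    Tendsto (fun k => (N k : ℝ) * (t * a k) * Real.log ((t * a k)⁻¹)) atTop (nhds (t * ζ)) := by
  have hN' : Tendsto (fun k => (N k : ℝ)) atTop atTop := tendsto_natCast_atTop_atTop.comp hN
  have hL : Tendsto (fun k => Real.log (N k : ℝ)) atTop atTop := Real.tendsto_log_atTop.comp hN'
  have hLi := tendsto_inv_atTop_zero.comp hL
  have hll : Tendsto (fun T : ℝ => Real.log T / T) atTop (nhds 0) :=
    Real.isLittleO_log_id_atTop.tendsto_div_nhds_zero
  have h1 := h.mul ((tendsto_const_nhds (x := (1:ℝ))).add (hll.comp hL))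
  have h2 := ((Real.continuous_mul_log.tendsto ζ).comp h).mul hLi
  have h3 := (h.mul hLi).mul_const (Real.log t)
  have h4 := ((h1.sub h2).sub h3).const_mul t
  simp only [add_zero, mul_one, mul_zero, sub_zero, zero_mul] at h4
  refine h4.congr' ?_
  filter_upwards [hN'.eventually_gt_atTop 1] with k hk
  have hl : 0 < Real.log (N k : ℝ) := Real.log_pos hk
  have hak := ha k
  simp only [Function.comp]
  rw [Real.log_inv, Real.log_mul ht.ne' hak.ne', Real.log_mul (by positivity) hl.ne',
    Real.log_mul hak.ne' (by positivity)]
  field_simp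
  ring

theorem HL_core
    (d : ℕ) (hd : 1 ≤ d)
    (ρ : Euc d → ℝ) (hρ_meas : Measurable ρ) (hρ_nonneg : ∀ y, 0 ≤ ρ y)
    (hρ_prob : (∫ y, ρ y) = 1) (hi : Integrable ρ)
    (x : Euc d) (hρx : 0 < ρ x) (hρ_cont : ContinuousAt ρ x)
    (Z : ℝ) (hZ : 0 ≤ Z) (N : ℕ → ℕ) (a : ℕ → ℝ)
    (hN : Tendsto N atTop atTop) (ha : ∀ k, 0 < a k)
    (hainv : Tendsto (fun k => (a k)⁻¹) atTop atTop)
    (hz : Tendsto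
      (fun k => unitBallVol d * ρ x * a k * (N k : ℝ) * Real.log (N k))
      atTop (nhds Z)) :
    Tendsto (fun k => ∫ t in Set.Ioi (0:ℝ), Real.exp (-t) *
      (∫ y, Real.exp (-(t * a k * ‖x - y‖ ^ (-(d : ℝ)))) * ρ y) ^ N k)
      atTop (nhds (1 / (1 + Z))) := by
  have hV : 0 < unitBallVol d := by
    unfold unitBallVol
    have := Real.Gamma_pos_of_pos (show (0:ℝ) < (d:ℝ)/2 + 1 by positivity)
    have := Real.pi_pos
    positivity
  have hc : 0 < unitBallVol d * ρ x := mul_pos hV hρx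
  have hW0 : ∀ y, 0 ≤ ‖x - y‖ ^ (-(d : ℝ)) := fun y => Real.rpow_nonneg (norm_nonneg _) _
  have hphi := HL_phi d hd ρ hρ_meas hρ_nonneg hi x hρ_cont
  set c := unitBallVol d * ρ x with hcdef
  clear_value c
  have hζ : Tendsto (fun k => a k * (N k : ℝ) * Real.log (N k)) atTop (nhds (c⁻¹ * Z)) := by
    refine (hz.const_mul c⁻¹).congr fun k => ?_
    field_simp
  have hEi : ∀ s, 0 ≤ s → Integrable (fun y => Real.exp (-(s * ‖x - y‖ ^ (-(d : ℝ)))) * ρ y) := by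
    intro s hs
    refine hi.bdd_mul (c := 1) (Measurable.aestronglyMeasurable (by fun_prop)) ?_
    refine Eventually.of_forall fun y => ?_
    rw [Real.norm_of_nonneg (Real.exp_pos _).le]
    exact Real.exp_le_one_iff.2 (neg_nonpos.2 (mul_nonneg hs (hW0 y)))
  have hE0 : ∀ s : ℝ, 0 ≤ ∫ y, Real.exp (-(s * ‖x - y‖ ^ (-(d : ℝ)))) * ρ y := fun s =>
    integral_nonneg fun y => mul_nonneg (Real.exp_pos _).le (hρ_nonneg y)
  have hE1 : ∀ s : ℝ, 0 ≤ s → ∫ y, Real.exp (-(s * ‖x - y‖ ^ (-(d : ℝ)))) * ρ y ≤ 1 := by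
    intro s hs
    rw [← hρ_prob]
    refine integral_mono (hEi s hs) hi fun y => ?_
    exact mul_le_of_le_one_left (hρ_nonneg y)
      (Real.exp_le_one_iff.2 (neg_nonpos.2 (mul_nonneg hs (hW0 y))))
  have hfinal : ∫ t in Set.Ioi (0:ℝ), Real.exp (-t) * Real.exp (-(t * Z)) = 1 / (1 + Z) := by
    have e : ∀ t : ℝ, Real.exp (-t) * Real.exp (-(t * Z)) = Real.exp (-(1 + Z) * t) := by
      intro t
      rw [← Real.exp_add]; congr 1; ring
    simp_rw [e]
    rw [integral_exp_mul_Ioi (by linarith)]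
    rw [mul_zero, Real.exp_zero, neg_div_neg_eq]
  rw [← hfinal]
  refine tendsto_integral_of_dominated_convergence (fun t => Real.exp (-t)) ?_ ?_ ?_ ?_
  · intro k
    apply Measurable.aestronglyMeasurable
    refine Measurable.mul (by fun_prop) (Measurable.pow_const ?_ _)
    have : StronglyMeasurable (Function.uncurry fun (t : ℝ) (y : Euc d) =>
        Real.exp (-(t * a k * ‖x - y‖ ^ (-(d : ℝ)))) * ρ y) := by
      apply Measurable.stronglyMeasurable
      unfold Function.uncurry
      fun_prop
    exact this.integral_prod_right.measurable
  · have := integrableOn_exp_mul_Ioi (a := -1) (by norm_num) 0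
    simpa [IntegrableOn] using this
  · intro k
    filter_upwards [ae_restrict_mem measurableSet_Ioi] with t ht
    have ht0 : (0:ℝ) < t := ht
    have h1 := hE0 (t * a k)
    have h2 := hE1 (t * a k) (mul_pos ht0 (ha k)).le
    rw [norm_mul, Real.norm_of_nonneg (Real.exp_pos _).le, Real.norm_of_nonneg (pow_nonneg h1 _)]
    exact mul_le_of_le_one_right (Real.exp_pos _).le (pow_le_one₀ h1 h2)
  · filter_upwards [ae_restrict_mem measurableSet_Ioi] with t ht
    have ht0 : (0:ℝ) < t := ht
    refine Tendsto.const_mul _ ?_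
    have hT : Tendsto (fun k => (t * a k)⁻¹) atTop atTop := by
      refine (hainv.const_mul_atTop (inv_pos.2 ht0)).congr fun k => ?_
      rw [mul_inv]
    set p : ℕ → ℝ := fun k => ∫ y, (1 - Real.exp (-(t * a k * ‖x - y‖ ^ (-(d : ℝ))))) * ρ y with hp
    have hpE : ∀ k, ∫ y, Real.exp (-(t * a k * ‖x - y‖ ^ (-(d : ℝ)))) * ρ y = 1 - p k := by
      intro k
      have : p k = ∫ y, (ρ y - Real.exp (-(t * a k * ‖x - y‖ ^ (-(d : ℝ)))) * ρ y) := by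
        exact integral_congr_ae (Eventually.of_forall fun y => by ring)
      rw [this, integral_sub hi (hEi _ (mul_pos ht0 (ha k)).le), hρ_prob]
      ring
    simp_rw [hpE]
    have hlim := hphi.comp hT
    have hseq := HL_seq N a _ t ht0 ha hN hζ
    have hNp : Tendsto (fun k => (N k : ℝ) * p k) atTop (nhds (t * Z)) := by
      have := hseq.mul hlim
      have e : t * (c⁻¹ * Z) * c = t * Z := by field_simp
      rw [e] at this
      refine this.congr' ?_
      filter_upwards [hT.eventually_gt_atTop 1] with k hk
      have hl : Real.log ((t * a k)⁻¹) ≠ 0 := (Real.log_pos hk).ne'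
      have hta : t * a k ≠ 0 := (mul_pos ht0 (ha k)).ne'
      simp only [Function.comp, inv_inv]
      change _ * ((t * a k)⁻¹ * p k / _) = _
      generalize Real.log ((t * a k)⁻¹) = l at *
      generalize t * a k = s at *
      field_simp
    have hp0 : Tendsto p atTop (nhds 0) := by
      have hN' : Tendsto (fun k => (N k : ℝ)) atTop atTop := tendsto_natCast_atTop_atTop.comp hN
      have := hNp.mul (tendsto_inv_atTop_zero.comp hN')
      rw [mul_zero] at this
      refine this.congr' ?_
      filter_upwards [hN'.eventually_gt_atTop 0] with k hk
      simp only [Function.comp]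
      field_simp
    exact HL_pow N p _ hp0 hNp

/-- scaling limit of the expected Lagrange function. For any `Z ≥ 0`, along any
joint limit `n → ∞`, `‖x−x₀‖^{−d} → ∞` (i.e. `x₀ → x`, `x₀ ≠ x`) with
`z_x(n,x₀) = V_d·ρ(x)·‖x−x₀‖^d·n·ln(n) → Z`, one has `L_0(x) → 1/(1+Z)`. -/
theorem hilbert_lagrange_scaling_limit
    (d : ℕ) (hd : 1 ≤ d)
    (ρ : Euc d → ℝ) (hρ_meas : Measurable ρ) (hρ_nonneg : ∀ y, 0 ≤ ρ y)
    (hρ_prob : (∫ y, ρ y) = 1)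
    (hρ_var : Integrable (fun y => ρ y * ‖y‖ ^ 2))
    (x : Euc d) (hx : x ∈ interior {y | 0 < ρ y}) (hρ_cont : ContinuousAt ρ x)
    (Z : ℝ) (hZ : 0 ≤ Z)
    (N : ℕ → ℕ) (ξ : ℕ → Euc d)
    (hN : Tendsto N atTop atTop)
    (hξ : ∀ k, ξ k ≠ x)
    (hξ_lim : Tendsto (fun k => ‖x - ξ k‖ ^ (-(d : ℝ))) atTop atTop)
    (hz : Tendsto
      (fun k => unitBallVol d * ρ x * ‖x - ξ k‖ ^ (d : ℝ) * (N k : ℝ) * Real.log (N k))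
      atTop (nhds Z)) :
    Tendsto (fun k => lagrangeFn d (N k) x (ξ k) ρ) atTop (nhds (1 / (1 + Z))) := by
  have hi : Integrable ρ := by
    by_contra hcon
    rw [integral_undef hcon] at hρ_prob
    norm_num at hρ_prob
  have hρx : 0 < ρ x := by
    have h := interior_subset hx
    exact h
  have hpos : ∀ k, 0 < ‖x - ξ k‖ := fun k => norm_pos_iff.2 (sub_ne_zero.2 (hξ k).symm)
  refine (HL_core d hd ρ hρ_meas hρ_nonneg hρ_prob hi x hρx hρ_cont Z hZ N
    (fun k => ‖x - ξ k‖ ^ (d : ℝ)) hN (fun k => Real.rpow_pos_of_pos (hpos k) _)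
    (hξ_lim.congr fun k => Real.rpow_neg (hpos k).le _) hz).congr fun k => ?_
  exact (HL_laplace d (N k) x (ξ k) ρ (hξ k) hρ_meas hi).symm

end
end

section
/- Let d ≥ 1, let ρ be a probability density on ℝ^d with finite variance, fix x in the interior of the support of ρ with ρ continuous at x, and let (X_0,Y_0),…,(X_n,Y_n) be i.i.d. with X_i of density ρ, regression function f(x) = E[Y|X=x], and conditional variance σ²(x) = E[(Y−f(X))²|X=x]. Assume σ²(y) ≤ σ_0² for all y in the support of ρ. Then for every ε > 0 there exists N such that for all n ≥ N, the variance term V(x) = E[ Σ_{i=0}^n w_i(x)²·σ²(X_i) ] of the Hilbert kernel regression estimator satisfies V(x) ≤ (1+ε)·σ_0²/ln(n). -/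
open MeasureTheory Filter

noncomputable section

/-- The variance term `V(x) = E[Σ_i w_i(x)²·σ²(X_i)]` of the Hilbert kernel regression
estimator, expressed as an integral against the product density `∏ ρ(x_i)`. -/
def hilbertVariance (d n : ℕ) (x : Euc d) (ρ σ : Euc d → ℝ) : ℝ :=
  ∫ xs : Fin (n + 1) → Euc d,
    (∑ i : Fin (n + 1), hilbertWeight d n x xs i ^ 2 * σ (xs i) ^ 2) *
      ∏ i : Fin (n + 1), ρ (xs i)

open Topology Set in
lemma radG (d : ℕ) (hd : 1 ≤ d) (x : Euc d) (a : ℝ) (ha : 0 < a) :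
    Integrable (fun y : Euc d => ((1 + a * ‖x - y‖ ^ d) ^ 2)⁻¹) ∧
    ∫ y : Euc d, ((1 + a * ‖x - y‖ ^ d) ^ 2)⁻¹ = volume.real (Metric.ball (0 : Euc d) 1) / a := by
  have : Nonempty (Fin d) := ⟨⟨0, hd⟩⟩
  have : Nontrivial (Euc d) := inferInstance
  have hdim : Module.finrank ℝ (Euc d) = d := by simp
  have hd0 : (0 : ℝ) < d := by exact_mod_cast hd
  have hder : ∀ r ∈ Ici (0 : ℝ), HasDerivAt (fun r : ℝ => -(1 + a * r ^ d)⁻¹ / (d * a))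
      (r ^ (d - 1) • ((1 + a * r ^ d) ^ 2)⁻¹) r := by
    intro r hr
    have hr' : (0 : ℝ) ≤ r := hr
    have h0 : 1 + a * r ^ d ≠ 0 := by positivity
    have := (((((hasDerivAt_pow d r).const_mul a).const_add 1).inv h0).neg).div_const (d * a)
    refine this.congr_deriv ?_
    rw [smul_eq_mul]
    field_simp
  have hpos : ∀ r ∈ Ioi (0 : ℝ), 0 ≤ r ^ (d - 1) • ((1 + a * r ^ d) ^ 2)⁻¹ := by
    intro r hr
    have hr' : (0 : ℝ) < r := hr
    simp only [smul_eq_mul]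
    positivity
  have hlim : Tendsto (fun r : ℝ => -(1 + a * r ^ d)⁻¹ / (d * a)) atTop (𝓝 0) := by
    have h1 : Tendsto (fun r : ℝ => 1 + a * r ^ d) atTop atTop :=
      tendsto_atTop_add_const_left _ _ ((tendsto_pow_atTop (by lia)).const_mul_atTop ha)
    have := (h1.inv_tendsto_atTop.neg).div_const (d * a)
    simpa using this
  have hint := integrableOn_Ioi_deriv_of_nonneg' hder hpos hlim
  have hval := integral_Ioi_of_hasDerivAt_of_nonneg' hder hpos hlim
  constructor
  · have h := (integrable_fun_norm_addHaar (volume : Measure (Euc d))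
      (f := fun r : ℝ => ((1 + a * r ^ d) ^ 2)⁻¹)).2 (by rw [hdim]; exact hint)
    exact h.comp_sub_left x
  · rw [integral_sub_left_eq_self (fun z : Euc d => ((1 + a * ‖z‖ ^ d) ^ 2)⁻¹) volume x]
    rw [integral_fun_norm_addHaar volume (fun r : ℝ => ((1 + a * r ^ d) ^ 2)⁻¹), hdim, hval]
    have : (0 : ℝ) ^ d = 0 := zero_pow (by lia)
    simp [this]
    field_simp

open Topology Set in
lemma radH (d : ℕ) (hd : 1 ≤ d) (x : Euc d) (r δ : ℝ) (hr : 0 < r) (hrd : r ≤ δ) :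
    ∫ y : Euc d, (Ioc r δ).indicator (fun t : ℝ => t ^ (-(d : ℝ))) ‖x - y‖ =
      d * volume.real (Metric.ball (0 : Euc d) 1) * (Real.log δ - Real.log r) := by
  have : Nonempty (Fin d) := ⟨⟨0, hd⟩⟩
  have : Nontrivial (Euc d) := inferInstance
  have hdim : Module.finrank ℝ (Euc d) = d := by simp
  rw [integral_sub_left_eq_self
    (fun z : Euc d => (Ioc r δ).indicator (fun t : ℝ => t ^ (-(d : ℝ))) ‖z‖) volume x]
  rw [integral_fun_norm_addHaar volume ((Ioc r δ).indicator (fun t : ℝ => t ^ (-(d : ℝ)))), hdim]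
  have h1 : ∀ t : ℝ, t ^ (d - 1) • (Ioc r δ).indicator (fun t : ℝ => t ^ (-(d : ℝ))) t =
      (Ioc r δ).indicator (fun t : ℝ => 1 / t) t := by
    intro t
    by_cases ht : t ∈ Ioc r δ
    · have ht0 : 0 < t := hr.trans ht.1
      simp only [ht, indicator_of_mem, smul_eq_mul]
      rw [Real.rpow_neg ht0.le, Real.rpow_natCast]
      obtain ⟨k, rfl⟩ : ∃ k, d = k + 1 := ⟨d - 1, by lia⟩
      simp only [Nat.add_sub_cancel]
      rw [pow_succ]
      field_simp
    · simp [ht]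
  simp_rw [h1]
  rw [setIntegral_indicator measurableSet_Ioc]
  have h2 : Ioi (0 : ℝ) ∩ Ioc r δ = Ioc r δ := by
    ext t; simp only [mem_inter_iff, mem_Ioi, mem_Ioc]
    constructor
    · exact fun h => h.2
    · exact fun h => ⟨hr.trans h.1, h⟩
  rw [h2, ← intervalIntegral.integral_of_le hrd, integral_one_div_of_pos hr (hr.trans_le hrd),
    Real.log_div (hr.trans_le hrd).ne' hr.ne']
  simp
  ring
lemma h8aux (e l K : ℝ) (he0 : 0 < e) (he1 : e < 1 / 4) (hs2 : |K| ≤ l * (2 * e)) :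
    (1 - 4 * e) * l ≤ (1 - e) ^ 2 * (l + K) := by
  have h9 := neg_abs_le K
  have hl0 : 0 ≤ l := by
    have := (abs_nonneg K).trans hs2
    exact nonneg_of_mul_nonneg_left this (by positivity)
  have h1 : (1 - e) ^ 2 * |K| ≤ |K| := by
    apply mul_le_of_le_one_left (abs_nonneg K); nlinarith
  have h2 := mul_le_mul_of_nonneg_left h9 (sq_nonneg (1 - e))
  have h3 : (1 - e) ^ 2 * (l + K) = l - 2 * (e * l) + e ^ 2 * l + (1 - e) ^ 2 * K := by ring
  have h4 : 0 ≤ e ^ 2 * l := by positivity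
  have h5 : (1 - e) ^ 2 * -|K| = - ((1 - e) ^ 2 * |K|) := by ring
  nlinarith

open Topology Set in
lemma gBound (d : ℕ) (hd : 1 ≤ d)
    (ρ : Euc d → ℝ) (hρ_nonneg : ∀ y, 0 ≤ ρ y)
    (hρ_prob : (∫ y, ρ y) = 1) (x : Euc d) (hx : 0 < ρ x) (hρ_cont : ContinuousAt ρ x)
    (c : ℝ) (hc : c = ρ x * volume.real (Metric.ball (0 : Euc d) 1)) (hc0 : 0 < c)
    (η : ℝ) (hη : 0 < η) :
    ∀ᶠ a in atTop, ∫ y, ρ y * ((‖x - y‖ ^ (-(d : ℝ))) / (‖x - y‖ ^ (-(d : ℝ)) + a)) ^ 2 ≤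
      (1 + η) * c / a := by
  have hint : Integrable ρ := by
    by_contra h
    rw [integral_undef h] at hρ_prob
    norm_num at hρ_prob
  obtain ⟨δ, hδ, hδρ⟩ : ∃ δ > 0, ∀ y, ‖x - y‖ < δ → ρ y ≤ (1 + η / 2) * ρ x := by
    have : ∀ᶠ y in 𝓝 x, ρ y < (1 + η / 2) * ρ x :=
      hρ_cont.eventually_lt_const (by nlinarith)
    obtain ⟨δ, hδ, h⟩ := Metric.eventually_nhds_iff.1 this
    refine ⟨δ, hδ, fun y hy => (h ?_).le⟩
    rwa [dist_comm, dist_eq_norm]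
  have hδd : 0 < δ ^ d := pow_pos hδ d
  filter_upwards [eventually_gt_atTop 0, eventually_ge_atTop (2 / (η * c * (δ ^ d) ^ 2))] with a ha ha2
  obtain ⟨hGi, hGv⟩ := radG d hd x a ha
  calc _ ≤ ∫ y, (((1 + η / 2) * ρ x) * ((1 + a * ‖x - y‖ ^ d) ^ 2)⁻¹ +
            ((a * δ ^ d) ^ 2)⁻¹ * ρ y) := by
        apply integral_mono_of_nonneg
        · exact Eventually.of_forall fun y => mul_nonneg (hρ_nonneg y) (sq_nonneg _)
        · exact (hGi.const_mul _).add (hint.const_mul _)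
        · refine Eventually.of_forall fun y => ?_
          have hF : ((‖x - y‖ ^ (-(d : ℝ))) / (‖x - y‖ ^ (-(d : ℝ)) + a)) ^ 2 ≤
              ((1 + a * ‖x - y‖ ^ d) ^ 2)⁻¹ := by
            rcases (norm_nonneg (x - y)).eq_or_lt with h0 | h0
            · rw [← h0, Real.zero_rpow (by simp; lia)]
              simp; positivity
            · rw [Real.rpow_neg h0.le, Real.rpow_natCast]
              apply le_of_eq
              have : 0 < ‖x - y‖ ^ d := by positivity
              field_simp
          have hG0 : 0 ≤ ((1 + a * ‖x - y‖ ^ d) ^ 2)⁻¹ := by positivity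
          have hc0 : 0 ≤ ((a * δ ^ d) ^ 2)⁻¹ := by positivity
          have hρy := hρ_nonneg y
          show ρ y * _ ≤ _
          refine (mul_le_mul_of_nonneg_left hF hρy).trans ?_
          by_cases hy : ‖x - y‖ < δ
          · have := mul_le_mul_of_nonneg_right (hδρ y hy) hG0
            nlinarith [mul_nonneg hc0 hρy]
          · have h1 : ((1 + a * ‖x - y‖ ^ d) ^ 2)⁻¹ ≤ ((a * δ ^ d) ^ 2)⁻¹ := by
              apply inv_anti₀ (by positivity)
              have : δ ^ d ≤ ‖x - y‖ ^ d := pow_le_pow_left₀ hδ.le (not_lt.1 hy) d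
              apply pow_le_pow_left₀ (by positivity)
              nlinarith
            have h2 : 0 ≤ ((1 + η / 2) * ρ x) * ((1 + a * ‖x - y‖ ^ d) ^ 2)⁻¹ := by positivity
            nlinarith [mul_le_mul_of_nonneg_left h1 hρy]
    _ = (1 + η / 2) * c / a + ((a * δ ^ d) ^ 2)⁻¹ := by
        rw [integral_add (hGi.const_mul _) (hint.const_mul _), integral_const_mul,
          integral_const_mul, hρ_prob, hGv, hc]
        ring
    _ ≤ (1 + η) * c / a := by
        have : ((a * δ ^ d) ^ 2)⁻¹ ≤ (η / 2) * c / a := by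
          rw [div_le_iff₀ (by positivity)] at ha2
          rw [inv_le_iff_one_le_mul₀ (by positivity)]
          have : η / 2 * c / a * (a * δ ^ d) ^ 2 = (a * (η * c * (δ ^ d) ^ 2)) / 2 := by
            field_simp
          rw [this]; linarith
        have h2 : (1 + η) * c / a = (1 + η / 2) * c / a + (η / 2) * c / a := by ring
        linarith

open Topology Set in
lemma phiBound (d : ℕ) (hd : 1 ≤ d)
    (ρ : Euc d → ℝ) (hρ_nonneg : ∀ y, 0 ≤ ρ y)
    (hρ_prob : (∫ y, ρ y) = 1) (x : Euc d) (hx : 0 < ρ x) (hρ_cont : ContinuousAt ρ x)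
    (c : ℝ) (hc : c = ρ x * volume.real (Metric.ball (0 : Euc d) 1)) (hc0 : 0 < c)
    (η : ℝ) (hη : 0 < η) (hη1 : η < 1)
    (hinte : ∀ s : ℝ, 0 < s →
      Integrable (fun y => ρ y * Real.exp (-(s * ‖x - y‖ ^ (-(d : ℝ)))))) :
    ∀ᶠ s in 𝓝[>] (0 : ℝ), ∫ y, ρ y * Real.exp (-(s * ‖x - y‖ ^ (-(d : ℝ)))) ≤
      1 - (1 - η) * c * s * (-Real.log s) := by
  have hd0 : (0 : ℝ) < d := by exact_mod_cast hd
  have hint : Integrable ρ := by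
    by_contra h
    rw [integral_undef h] at hρ_prob
    norm_num at hρ_prob
  obtain ⟨e, he⟩ : ∃ e, e = η / 4 := ⟨_, rfl⟩
  have he0 : 0 < e := by rw [he]; positivity
  have he1 : e < 1 / 4 := by rw [he]; linarith
  obtain ⟨δ, hδ, hδρ⟩ : ∃ δ > 0, ∀ y, ‖x - y‖ ≤ δ → (1 - e) * ρ x ≤ ρ y := by
    have : ∀ᶠ y in 𝓝 x, (1 - e) * ρ x < ρ y :=
      hρ_cont.eventually_const_lt (by nlinarith)
    obtain ⟨δ, hδ, h⟩ := Metric.eventually_nhds_iff.1 this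
    refine ⟨δ / 2, by positivity, fun y hy => (h ?_).le⟩
    rw [dist_comm, dist_eq_norm]; linarith
  have hδd : 0 < δ ^ d := pow_pos hδ d
  obtain ⟨K, hK⟩ : ∃ K, K = d * Real.log δ + Real.log e := ⟨_, rfl⟩
  have hs1 : ∀ᶠ s in 𝓝[>] (0 : ℝ), s ≤ e * δ ^ d :=
    (eventually_le_nhds (by positivity)).filter_mono nhdsWithin_le_nhds
  have hs2 : ∀ᶠ s in 𝓝[>] (0 : ℝ), |K| / (2 * e) ≤ -Real.log s :=
    (tendsto_neg_atBot_atTop.comp Real.tendsto_log_nhdsGT_zero).eventually_ge_atTop _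
  filter_upwards [self_mem_nhdsWithin, hs1, hs2] with s hs0 hs1 hs2
  have hs0 : 0 < s := hs0
  set l := -Real.log s with hl
  obtain ⟨r, hr⟩ : ∃ r, r = (s / e) ^ ((d : ℝ)⁻¹) := ⟨_, rfl⟩
  have hr0 : 0 < r := by rw [hr]; positivity
  have hrd : r ^ d = s / e := by
    rw [hr]; exact Real.rpow_inv_natCast_pow (by positivity) (by lia)
  have hrδ : r ≤ δ := by
    rw [← pow_le_pow_iff_left₀ hr0.le hδ.le (by lia : d ≠ 0), hrd, div_le_iff₀ he0]
    linarith
  have hlogr : d * Real.log r = -l - Real.log e := by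
    rw [← Real.log_pow, hrd, Real.log_div hs0.ne' he0.ne', hl]; ring
  have hH := radH d hd x r δ hr0 hrδ
  have key : ∫ y : Euc d, ((1 - e) ^ 2 * s * ρ x) *
        (Ioc r δ).indicator (fun t : ℝ => t ^ (-(d : ℝ))) ‖x - y‖ ≤
      ∫ y, (ρ y - ρ y * Real.exp (-(s * ‖x - y‖ ^ (-(d : ℝ))))) := by
    apply integral_mono_of_nonneg
    · refine Eventually.of_forall fun y => mul_nonneg (by positivity) ?_
      exact indicator_nonneg (fun t ht => Real.rpow_nonneg (hr0.trans ht.1).le _) _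
    · exact hint.sub (hinte s hs0)
    · refine Eventually.of_forall fun y => ?_
      show _ ≤ ρ y - ρ y * Real.exp (-(s * ‖x - y‖ ^ (-(d : ℝ))))
      have hρy := hρ_nonneg y
      by_cases hy : ‖x - y‖ ∈ Ioc r δ
      · simp only [hy, indicator_of_mem]
        have hn : 0 < ‖x - y‖ := hr0.trans hy.1
        have hT : s * ‖x - y‖ ^ (-(d : ℝ)) ≤ e := by
          rw [Real.rpow_neg hn.le, Real.rpow_natCast, ← div_eq_mul_inv, div_le_iff₀ (by positivity)]
          have h3 : r ^ d ≤ ‖x - y‖ ^ d := pow_le_pow_left₀ hr0.le hy.1.le d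
          rw [hrd, div_le_iff₀ he0] at h3
          linarith
        have hT0 : 0 ≤ ‖x - y‖ ^ (-(d : ℝ)) := Real.rpow_nonneg hn.le _
        set T := ‖x - y‖ ^ (-(d : ℝ))
        have hu0 : 0 ≤ s * T := by positivity
        have hexp : Real.exp (-(s * T)) ≤ 1 - (1 - e) * (s * T) := by
          have h4 : 1 + s * T ≤ Real.exp (s * T) := by linarith [Real.add_one_le_exp (s * T)]
          rw [Real.exp_neg]
          calc (Real.exp (s * T))⁻¹ ≤ (1 + s * T)⁻¹ := inv_anti₀ (by positivity) h4
            _ ≤ _ := by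
              rw [inv_le_iff_one_le_mul₀ (by positivity)]
              nlinarith [mul_nonneg hu0 (sub_nonneg.2 hT), mul_nonneg (mul_nonneg hu0 hu0) he0.le]
        have h5 := hδρ y hy.2
        have h6 : 0 ≤ (1 - e) * (s * T) := mul_nonneg (by linarith) hu0
        nlinarith [mul_le_mul_of_nonneg_right h5 h6, mul_le_mul_of_nonneg_left hexp hρy]
      · simp only [hy, not_false_eq_true, indicator_of_notMem, mul_zero]
        have : Real.exp (-(s * ‖x - y‖ ^ (-(d : ℝ)))) ≤ 1 := by
          rw [Real.exp_le_one_iff, neg_nonpos]; positivity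
        nlinarith
  rw [integral_const_mul, hH, integral_sub hint (hinte s hs0), hρ_prob] at key
  have h7 : (1 - e) ^ 2 * s * ρ x * (d * volume.real (Metric.ball (0 : Euc d) 1) *
      (Real.log δ - Real.log r)) = c * s * ((1 - e) ^ 2 * (l + K)) := by
    rw [hc, hK]
    linear_combination (-(1 - e) ^ 2 * s * ρ x * volume.real (Metric.ball (0 : Euc d) 1)) * hlogr
  have h8 : (1 - η) * l ≤ (1 - e) ^ 2 * (l + K) := by
    rw [div_le_iff₀ (by positivity)] at hs2
    have hη4 : η = 4 * e := by rw [he]; ring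
    rw [hη4]
    exact h8aux e l K he0 he1 hs2
  rw [h7] at key
  have := mul_le_mul_of_nonneg_left h8 (by positivity : 0 ≤ c * s)
  linarith
lemma wBound (d n : ℕ) (x : Euc d) (xs : Fin (n + 1) → Euc d) (i : Fin (n + 1))
    (s a : ℝ) (hs : 0 < s) (ha : 0 < a) :
    hilbertWeight d n x xs i ^ 2 ≤
      Real.exp (s * a) * ∏ j, (if j = i then 1 else Real.exp (-(s * ‖x - xs j‖ ^ (-(d : ℝ))))) +
      (‖x - xs i‖ ^ (-(d : ℝ)) / (‖x - xs i‖ ^ (-(d : ℝ)) + a)) ^ 2 := by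
  unfold hilbertWeight
  have hT0 : ∀ j, 0 ≤ ‖x - xs j‖ ^ (-(d : ℝ)) := fun j => Real.rpow_nonneg (norm_nonneg _) _
  generalize hT : (fun j => ‖x - xs j‖ ^ (-(d : ℝ))) = T
  have hT' : ∀ j, ‖x - xs j‖ ^ (-(d : ℝ)) = T j := fun j => by rw [← hT]
  simp only [hT'] at hT0 ⊢
  set S := ∑ j ∈ Finset.univ.erase i, T j with hS
  have hsum : ∑ j, T j = T i + S := (Finset.add_sum_erase _ _ (Finset.mem_univ i)).symm
  have hS0 : 0 ≤ S := Finset.sum_nonneg fun j _ => hT0 j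
  have hprod : ∏ j, (if j = i then 1 else Real.exp (-(s * T j))) = Real.exp (-(s * S)) := by
    rw [← Finset.mul_prod_erase _ _ (Finset.mem_univ i), if_pos rfl, one_mul, hS, Finset.mul_sum,
      ← Finset.sum_neg_distrib, Real.exp_sum]
    apply Finset.prod_congr rfl
    intro j hj
    rw [if_neg (Finset.ne_of_mem_erase hj)]
  rw [hprod, hsum, ← Real.exp_add]
  have hTi := hT0 i
  by_cases h : S < a
  · have h1 : 1 ≤ Real.exp (s * a + -(s * S)) := by
      rw [Real.one_le_exp_iff]
      nlinarith
    have h2 : T i / (T i + S) ≤ 1 := div_le_one_of_le₀ (by linarith) (by linarith)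
    have h3 : 0 ≤ T i / (T i + S) := by positivity
    nlinarith [sq_nonneg (T i / (T i + a))]
  · have h1 : T i / (T i + S) ≤ T i / (T i + a) :=
      div_le_div_of_nonneg_left hTi (by linarith) (by linarith)
    have h3 : 0 ≤ T i / (T i + S) := by positivity
    have := pow_le_pow_left₀ h3 h1 2
    have := Real.exp_pos (s * a + -(s * S))
    linarith

lemma varBound (d n : ℕ) (ρ σ : Euc d → ℝ) (hρ_nonneg : ∀ y, 0 ≤ ρ y)
    (hρ_prob : (∫ y, ρ y) = 1) (x : Euc d)
    (σ₀ : ℝ) (hσ_bound : ∀ y, 0 < ρ y → σ y ^ 2 ≤ σ₀ ^ 2)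
    (s a : ℝ) (hs : 0 < s) (ha : 0 < a) (hint : Integrable ρ)
    (hinte : Integrable (fun y => ρ y * Real.exp (-(s * ‖x - y‖ ^ (-(d : ℝ))))))
    (hintg : Integrable
      (fun y => ρ y * ((‖x - y‖ ^ (-(d : ℝ))) / (‖x - y‖ ^ (-(d : ℝ)) + a)) ^ 2)) :
    hilbertVariance d n x ρ σ ≤ σ₀ ^ 2 * ((n + 1) *
      (Real.exp (s * a) * (∫ y, ρ y * Real.exp (-(s * ‖x - y‖ ^ (-(d : ℝ))))) ^ n +
       ∫ y, ρ y * ((‖x - y‖ ^ (-(d : ℝ))) / (‖x - y‖ ^ (-(d : ℝ)) + a)) ^ 2)) := by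
  set p : Euc d → ℝ := fun y => ρ y * Real.exp (-(s * ‖x - y‖ ^ (-(d : ℝ)))) with hp
  set q : Euc d → ℝ := fun y => ρ y * ((‖x - y‖ ^ (-(d : ℝ))) / (‖x - y‖ ^ (-(d : ℝ)) + a)) ^ 2
    with hq
  set P : Fin (n + 1) → Fin (n + 1) → Euc d → ℝ := fun i j => if j = i then ρ else p with hP
  set Q : Fin (n + 1) → Fin (n + 1) → Euc d → ℝ := fun i j => if j = i then q else ρ with hQ
  have hPi : ∀ i, Integrable (fun xs : Fin (n + 1) → Euc d => ∏ j, P i j (xs j)) := by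
    intro i
    apply Integrable.fintype_prod
    intro j
    simp only [hP]; split_ifs
    · exact hint
    · exact hinte
  have hQi : ∀ i, Integrable (fun xs : Fin (n + 1) → Euc d => ∏ j, Q i j (xs j)) := by
    intro i
    apply Integrable.fintype_prod
    intro j
    simp only [hQ]; split_ifs
    · exact hintg
    · exact hint
  have hPv : ∀ i, ∫ xs : Fin (n + 1) → Euc d, ∏ j, P i j (xs j) = (∫ y, p y) ^ n := by
    intro i
    rw [integral_fintype_prod_volume_eq_prod, ← Finset.mul_prod_erase _ _ (Finset.mem_univ i)]
    simp only [hP, if_pos, hρ_prob, one_mul]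
    rw [Finset.prod_congr rfl (g := fun _ => ∫ y, p y)]
    · simp
    · intro j hj
      rw [if_neg (Finset.ne_of_mem_erase hj)]
  have hQv : ∀ i, ∫ xs : Fin (n + 1) → Euc d, ∏ j, Q i j (xs j) = ∫ y, q y := by
    intro i
    rw [integral_fintype_prod_volume_eq_prod, ← Finset.mul_prod_erase _ _ (Finset.mem_univ i)]
    simp only [hQ, if_pos]
    rw [Finset.prod_congr rfl (g := fun _ => (1 : ℝ))]
    · simp
    · intro j hj
      rw [if_neg (Finset.ne_of_mem_erase hj), hρ_prob]
  have hI : ∀ i, Integrable (fun xs : Fin (n + 1) → Euc d =>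
      Real.exp (s * a) * ∏ j, P i j (xs j) + ∏ j, Q i j (xs j)) :=
    fun i => ((hPi i).const_mul _).add (hQi i)
  have hv : ∫ xs : Fin (n + 1) → Euc d, σ₀ ^ 2 * ∑ i,
      (Real.exp (s * a) * ∏ j, P i j (xs j) + ∏ j, Q i j (xs j)) =
      σ₀ ^ 2 * ((n + 1) * (Real.exp (s * a) * (∫ y, p y) ^ n + ∫ y, q y)) := by
    rw [integral_const_mul, integral_finsetSum _ (fun i _ => hI i)]
    congr 1
    rw [Finset.sum_congr rfl
      (g := fun _ => (Real.exp (s * a) * (∫ y, p y) ^ n + ∫ y, q y))]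
    · simp
      ring
    · intro i _
      rw [integral_add ((hPi i).const_mul _) (hQi i), integral_const_mul, hPv, hQv]
  rw [← hv]
  unfold hilbertVariance
  apply integral_mono_of_nonneg
  · refine Eventually.of_forall fun xs => mul_nonneg ?_ ?_
    · exact Finset.sum_nonneg fun i _ => by positivity
    · exact Finset.prod_nonneg fun i _ => hρ_nonneg _
  · exact (integrable_finsetSum _ (fun i _ => hI i)).const_mul _
  · refine Eventually.of_forall fun xs => ?_
    show (∑ i, hilbertWeight d n x xs i ^ 2 * σ (xs i) ^ 2) * ∏ i, ρ (xs i) ≤ σ₀ ^ 2 * ∑ i,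
      (Real.exp (s * a) * ∏ j, P i j (xs j) + ∏ j, Q i j (xs j))
    rw [Finset.sum_mul, Finset.mul_sum]
    apply Finset.sum_le_sum
    intro i _
    have hR : 0 ≤ ∏ i, ρ (xs i) := Finset.prod_nonneg fun i _ => hρ_nonneg _
    have e1 : ∏ j, P i j (xs j) = (∏ j, (if j = i then 1 else
        Real.exp (-(s * ‖x - xs j‖ ^ (-(d : ℝ)))))) * ∏ j, ρ (xs j) := by
      rw [← Finset.prod_mul_distrib]
      apply Finset.prod_congr rfl
      intro j _
      simp only [hP]; split_ifs
      · simp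
      · simp [hp, mul_comm]
    have e2 : ∏ j, Q i j (xs j) =
        (‖x - xs i‖ ^ (-(d : ℝ)) / (‖x - xs i‖ ^ (-(d : ℝ)) + a)) ^ 2 * ∏ j, ρ (xs j) := by
      rw [← Finset.mul_prod_erase _ _ (Finset.mem_univ i),
        ← Finset.mul_prod_erase _ (fun j => ρ (xs j)) (Finset.mem_univ i)]
      rw [Finset.prod_congr rfl (g := fun j => ρ (xs j))]
      · simp only [hQ, if_pos, hq]; ring
      · intro j hj
        simp only [hQ]
        rw [if_neg (Finset.ne_of_mem_erase hj)]
    rw [e1, e2, ← mul_assoc, ← add_mul, ← mul_assoc]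
    rcases hR.eq_or_lt with h0 | h0
    · rw [← h0]; simp
    · apply mul_le_mul_of_nonneg_right _ hR
      have hi : 0 < ρ (xs i) := by
        refine lt_of_le_of_ne (hρ_nonneg _) fun h => h0.ne' ?_
        exact Finset.prod_eq_zero (Finset.mem_univ i) h.symm
      rw [mul_comm (σ₀ ^ 2)]
      exact mul_le_mul (wBound d n x xs i s a hs ha) (hσ_bound _ hi) (sq_nonneg _)
        ((sq_nonneg _).trans (wBound d n x xs i s a hs ha))

lemma exEta (ε : ℝ) (hε : 0 < ε) :
    ∃ η : ℝ, 0 < η ∧ η < 1 ∧ (1 + η) ^ 2 / (1 - η) ^ 3 + η ≤ 1 + ε := by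
  have hc : ContinuousAt (fun η : ℝ => (1 + η) ^ 2 / (1 - η) ^ 3 + η) 0 := by
    apply ContinuousAt.add _ continuousAt_id
    apply ContinuousAt.div (by fun_prop) (by fun_prop)
    norm_num
  have h1 : ∀ᶠ η in nhds (0 : ℝ), (1 + η) ^ 2 / (1 - η) ^ 3 + η < 1 + ε :=
    hc.eventually_lt_const (by norm_num; exact hε)
  have h2 : ∀ᶠ η in nhds (0 : ℝ), η < 1 := eventually_lt_nhds (by norm_num)
  have h3 := (h1.and h2).filter_mono (nhdsWithin_le_nhds (s := Set.Ioi 0))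
  obtain ⟨η, ⟨h4, h5⟩, h6⟩ := (h3.and self_mem_nhdsWithin).exists
  exact ⟨η, h6, h5, h4.le⟩

/-- if the conditional variance is bounded, `σ²(y) ≤ σ₀²` on the support of `ρ`,
then for every `ε > 0` there is `N` with `V(x) ≤ (1+ε)·σ₀²/ln(n)` for all `n ≥ N`. -/
theorem hilbert_variance_upper_bound
    (d : ℕ) (hd : 1 ≤ d)
    (ρ : Euc d → ℝ) (hρ_meas : Measurable ρ) (hρ_nonneg : ∀ y, 0 ≤ ρ y)
    (hρ_prob : (∫ y, ρ y) = 1)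
    (hρ_var : Integrable (fun y => ρ y * ‖y‖ ^ 2))
    (x : Euc d) (hx : x ∈ interior {y | 0 < ρ y}) (hρ_cont : ContinuousAt ρ x)
    (σ : Euc d → ℝ) (hσ_meas : Measurable σ)
    (σ₀ : ℝ) (hσ_bound : ∀ y, 0 < ρ y → σ y ^ 2 ≤ σ₀ ^ 2) :
    ∀ ε > (0 : ℝ), ∃ N : ℕ, ∀ n ≥ N,
      hilbertVariance d n x ρ σ ≤ (1 + ε) * σ₀ ^ 2 / Real.log n := by
  intro ε hε
  have hint : Integrable ρ := by
    by_contra h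
    rw [integral_undef h] at hρ_prob
    norm_num at hρ_prob
  have hTm : Measurable (fun y : Euc d => ‖x - y‖ ^ (-(d : ℝ))) := by fun_prop
  have hinte : ∀ s : ℝ, 0 < s →
      Integrable (fun y => ρ y * Real.exp (-(s * ‖x - y‖ ^ (-(d : ℝ))))) := by
    intro s hs
    apply hint.mul_of_top_left
    apply memLp_top_of_bound (C := 1)
    · exact (by fun_prop : Measurable _).aestronglyMeasurable
    · refine Eventually.of_forall fun y => ?_
      rw [Real.norm_eq_abs, Real.abs_exp, Real.exp_le_one_iff, neg_nonpos]
      positivity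
  have hintg : ∀ a : ℝ, 0 < a → Integrable
      (fun y => ρ y * ((‖x - y‖ ^ (-(d : ℝ))) / (‖x - y‖ ^ (-(d : ℝ)) + a)) ^ 2) := by
    intro a ha
    apply hint.mul_of_top_left
    apply memLp_top_of_bound (C := 1)
    · exact (by fun_prop : Measurable _).aestronglyMeasurable
    · refine Eventually.of_forall fun y => ?_
      have hT : 0 ≤ ‖x - y‖ ^ (-(d : ℝ)) := by positivity
      rw [Real.norm_eq_abs, abs_of_nonneg (by positivity)]
      apply pow_le_one₀ (by positivity)
      exact div_le_one_of_le₀ (by linarith) (by linarith)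
  have hx0 : 0 < ρ x := by
    have h : x ∈ {y | 0 < ρ y} := interior_subset hx
    exact h
  obtain ⟨c, hc⟩ : ∃ c, c = ρ x * volume.real (Metric.ball (0 : Euc d) 1) := ⟨_, rfl⟩
  have hc0 : 0 < c := by
    rw [hc]
    apply mul_pos hx0
    exact ENNReal.toReal_pos (Metric.measure_ball_pos _ _ one_pos).ne' measure_ball_lt_top.ne
  obtain ⟨η, hη0, hη1, hηε⟩ := exEta ε hε
  have hg := gBound d hd ρ hρ_nonneg hρ_prob x hx0 hρ_cont c hc hc0 η hη0
  have hφ := phiBound d hd ρ hρ_nonneg hρ_prob x hx0 hρ_cont c hc hc0 η hη0 hη1 hinte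
  obtain ⟨k, hk⟩ : ∃ k, k = 1 - η := ⟨_, rfl⟩
  have hk0 : 0 < k := by rw [hk]; linarith
  have hcast : Tendsto (fun n : ℕ => (n : ℝ)) atTop atTop := tendsto_natCast_atTop_atTop
  have hlog : Tendsto (fun n : ℕ => Real.log n) atTop atTop := Real.tendsto_log_atTop.comp hcast
  have hst : Tendsto (fun n : ℕ => (n : ℝ) ^ (-k)) atTop (nhdsWithin 0 (Set.Ioi 0)) := by
    rw [tendsto_nhdsWithin_iff]
    refine ⟨(tendsto_rpow_neg_atTop hk0).comp hcast, ?_⟩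
    filter_upwards [eventually_gt_atTop 0] with n hn
    have : (0 : ℝ) < n := by exact_mod_cast hn
    exact Real.rpow_pos_of_pos this _
  have hat : Tendsto (fun n : ℕ => k ^ 3 * c * ((n : ℝ) * Real.log n)) atTop atTop :=
    (hcast.atTop_mul_atTop₀ hlog).const_mul_atTop (by positivity)
  have hnη : Tendsto (fun n : ℕ => k ^ 2 * η * c * (n : ℝ) ^ η) atTop atTop :=
    ((tendsto_rpow_atTop hη0).comp hcast).const_mul_atTop (by positivity)
  have hev := (hst.eventually hφ).and ((hat.eventually hg).and
    ((hnη.eventually_ge_atTop 4).and ((hlog.eventually_ge_atTop 1).and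
    ((hcast.eventually_ge_atTop 2).and (hcast.eventually_ge_atTop (2 / η))))))
  obtain ⟨N, hN⟩ := eventually_atTop.1 hev
  refine ⟨N, fun n hn => ?_⟩
  obtain ⟨h1, h2, h3, h4, h5, h6⟩ := hN n hn
  have hn0 : (0 : ℝ) < n := by linarith
  obtain ⟨s, hs⟩ : ∃ s, s = (n : ℝ) ^ (-k) := ⟨_, rfl⟩
  obtain ⟨L, hL⟩ : ∃ L, L = Real.log n := ⟨_, rfl⟩
  have hs0 : 0 < s := by rw [hs]; positivity
  have hlogs : -Real.log s = k * L := by rw [hs, Real.log_rpow hn0, hL]; ring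
  have hns : n * s = (n : ℝ) ^ η := by
    rw [hs]
    nth_rewrite 1 [← Real.rpow_one (n : ℝ)]
    rw [← Real.rpow_add hn0]
    congr 1; rw [hk]; ring
  rw [← hs, hlogs, ← hk] at h1
  rw [← hL] at h2 h4 ⊢
  rw [← hns] at h3
  obtain ⟨a, ha⟩ : ∃ a, a = k ^ 3 * c * (n * L) := ⟨_, rfl⟩
  have hL0 : 0 < L := by linarith
  have ha0 : 0 < a := by rw [ha]; positivity
  rw [← ha] at h2
  have hV := varBound d n ρ σ hρ_nonneg hρ_prob x σ₀ hσ_bound s a hs0 ha0 hint (hinte s hs0)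
    (hintg a ha0)
  have hφ0 : 0 ≤ ∫ y, ρ y * Real.exp (-(s * ‖x - y‖ ^ (-(d : ℝ)))) :=
    integral_nonneg fun y => mul_nonneg (hρ_nonneg y) (Real.exp_pos _).le
  generalize (∫ y, ρ y * Real.exp (-(s * ‖x - y‖ ^ (-(d : ℝ))))) = φ at hV h1 hφ0
  generalize (∫ y, ρ y * ((‖x - y‖ ^ (-(d : ℝ))) / (‖x - y‖ ^ (-(d : ℝ)) + a)) ^ 2) = g at hV h2
  have hφn : Real.exp (s * a) * φ ^ n ≤ 1 / (n : ℝ) ^ 4 := by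
    have e1 : φ ≤ Real.exp (-(k * c * s * (k * L))) := by
      linarith [Real.add_one_le_exp (-(k * c * s * (k * L)))]
    have e2 : φ ^ n ≤ Real.exp (n * -(k * c * s * (k * L))) := by
      rw [Real.exp_nat_mul]
      exact pow_le_pow_left₀ hφ0 e1 n
    calc Real.exp (s * a) * φ ^ n ≤ Real.exp (s * a) * Real.exp (n * -(k * c * s * (k * L))) :=
          mul_le_mul_of_nonneg_left e2 (Real.exp_pos _).le
      _ = Real.exp (-(k ^ 2 * η * c * (n * s) * L)) := by
          rw [← Real.exp_add, ha]
          congr 1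
          have : η = 1 - k := by rw [hk]; ring
          rw [this]; ring
      _ ≤ Real.exp (-((4 : ℕ) * L)) := by
          apply Real.exp_le_exp.2
          push_cast
          nlinarith
      _ = 1 / (n : ℝ) ^ 4 := by
          rw [Real.exp_neg, Real.exp_nat_mul, hL, Real.exp_log hn0, one_div]
  have hLn : L ≤ n := by rw [hL]; exact (Real.log_le_sub_one_of_pos hn0).trans (by linarith)
  have hA : ((n : ℝ) + 1) * (1 / (n : ℝ) ^ 4) ≤ η / L := by
    rw [div_le_iff₀ hη0] at h6
    rw [le_div_iff₀ hL0, mul_one_div, div_mul_eq_mul_div, div_le_iff₀ (by positivity)]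
    have q1 : ((n : ℝ) + 1) * L ≤ (2 * n) * n :=
      mul_le_mul (by linarith) hLn hL0.le (by positivity)
    have q2 : (2 * n) * n ≤ (n * η) * n * n := by
      have := mul_le_mul_of_nonneg_right h6 (by positivity : (0 : ℝ) ≤ n * n)
      linarith
    have q3 : (n * η) * n * n ≤ η * (n : ℝ) ^ 4 := by
      have : 0 ≤ η * (n : ℝ) ^ 3 * (n - 1) := by
        apply mul_nonneg (by positivity); linarith
      nlinarith
    linarith
  have hB : ((n : ℝ) + 1) * g ≤ (1 + η) ^ 2 / k ^ 3 / L := by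
    have q0 : (n : ℝ) + 1 ≤ n * (1 + η) := by
      rw [div_le_iff₀ hη0] at h6; linarith
    calc ((n : ℝ) + 1) * g ≤ ((n : ℝ) + 1) * ((1 + η) * c / a) :=
          mul_le_mul_of_nonneg_left h2 (by positivity)
      _ ≤ (n * (1 + η)) * ((1 + η) * c / a) := mul_le_mul_of_nonneg_right q0 (by positivity)
      _ = _ := by rw [ha]; field_simp
  have hC : ((n : ℝ) + 1) * (Real.exp (s * a) * φ ^ n + g) ≤ (1 + ε) / L := by
    have q1 := mul_le_mul_of_nonneg_left hφn (by positivity : (0 : ℝ) ≤ (n : ℝ) + 1)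
    have q2 : ((1 + η) ^ 2 / k ^ 3 + η) / L ≤ (1 + ε) / L := by
      rw [hk]; gcongr
    rw [add_div] at q2
    rw [mul_add]
    linarith
  calc _ ≤ _ := hV
    _ ≤ σ₀ ^ 2 * ((1 + ε) / L) := mul_le_mul_of_nonneg_left hC (sq_nonneg _)
    _ = _ := by ring

end
end
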